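/- Fix r ≥ 1, n ≥ 2r, σ > 0, and θ* ∈ ℝ^n with D^{(r)}θ* ≠ 0. With v*, v_0 and λ* defined as in the context, there is a constant C_r depending only on r such that for every regularization parameter λ ≥ λ*, the penalized trend filtering estimator satisfies R(θ̂^{(r)}_λ, θ*) ≤ C_r σ² Δ_r(θ*) + (64σ²/n)·(‖v*‖²/‖v_0‖²) + (4σ²/n^{3−2r})·(λ − λ*)²·‖v*‖². -/

import Mathlib

open MeasureTheory ProbabilityTheory
open scoped BigOperators

noncomputable section

/-- Zero-padding of a finite vector to a sequence on `ℕ`. -/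
def pad {n : ℕ} (θ : Fin n → ℝ) : ℕ → ℝ := fun t => if h : t < n then θ ⟨t, h⟩ else 0

/-- First-order forward difference of a sequence. -/
def dseq (f : ℕ → ℝ) : ℕ → ℝ := fun t => f (t + 1) - f t

/-- `DD r θ t` is the `t`-th entry (0-indexed) of the `r`-th order difference `D^{(r)} θ`
of the vector `θ ∈ ℝ^n`; only the entries `t < n - r` are meaningful. -/
def DD (r : ℕ) {n : ℕ} (θ : Fin n → ℝ) : ℕ → ℝ := dseq^[r] (pad θ)

/-- The ℓ¹ norm `‖D^{(r)} θ‖₁`. -/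
def Dl1 (r : ℕ) {n : ℕ} (θ : Fin n → ℝ) : ℝ := ∑ t ∈ Finset.range (n - r), |DD r θ t|

/-- The number of nonzero entries `‖D^{(r)} θ‖₀`. -/
def Dl0 (r : ℕ) {n : ℕ} (θ : Fin n → ℝ) : ℕ :=
  ((Finset.range (n - r)).filter fun t => DD r θ t ≠ 0).card

/-- Squared Euclidean norm. -/
def sqnorm {n : ℕ} (x : Fin n → ℝ) : ℝ := ∑ i, x i ^ 2

/-- Euclidean norm. -/
def eunorm {n : ℕ} (x : Fin n → ℝ) : ℝ := Real.sqrt (sqnorm x)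

/-- `V^{(r)}(θ) = n^{r-1} ‖D^{(r)} θ‖₁`. -/
def Vr (r : ℕ) {n : ℕ} (θ : Fin n → ℝ) : ℝ := (n : ℝ) ^ ((r : ℤ) - 1) * Dl1 r θ

/-- The constraint set `K^{(r)}(V) = {θ : ‖D^{(r)} θ‖₁ ≤ V n^{1-r}}`. -/
def Kset (r n : ℕ) (V : ℝ) : Set (Fin n → ℝ) := {θ | Dl1 r θ ≤ V * (n : ℝ) ^ (1 - (r : ℤ))}

/-- `est` is a least-squares projection onto the set `K`. -/
def IsProjOn {n : ℕ} (est : (Fin n → ℝ) → Fin n → ℝ) (K : Set (Fin n → ℝ)) : Prop :=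
  ∀ y, est y ∈ K ∧ ∀ θ ∈ K, sqnorm (y - est y) ≤ sqnorm (y - θ)

/-- `est` is the penalized trend filtering estimator of order `r` with noise level `σ`
and tuning parameter `lam`: it minimizes `½‖y - θ‖² + σ n^{r-1} lam ‖D^{(r)} θ‖₁`. -/
def IsPenEst (r : ℕ) {n : ℕ} (σ lam : ℝ) (est : (Fin n → ℝ) → Fin n → ℝ) : Prop :=
  ∀ y θ, 1 / 2 * sqnorm (y - est y) + σ * (n : ℝ) ^ ((r : ℤ) - 1) * lam * Dl1 r (est y) ≤
    1 / 2 * sqnorm (y - θ) + σ * (n : ℝ) ^ ((r : ℤ) - 1) * lam * Dl1 r θ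

/-- The Gaussian measure `N_n(0, σ² I_n)` on `ℝ^n`. -/
def gaussVec (n : ℕ) (σ : ℝ) : Measure (Fin n → ℝ) :=
  Measure.pi fun _ => gaussianReal 0 (σ ^ 2).toNNReal

/-- The risk `R(θ̂, θ*) = (1/n) E ‖θ̂(θ* + ξ) - θ*‖²` for `ξ ∼ N_n(0, σ² I_n)`. -/
def risk {n : ℕ} (σ : ℝ) (est : (Fin n → ℝ) → Fin n → ℝ) (θs : Fin n → ℝ) : ℝ :=
  1 / (n : ℝ) * ∫ ξ, sqnorm (est (θs + ξ) - θs) ∂gaussVec n σ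

/-- `j` (with signs `sg`) enumerates, in increasing order and paper (1-indexed) convention,
exactly the `r`-th order knots of `θ ∈ ℝ^n`; an index `2 ≤ m ≤ n - r + 1` is a knot when
`(D^{(r-1)}θ)_{m-1} ≠ (D^{(r-1)}θ)_m` (1-indexed entries), and its sign is `+1` when
`(D^{(r-1)}θ)_{m-1} < (D^{(r-1)}θ)_m` and `-1` otherwise. -/
def IsKnotSeq (r n : ℕ) (θ : Fin n → ℝ) (k : ℕ) (j : Fin k → ℕ) (sg : Fin k → ℝ) : Prop :=
  StrictMono j ∧ (∀ i, 2 ≤ j i ∧ j i ≤ n - r + 1) ∧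
    (∀ m : ℕ, 2 ≤ m → m ≤ n - r + 1 →
      (DD (r - 1) θ (m - 2) ≠ DD (r - 1) θ (m - 1) ↔ ∃ i, j i = m)) ∧
    ∀ i, sg i = if DD (r - 1) θ (j i - 2) < DD (r - 1) θ (j i - 1) then 1 else -1

/-- Extended knot sequence: `jext 0 = j_0 = 1`, `jext i = j_i` for `1 ≤ i ≤ k`, and
`jext (k+1) = j_{k+1} = n - r + 2`. -/
def jext (n r k : ℕ) (j : Fin k → ℕ) : ℕ → ℕ := fun i =>
  if i = 0 then 1 else if h : i - 1 < k then j ⟨i - 1, h⟩ else n - r + 2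

/-- Extended sign sequence: `sgext i = 𝔯_i` for `1 ≤ i ≤ k` and `0` otherwise. -/
def sgext (k : ℕ) (sg : Fin k → ℝ) : ℕ → ℝ := fun i =>
  if h : 0 < i ∧ i - 1 < k then sg ⟨i - 1, h.2⟩ else 0

/-- The lengths `n_0 = j_1 + r - 2`, `n_i = j_{i+1} - j_i` (`1 ≤ i ≤ k-1`),
`n_k = n - r + 2 - j_k`. -/
def nlen (n r k : ℕ) (j : Fin k → ℕ) : ℕ → ℕ := fun i =>
  if i = 0 then jext n r k j 1 + r - 2 else jext n r k j (i + 1) - jext n r k j i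

/-- `n_{i*} = min(n_i, n/(k+1))`. -/
def nstar (n r k : ℕ) (j : Fin k → ℕ) (i : ℕ) : ℝ :=
  min (nlen n r k j i : ℝ) ((n : ℝ) / ((k : ℝ) + 1))

/-- `δ_r(θ)²` defined from the knot data of `θ`. -/
def deltaSq (n r k : ℕ) (j : Fin k → ℕ) (sg : Fin k → ℝ) : ℝ :=
  nstar n r k j 0 ^ (1 - 2 * (r : ℤ)) + nstar n r k j k ^ (1 - 2 * (r : ℤ)) +
    ∑ i ∈ Finset.Ico 1 k,
      if sgext k sg i ≠ sgext k sg (i + 1) then nstar n r k j i ^ (1 - 2 * (r : ℤ)) else 0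

/-- `Δ_r(θ)` defined from the knot data of `θ`. -/
def DeltaR (n r k : ℕ) (j : Fin k → ℕ) (sg : Fin k → ℝ) : ℝ :=
  ((k : ℝ) + 1) / (n : ℝ) * Real.log (Real.exp 1 * (n : ℝ) / ((k : ℝ) + 1)) +
    deltaSq n r k j sg / (n : ℝ) * ((n : ℝ) / ((k : ℝ) + 1)) ^ (2 * (r : ℤ) - 1) *
      Real.log (Real.exp 1 * (n : ℝ) / ((k : ℝ) + 1)) +
    (Real.sqrt (deltaSq n r k j sg) / Real.sqrt (n : ℝ)) ^ ((1 : ℝ) / (r : ℝ))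

/-- The minimum length condition with constant `c`: `n_i ≥ c n/(k+1)` for every `0 ≤ i ≤ k`
with `𝔯_i ≠ 𝔯_{i+1}` (where `𝔯_0 = 𝔯_{k+1} = 0`). -/
def MinLen (n r k : ℕ) (j : Fin k → ℕ) (sg : Fin k → ℝ) (c : ℝ) : Prop :=
  ∀ i ≤ k, sgext k sg i ≠ sgext k sg (i + 1) →
    c * (n : ℝ) / ((k : ℝ) + 1) ≤ (nlen n r k j i : ℝ)

/-- The subdifferential of `g` at `θ`. -/
def subdiff {n : ℕ} (g : (Fin n → ℝ) → ℝ) (θ : Fin n → ℝ) : Set (Fin n → ℝ) :=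
  {v | ∀ y, g θ + ∑ i, v i * (y i - θ i) ≤ g y}

/-- `v` is the minimum-norm element of `S`. -/
def IsMinNormIn {n : ℕ} (v : Fin n → ℝ) (S : Set (Fin n → ℝ)) : Prop :=
  v ∈ S ∧ ∀ w ∈ S, eunorm v ≤ eunorm w

/-- `c • S`. -/
def scaleSet {n : ℕ} (c : ℝ) (S : Set (Fin n → ℝ)) : Set (Fin n → ℝ) := (c • ·) '' S

/-- The cone generated by `S`: `⋃_{c ≥ 0} c • S`. -/
def coneOf {n : ℕ} (S : Set (Fin n → ℝ)) : Set (Fin n → ℝ) := ⋃ c ∈ Set.Ici (0 : ℝ), scaleSet c S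

/-- Euclidean distance from a point to a set. -/
def distSet {n : ℕ} (z : Fin n → ℝ) (S : Set (Fin n → ℝ)) : ℝ :=
  sInf ((fun v => eunorm (z - v)) '' S)

/-- Gaussian mean squared distance `D(S) = E dist²(Z, S)`, `Z ∼ N_n(0, I_n)`. -/
def gaussMSD {n : ℕ} (S : Set (Fin n → ℝ)) : ℝ := ∫ z, distSet z S ^ 2 ∂gaussVec n 1

/-- `lam z` is, for each `z`, the minimizer over `λ ≥ 0` of `dist(z, λ S)`. -/
def IsLamFun {n : ℕ} (S : Set (Fin n → ℝ)) (lam : (Fin n → ℝ) → ℝ) : Prop :=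
  ∀ z, 0 ≤ lam z ∧ ∀ μ : ℝ, 0 ≤ μ → distSet z (scaleSet (lam z) S) ≤ distSet z (scaleSet μ S)

/-- Euclidean covering number of `K` at scale `ε`. -/
def covN {n : ℕ} (ε : ℝ) (K : Set (Fin n → ℝ)) : ℕ :=
  sInf {m : ℕ | ∃ a : Fin m → Fin n → ℝ, ∀ x ∈ K, ∃ i, eunorm (x - a i) ≤ ε}

/-- `K` `t`-shatters the (finite) index set `A`. -/
def fatShatters {n : ℕ} (K : Set (Fin n → ℝ)) (t : ℝ) (A : Finset (Fin n)) : Prop :=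
  ∃ h : Fin n → ℝ, ∀ S : Finset (Fin n), S ⊆ A →
    ∃ θ ∈ K, (∀ i ∈ S, θ i ≤ h i) ∧ ∀ i ∈ A, i ∉ S → h i + t ≤ θ i

/-- The fat shattering dimension `v(K, t)`. -/
def fatDim {n : ℕ} (K : Set (Fin n → ℝ)) (t : ℝ) : ℕ :=
  sSup {m : ℕ | ∃ A : Finset (Fin n), A.card = m ∧ fatShatters K t A}

/-- The tangent cone of `K` at `θ`. -/
def tanCone {n : ℕ} (K : Set (Fin n → ℝ)) (θ : Fin n → ℝ) : Set (Fin n → ℝ) :=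
  closure {w | ∃ t : ℝ, 0 ≤ t ∧ ∃ η ∈ K, w = t • (η - θ)}

/-- `V_{a,b}(f) = Σ_{m=a+1}^{b} |f_m - f_{m-1}|` for the (paper 1-indexed) sequence whose
`m`-th entry is `f (m-1)`. -/
def Vab (f : ℕ → ℝ) (a b : ℕ) : ℝ := ∑ t ∈ Finset.Ico (a - 1) (b - 1), |f (t + 1) - f t|

/-- `Acoef r n v j = Σ_{i=j}^n C(r+i-j-1, r-1) v_i` (paper 1-indexed). -/
def Acoef (r n : ℕ) (v : Fin n → ℝ) (jj : ℕ) : ℝ :=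
  ∑ i : Fin n, (if jj ≤ i.1 + 1 then ((r + (i.1 + 1) - jj - 1).choose (r - 1) : ℝ) else 0) * v i

/-- The class `C_r({a_i}, {s_i})`. -/
def Cras (r n : ℕ) (a s : ℕ → ℝ) : Set (Fin n → ℝ) :=
  {θ | (∀ i < r - 1, a i ≤ DD i θ 0 ∧ DD i θ 0 ≤ a i + s i) ∧
    a (r - 1) ≤ DD (r - 1) θ 0 ∧
    (∀ t : ℕ, t + 1 ≤ n - r → DD (r - 1) θ t ≤ DD (r - 1) θ (t + 1)) ∧
    DD (r - 1) θ (n - r) ≤ a (r - 1) + s (r - 1)}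

/-- The class `C_r(a, V) = {θ : a ≤ (D^{(r-1)}θ)_1 ≤ ⋯ ≤ (D^{(r-1)}θ)_{n-r+1} ≤ a + V}`. -/
def CrMono (r n : ℕ) (a V : ℝ) : Set (Fin n → ℝ) :=
  {θ | a ≤ DD (r - 1) θ 0 ∧
    (∀ t : ℕ, t + 1 ≤ n - r → DD (r - 1) θ t ≤ DD (r - 1) θ (t + 1)) ∧
    DD (r - 1) θ (n - r) ≤ a + V}


section

/-! ### Difference and averaging operators on functions `ℤ → ℝ` -/

/-- Translation by `c`. -/
def shf (c : ℤ) : Module.End ℝ (ℤ → ℝ) where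
  toFun f := fun t => f (t - c)
  map_add' _ _ := rfl
  map_smul' _ _ := rfl

/-- Backward difference. -/
def nab : Module.End ℝ (ℤ → ℝ) where
  toFun f := fun t => f t - f (t - 1)
  map_add' f g := by funext t; simp; ring
  map_smul' c f := by funext t; simp; ring

/-- Moving average with window `h`. -/
def avg (h : ℕ) : Module.End ℝ (ℤ → ℝ) where
  toFun f := fun t => (∑ s ∈ Finset.range h, f (t - (s : ℤ))) / (h : ℝ)
  map_add' f g := by funext t; simp [Finset.sum_add_distrib, add_div]
  map_smul' c f := by funext t; simp [← Finset.mul_sum, mul_div_assoc]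

lemma nab_apply (f : ℤ → ℝ) (t : ℤ) : nab f t = f t - f (t - 1) := rfl
lemma shf_apply (c : ℤ) (f : ℤ → ℝ) (t : ℤ) : shf c f t = f (t - c) := rfl
lemma avg_apply (h : ℕ) (f : ℤ → ℝ) (t : ℤ) :
    avg h f t = (∑ s ∈ Finset.range h, f (t - (s : ℤ))) / (h : ℝ) := rfl

lemma nab_pow_shf (i : ℕ) (c : ℤ) (f : ℤ → ℝ) (t : ℤ) :
    (nab ^ i) (shf c f) t = (nab ^ i) f (t - c) := by
  induction i generalizing t with
  | zero => rfl
  | succ i ih =>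
    rw [pow_succ', Module.End.mul_apply, Module.End.mul_apply, nab_apply, nab_apply, ih, ih, sub_right_comm t 1 c]

lemma nab_avg (h : ℕ) (f : ℤ → ℝ) :
    nab (avg h f) = (1 / (h : ℝ)) • (f - shf h f) := by
  funext t
  rw [nab_apply, avg_apply, avg_apply]
  simp only [Pi.smul_apply, Pi.sub_apply, shf_apply, smul_eq_mul]
  rw [← sub_div, ← Finset.sum_sub_distrib]
  have : ∀ s ∈ Finset.range h, f (t - (s : ℤ)) - f (t - 1 - (s : ℤ))
      = (fun s : ℕ => f (t - (s : ℤ))) s - (fun s : ℕ => f (t - (s : ℤ))) (s + 1) := by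
    intro s _
    simp only
    congr 2; push_cast; ring
  rw [Finset.sum_congr rfl this, Finset.sum_range_sub']
  simp; ring_nf

lemma nab_pow_avg_bound (h : ℕ) (m : ℕ) (f : ℤ → ℝ) (c : ℝ)
    (hc : ∀ t, |((avg h) ^ m) f t| ≤ c) (i : ℕ) (t : ℤ) :
    |(nab ^ i) (((avg h) ^ (m + i)) f) t| ≤ (2 / (h : ℝ)) ^ i * c := by
  induction i generalizing t with
  | zero => simpa using hc t
  | succ i ih =>
    rw [pow_succ, Module.End.mul_apply, ← add_assoc, pow_succ' (avg h), Module.End.mul_apply,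
      nab_avg, map_smul, map_sub, Pi.smul_apply, Pi.sub_apply, nab_pow_shf, smul_eq_mul, abs_mul,
      abs_of_nonneg (by positivity)]
    have h1 := ih t
    have h2 := ih (t - h)
    have h3 := abs_sub ((nab ^ i) (((avg h) ^ (m + i)) f) t)
      ((nab ^ i) (((avg h) ^ (m + i)) f) (t - h))
    have hh : (0 : ℝ) ≤ 1 / h := by positivity
    calc _ ≤ 1 / (h : ℝ) * ((2 / (h : ℝ)) ^ i * c + (2 / (h : ℝ)) ^ i * c) := by
          apply mul_le_mul_of_nonneg_left _ hh
          linarith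
      _ = _ := by rw [pow_succ]; ring

lemma avg_const (h : ℕ) (hh : 1 ≤ h) (f : ℤ → ℝ) (c : ℝ) (t : ℤ)
    (H : ∀ s, t - (h - 1) ≤ s → s ≤ t → f s = c) : avg h f t = c := by
  rw [avg_apply, Finset.sum_congr rfl (g := fun _ => c)]
  · simp
    field_simp
  · intro s hs
    rw [Finset.mem_range] at hs
    exact H _ (by omega) (by omega)

lemma avg_pow_const (h : ℕ) (hh : 1 ≤ h) (m : ℕ) (f : ℤ → ℝ) (c : ℝ) (t : ℤ)
    (H : ∀ s, t - m * ((h : ℤ) - 1) ≤ s → s ≤ t → f s = c) : ((avg h) ^ m) f t = c := by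
  induction m generalizing t with
  | zero => simpa using H t (by simp) le_rfl
  | succ m ih =>
    rw [pow_succ', Module.End.mul_apply]
    apply avg_const h hh
    intro s hs hs2
    apply ih
    intro s' h1 h2
    apply H
    · push_cast; linarith
    · linarith

lemma avg_mem (h : ℕ) (hh : 1 ≤ h) (f : ℤ → ℝ) (l u : ℝ) (H : ∀ s, l ≤ f s ∧ f s ≤ u) (t : ℤ) :
    l ≤ avg h f t ∧ avg h f t ≤ u := by
  have hp : (0 : ℝ) < h := by exact_mod_cast hh
  rw [avg_apply, le_div_iff₀ hp, div_le_iff₀ hp]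
  constructor
  · calc l * h = ∑ s ∈ Finset.range h, l := by simp; ring
      _ ≤ _ := Finset.sum_le_sum fun s _ => (H _).1
  · calc _ ≤ ∑ s ∈ Finset.range h, u := Finset.sum_le_sum fun s _ => (H _).2
      _ = u * h := by simp; ring

lemma avg_pow_mem (h : ℕ) (hh : 1 ≤ h) (m : ℕ) (f : ℤ → ℝ) (l u : ℝ)
    (H : ∀ s, l ≤ f s ∧ f s ≤ u) (t : ℤ) :
    l ≤ ((avg h) ^ m) f t ∧ ((avg h) ^ m) f t ≤ u := by
  induction m generalizing t with
  | zero => simpa using H t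
  | succ m ih =>
    rw [pow_succ', Module.End.mul_apply]
    exact avg_mem h hh _ l u ih t

/-- Supports grow by one for each backward difference. -/
lemma nab_pow_supp (f : ℤ → ℝ) (a b : ℤ) (H : ∀ t, t < a ∨ b ≤ t → f t = 0) (i : ℕ) (t : ℤ)
    (ht : t < a ∨ b + i ≤ t) : (nab ^ i) f t = 0 := by
  induction i generalizing t with
  | zero => simpa using H t (by simpa using ht)
  | succ i ih =>
    rw [pow_succ', Module.End.mul_apply, nab_apply, ih t (by push_cast at ht; omega),
      ih (t - 1) (by push_cast at ht; omega), sub_zero]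

lemma nab_pow_congr (f g : ℤ → ℝ) (i : ℕ) (t : ℤ) (H : ∀ s, t - i ≤ s → s ≤ t → f s = g s) :
    (nab ^ i) f t = (nab ^ i) g t := by
  induction i generalizing t with
  | zero => exact H t (by simp) le_rfl
  | succ i ih =>
    rw [pow_succ', Module.End.mul_apply, Module.End.mul_apply, nab_apply, nab_apply,
      ih t (fun s h1 h2 => H s (by push_cast; omega) h2),
      ih (t - 1) (fun s h1 h2 => H s (by push_cast; omega) (by omega))]

lemma nab_pow_const (c : ℝ) (i : ℕ) (hi : 1 ≤ i) (t : ℤ) : (nab ^ i) (fun _ => c) t = 0 := by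
  obtain ⟨i, rfl⟩ : ∃ m, i = m + 1 := ⟨i - 1, by omega⟩
  rw [pow_succ, Module.End.mul_apply]
  have : nab (fun _ => c) = 0 := by funext t; simp [nab_apply]
  rw [this, map_zero]; rfl

/-! ### Smooth steps and bumps -/

/-- A smoothed unit step, going from `0` to `1` on `[τ, τ + r (h-1)]`. -/
def stp (r h : ℕ) (τ : ℤ) : ℤ → ℝ := ((avg h) ^ r) (fun t => if τ ≤ t then 1 else 0)

lemma stp_zero (r h : ℕ) (hh : 1 ≤ h) (τ t : ℤ) (ht : t < τ) : stp r h τ t = 0 := by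
  apply avg_pow_const h hh
  intro s _ h2
  rw [if_neg (by omega)]

lemma stp_one (r h : ℕ) (hh : 1 ≤ h) (τ t : ℤ) (ht : τ + r * ((h : ℤ) - 1) ≤ t) :
    stp r h τ t = 1 := by
  apply avg_pow_const h hh
  intro s _ h2
  rw [if_pos (by omega)]

lemma stp_mem (r h : ℕ) (hh : 1 ≤ h) (τ t : ℤ) : 0 ≤ stp r h τ t ∧ stp r h τ t ≤ 1 := by
  apply avg_pow_mem h hh
  intro s; split_ifs <;> simp

lemma stp_nab (r h : ℕ) (τ t : ℤ) : |(nab ^ r) (stp r h τ) t| ≤ (2 / (h : ℝ)) ^ r := by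
  have := nab_pow_avg_bound h 0 (fun t => if τ ≤ t then 1 else 0) 1
    (by intro t; simp; split_ifs <;> simp) r t
  simpa [stp] using this

lemma stp_nab_supp (r h : ℕ) (hr : 1 ≤ r) (hh : 1 ≤ h) (τ t : ℤ)
    (ht : t < τ ∨ τ + r * (h : ℤ) ≤ t) : (nab ^ r) (stp r h τ) t = 0 := by
  rcases ht with ht | ht
  · rw [nab_pow_congr _ (fun _ => 0) r t, nab_pow_const _ _ hr]
    intro s _ h2
    exact stp_zero r h hh τ s (by omega)
  · rw [nab_pow_congr _ (fun _ => 1) r t, nab_pow_const _ _ hr]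
    intro s h1 h2
    apply stp_one r h hh τ s
    linarith

/-- A bump equal to one on `[a, a + r h)`, supported in `[a - r (h-1), a + r h + r (h-1))`. -/
def bmp (r h : ℕ) (a : ℤ) : ℤ → ℝ :=
  ((avg h) ^ r) (fun t => if a - r * ((h : ℤ) - 1) ≤ t ∧ t < a + r * h then 1 else 0)

lemma bmp_one (r h : ℕ) (hh : 1 ≤ h) (a t : ℤ) (h1 : a ≤ t) (h2 : t < a + r * h) :
    bmp r h a t = 1 := by
  apply avg_pow_const h hh
  intro s _ h2
  rw [if_pos (by constructor <;> linarith)]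

lemma bmp_zero (r h : ℕ) (hh : 1 ≤ h) (a t : ℤ)
    (ht : t < a - r * ((h : ℤ) - 1) ∨ a + r * h + r * ((h : ℤ) - 1) ≤ t) :
    bmp r h a t = 0 := by
  apply avg_pow_const h hh
  intro s _ h2
  rw [if_neg]
  rintro ⟨h3, h4⟩
  rcases ht with ht | ht <;> linarith

lemma bmp_mem (r h : ℕ) (hh : 1 ≤ h) (a t : ℤ) : 0 ≤ bmp r h a t ∧ bmp r h a t ≤ 1 := by
  apply avg_pow_mem h hh
  intro s; split_ifs <;> simp

lemma bmp_nab (r h : ℕ) (a t : ℤ) : |(nab ^ r) (bmp r h a) t| ≤ (2 / (h : ℝ)) ^ r := by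
  have := nab_pow_avg_bound h 0
    (fun t => if a - r * ((h : ℤ) - 1) ≤ t ∧ t < a + r * h then 1 else 0) 1
    (by intro t; simp only [pow_zero, Module.End.one_apply]; split_ifs <;> simp) r t
  simpa [bmp] using this

lemma bmp_nab_supp (r h : ℕ) (hh : 1 ≤ h) (a t : ℤ)
    (ht : t < a - r * ((h : ℤ) - 1) ∨ a + r * h + r * h ≤ t) : (nab ^ r) (bmp r h a) t = 0 := by
  apply nab_pow_supp (bmp r h a) (a - r * ((h : ℤ) - 1)) (a + r * h + r * ((h : ℤ) - 1))
    (fun t => bmp_zero r h hh a t)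
  rcases ht with ht | ht
  · left; exact ht
  · right; linarith

lemma stp_nab' (r h i : ℕ) (hi : i ≤ r) (τ t : ℤ) :
    |(nab ^ i) (stp r h τ) t| ≤ (2 / (h : ℝ)) ^ i := by
  by_cases hh : 1 ≤ h
  · have := nab_pow_avg_bound h (r - i) (fun t => if τ ≤ t then 1 else 0) 1
      (by
        intro t
        have := avg_pow_mem h hh (r - i) (fun t => if τ ≤ t then 1 else 0) 0 1
          (by intro s; split_ifs <;> simp) t
        rw [abs_of_nonneg this.1]; exact this.2) i t
    rw [Nat.sub_add_cancel hi] at this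
    simpa [stp] using this
  · have h0 : h = 0 := by omega
    subst h0
    rcases Nat.eq_zero_or_pos i with rfl | hi0
    · rcases Nat.eq_zero_or_pos r with rfl | hr0
      · simp [stp]; split_ifs <;> simp
      · obtain ⟨r, rfl⟩ : ∃ m, r = m + 1 := ⟨r - 1, by omega⟩
        simp [stp, pow_succ', avg_apply]
    · obtain ⟨r, rfl⟩ : ∃ m, r = m + 1 := ⟨r - 1, by omega⟩
      have : stp (r + 1) 0 τ = 0 := by
        funext t
        simp [stp, pow_succ', avg_apply]
      rw [this, map_zero]; simp

/-- Cumulative sum started at `a`. -/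
def cs (a : ℤ) (f : ℤ → ℝ) : ℤ → ℝ := fun t => ∑ s ∈ Finset.Ico a (t + 1), f s

lemma cs_lt (a : ℤ) (f : ℤ → ℝ) (t : ℤ) (ht : t < a) : cs a f t = 0 := by
  unfold cs
  rw [Finset.Ico_eq_empty (by omega), Finset.sum_empty]

lemma nab_cs (a : ℤ) (f : ℤ → ℝ) (hf : ∀ t < a, f t = 0) : nab (cs a f) = f := by
  funext t
  rw [nab_apply]
  by_cases ht : t < a
  · rw [cs_lt _ _ _ ht, cs_lt _ _ _ (by omega), hf t ht, sub_zero]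
  · unfold cs
    rw [show t - 1 + 1 = t by ring]
    have : Finset.Ico a (t + 1) = insert t (Finset.Ico a t) := by
      ext x; simp only [Finset.mem_Ico, Finset.mem_insert]; omega
    rw [this, Finset.sum_insert (by simp)]
    ring

lemma cs_ge (a b : ℤ) (f : ℤ → ℝ) (hf : ∀ t, b ≤ t → f t = 0) (t : ℤ) (ht : b ≤ t + 1) :
    cs a f t = ∑ s ∈ Finset.Ico a b, f s := by
  unfold cs
  symm
  apply Finset.sum_subset
  · intro x; simp only [Finset.mem_Ico]; omega
  · intro x _ hx2
    simp only [Finset.mem_Ico] at *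
    exact hf x (by omega)

/-- One block: tracking of the data `y` on a block of length `r h` by an `r`-th order
difference of a function supported in the block. -/
lemma block_track (r : ℕ) (i : ℕ) (hi1 : 1 ≤ i) : i ≤ r → ∃ C : ℝ, 0 < C ∧
    ∀ (h : ℕ), 1 ≤ h → ∀ (a : ℤ) (y : ℤ → ℝ) (m : ℝ),
    (∀ t, t < a ∨ a + r * h ≤ t → y t = 0) → (∀ t, |cs a y t| ≤ m) →
    ∃ w : ℤ → ℝ, (∀ t, t < a ∨ a + r * h - i ≤ t → w t = 0) ∧
      (∀ t, |w t| ≤ C * ((r : ℝ) * h) ^ (i - 1) * m) ∧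
      (∀ t, |y t - (nab ^ i) w t| ≤ C * (m / h)) := by
  induction i, hi1 using Nat.le_induction with
  | base =>
    intro hir
    refine ⟨2, by norm_num, ?_⟩
    intro h hh a y m hy hm
    have hm0 : 0 ≤ m := (abs_nonneg _).trans (hm a)
    set Y := cs a y (a + r * h - 1) with hY
    have hYm : |Y| ≤ m := hm _
    refine ⟨cs a y - Y • stp r h a, ?_, ?_, ?_⟩
    · intro t ht
      simp only [Pi.sub_apply, Pi.smul_apply, smul_eq_mul]
      rcases ht with ht | ht
      · rw [cs_lt _ _ _ ht, stp_zero r h hh a t ht]; ring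
      · rw [stp_one r h hh a t, cs_ge a (a + r * h) y (fun t ht => hy t (Or.inr ht)) t, hY,
          cs_ge a (a + r * h) y (fun t ht => hy t (Or.inr ht)) _]
        · ring
        · omega
        · push_cast at ht; omega
        · have : (1 : ℤ) ≤ r := by exact_mod_cast hir
          push_cast at ht; linarith
    · intro t
      simp only [Pi.sub_apply, Pi.smul_apply, smul_eq_mul]
      have h1 := stp_mem r h hh a t
      have h2 : |Y * stp r h a t| ≤ m * 1 := by
        rw [abs_mul, abs_of_nonneg h1.1]
        exact mul_le_mul hYm h1.2 h1.1 hm0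
      have h3 := abs_sub (cs a y t) (Y * stp r h a t)
      have h4 := hm t
      simp; linarith
    · intro t
      rw [pow_one, map_sub, nab_cs a y (fun t ht => hy t (Or.inl ht)), map_smul]
      simp only [Pi.sub_apply, Pi.smul_apply, smul_eq_mul]
      have h1 := stp_nab' r h 1 hir a t
      rw [pow_one, pow_one] at h1
      rw [sub_sub_cancel, abs_mul]
      calc |Y| * |nab (stp r h a) t| ≤ m * (2 / h) := by gcongr
        _ = _ := by ring
  | succ i hi1 ih =>
    intro hir
    obtain ⟨C, hC, H⟩ := ih (by omega)
    refine ⟨C * (2 + (r : ℝ) ^ i * 2 ^ (i + 1)), by positivity, ?_⟩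
    intro h hh a y m hy hm
    have hm0 : 0 ≤ m := (abs_nonneg _).trans (hm a)
    obtain ⟨w, hw1, hw2, hw3⟩ := H h hh a y m hy hm
    have hhp : (0 : ℝ) < h := by exact_mod_cast hh
    have hrp : (0 : ℝ) < r := by exact_mod_cast (by omega : 0 < r)
    have hri : (i : ℤ) + 1 ≤ r := by exact_mod_cast hir
    have hcs : ∀ t, |cs a w t| ≤ C * ((r : ℝ) * h) ^ i * m := by
      intro t
      have h1 : cs a w t = ∑ s ∈ (Finset.Ico a (t + 1)).filter (fun s => s < a + r * h), w s := by
        unfold cs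
        rw [Finset.sum_filter_of_ne]
        intro x _ hx
        by_contra h2
        exact hx (hw1 x (Or.inr (by omega)))
      rw [h1]
      have hcard : ((Finset.Ico a (t + 1)).filter (fun s => s < a + r * h)).card ≤ r * h := by
        calc _ ≤ (Finset.Ico a (a + r * h)).card := by
              apply Finset.card_le_card
              intro x; simp only [Finset.mem_filter, Finset.mem_Ico]; omega
          _ = r * h := by rw [Int.card_Ico]; simp; norm_cast
      calc _ ≤ ∑ s ∈ (Finset.Ico a (t + 1)).filter (fun s => s < a + r * h), |w s| :=
            Finset.abs_sum_le_sum_abs _ _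
        _ ≤ ∑ s ∈ (Finset.Ico a (t + 1)).filter (fun s => s < a + r * h),
              C * ((r : ℝ) * h) ^ (i - 1) * m := Finset.sum_le_sum fun s _ => hw2 s
        _ = ((Finset.Ico a (t + 1)).filter (fun s => s < a + r * h)).card *
              (C * ((r : ℝ) * h) ^ (i - 1) * m) := by rw [Finset.sum_const, nsmul_eq_mul]
        _ ≤ ((r * h : ℕ) : ℝ) * (C * ((r : ℝ) * h) ^ (i - 1) * m) := by
              gcongr
        _ = C * ((r : ℝ) * h) ^ i * m := by
              obtain ⟨i', rfl⟩ : ∃ k, i = k + 1 := ⟨i - 1, by omega⟩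
              push_cast; rw [pow_succ]; ring
    set Y := cs a w (a + r * h - 1) with hY
    have hYm : |Y| ≤ C * ((r : ℝ) * h) ^ i * m := hcs _
    have hwz : ∀ t, a + r * h - i ≤ t → w t = 0 := fun t ht => hw1 t (Or.inr ht)
    refine ⟨cs a w - Y • stp r h a, ?_, ?_, ?_⟩
    · intro t ht
      simp only [Pi.sub_apply, Pi.smul_apply, smul_eq_mul]
      rcases ht with ht | ht
      · rw [cs_lt _ _ _ ht, stp_zero r h hh a t ht]; ring
      · rw [stp_one r h hh a t, cs_ge a _ w hwz t, hY, cs_ge a _ w hwz _]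
        · ring
        · omega
        · push_cast at ht; omega
        · push_cast at ht; linarith
    · intro t
      simp only [Pi.sub_apply, Pi.smul_apply, smul_eq_mul]
      have h1 := stp_mem r h hh a t
      have h0 : 0 ≤ C * ((r : ℝ) * h) ^ i * m := by positivity
      have h2 : |Y * stp r h a t| ≤ C * ((r : ℝ) * h) ^ i * m * 1 := by
        rw [abs_mul, abs_of_nonneg h1.1]
        exact mul_le_mul hYm h1.2 h1.1 h0
      have h3 := abs_sub (cs a w t) (Y * stp r h a t)
      have h4 := hcs t
      rw [Nat.add_sub_cancel]
      have h5 : C * (2 + (r : ℝ) ^ i * 2 ^ (i + 1)) * ((r : ℝ) * h) ^ i * m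
        = (2 + (r : ℝ) ^ i * 2 ^ (i + 1)) * (C * ((r : ℝ) * h) ^ i * m) := by ring
      rw [h5]
      have h6 : 2 * (C * ((r : ℝ) * h) ^ i * m) ≤
        (2 + (r : ℝ) ^ i * 2 ^ (i + 1)) * (C * ((r : ℝ) * h) ^ i * m) := by
        apply mul_le_mul_of_nonneg_right _ h0
        have : 0 ≤ (r : ℝ) ^ i * 2 ^ (i + 1) := by positivity
        linarith
      linarith
    · intro t
      have e1 : (nab ^ (i + 1)) (cs a w) = (nab ^ i) w := by
        rw [pow_succ, Module.End.mul_apply, nab_cs a w (fun t ht => hw1 t (Or.inl ht))]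
      rw [map_sub, e1, map_smul]
      simp only [Pi.sub_apply, Pi.smul_apply, smul_eq_mul]
      have h1 := stp_nab' r h (i + 1) hir a t
      have h2 : |Y * (nab ^ (i + 1)) (stp r h a) t| ≤
          C * ((r : ℝ) * h) ^ i * m * (2 / (h : ℝ)) ^ (i + 1) := by
        rw [abs_mul]
        exact mul_le_mul hYm h1 (abs_nonneg _) (by positivity)
      have h3 : C * ((r : ℝ) * h) ^ i * m * (2 / (h : ℝ)) ^ (i + 1)
          = C * (r : ℝ) ^ i * 2 ^ (i + 1) * (m / h) := by
        rw [div_pow, mul_pow, pow_succ (h : ℝ)]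
        field_simp
      have h4 := hw3 t
      have h5 : y t - ((nab ^ i) w t - Y * (nab ^ (i + 1)) (stp r h a) t)
        = (y t - (nab ^ i) w t) + Y * (nab ^ (i + 1)) (stp r h a) t := by ring
      rw [h5]
      have h6 := abs_add_le (y t - (nab ^ i) w t) (Y * (nab ^ (i + 1)) (stp r h a) t)
      have h7 : C * (2 + (r : ℝ) ^ i * 2 ^ (i + 1)) * (m / h)
        = C * (m / h) + C * (m / h) + C * (r : ℝ) ^ i * 2 ^ (i + 1) * (m / h) := by ring
      have h8 : 0 ≤ C * (m / h) := by positivity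
      linarith

end

section

/-- Restriction of a function to the block `[a, a+l)`. -/
def rst (a l : ℤ) (z : ℤ → ℝ) : ℤ → ℝ := fun t => if a ≤ t ∧ t < a + l then z t else 0

lemma block_g (r : ℕ) (hr : 1 ≤ r) : ∃ C : ℝ, 0 < C ∧
    ∀ (h : ℕ), 1 ≤ h → ∀ (a : ℤ) (z : ℤ → ℝ) (m : ℝ),
    (∀ t, |cs a (rst a (r * h) z) t| ≤ m) → ∀ ε : ℝ, ε ^ 2 = 1 →
    ∃ g : ℤ → ℝ, (∀ t, t < a - r * h ∨ a + 2 * (r * h) ≤ t → g t = 0) ∧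
      (∀ t, 0 ≤ ε * g t) ∧
      (∀ t, |g t| ≤ C * ((r : ℝ) * h) ^ (r - 1) * m) ∧
      (∀ t, |rst a (r * h) z t - (nab ^ r) g t| ≤ C * (m / h)) ∧
      (∀ t, t < a - r * h ∨ a + 2 * (r * h) ≤ t → rst a (r * h) z t - (nab ^ r) g t = 0) := by
  obtain ⟨C, hC, H⟩ := block_track r r hr le_rfl
  refine ⟨2 * C + C * (r : ℝ) ^ (r - 1) * 2 ^ r, by positivity, ?_⟩
  intro h hh a z m hm ε hε
  have hm0 : 0 ≤ m := (abs_nonneg _).trans (hm a)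
  have hhp : (0 : ℝ) < h := by exact_mod_cast hh
  have hhz : (1 : ℤ) ≤ h := by exact_mod_cast hh
  have hrz : (1 : ℤ) ≤ r := by exact_mod_cast hr
  have hrh : (0 : ℤ) ≤ r * (h - 1) := mul_nonneg (by omega) (by omega)
  have hrh' : (r : ℤ) * (h - 1) = r * h - r := by ring
  have habs : |ε| = 1 := by
    have : |ε| ^ 2 = 1 := by rw [sq_abs, hε]
    nlinarith [abs_nonneg ε]
  have hyz : ∀ t, t < a ∨ a + r * h ≤ t → rst a (r * h) z t = 0 := by
    intro t ht
    unfold rst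
    rw [if_neg]; omega
  obtain ⟨w, hw1, hw2, hw3⟩ := H h hh a (rst a (r * h) z) m hyz hm
  set A : ℝ := C * ((r : ℝ) * h) ^ (r - 1) * m with hA
  have hA0 : 0 ≤ A := by positivity
  have hbz : ∀ t, t < a - r * h ∨ a + 2 * (r * h) ≤ t → bmp r h a t = 0 := by
    intro t ht
    apply bmp_zero r h hh
    rcases ht with ht | ht
    · left; linarith
    · right; linarith
  have hAC : A ≤ (2 * C + C * (r : ℝ) ^ (r - 1) * 2 ^ r) * ((r : ℝ) * h) ^ (r - 1) * m / 2 := by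
    have : 0 ≤ C * (r : ℝ) ^ (r - 1) * 2 ^ r * ((r : ℝ) * h) ^ (r - 1) * m := by positivity
    rw [hA]; linarith
  refine ⟨w + (ε * A) • bmp r h a, ?_, ?_, ?_, ?_, ?_⟩
  · intro t ht
    simp only [Pi.add_apply, Pi.smul_apply, smul_eq_mul]
    rw [hbz t ht, hw1 t]
    · ring
    · rcases ht with ht | ht
      · left; linarith
      · right; linarith
  · intro t
    simp only [Pi.add_apply, Pi.smul_apply, smul_eq_mul]
    have e1 : ε * (w t + ε * A * bmp r h a t) = ε * w t + A * bmp r h a t := by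
      linear_combination A * bmp r h a t * hε
    rw [e1]
    have hb := bmp_mem r h hh a t
    by_cases ht : t < a ∨ a + r * h - r ≤ t
    · rw [hw1 t ht, mul_zero, zero_add]
      exact mul_nonneg hA0 hb.1
    · push Not at ht
      rw [bmp_one r h hh a t ht.1 (by linarith)]
      have h1 : |ε * w t| ≤ A := by rw [abs_mul, habs, one_mul]; exact hw2 t
      have := (abs_le.1 h1).1
      linarith
  · intro t
    simp only [Pi.add_apply, Pi.smul_apply, smul_eq_mul]
    have hb := bmp_mem r h hh a t
    have h1 : |ε * A * bmp r h a t| ≤ A := by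
      rw [abs_mul, abs_mul, habs, one_mul, abs_of_nonneg hA0, abs_of_nonneg hb.1]
      nlinarith
    have h2 := hw2 t
    have h3 := abs_add_le (w t) (ε * A * bmp r h a t)
    linarith
  · intro t
    rw [map_add, map_smul]
    simp only [Pi.add_apply, Pi.smul_apply, smul_eq_mul]
    have h1 : |ε * A * (nab ^ r) (bmp r h a) t| ≤ A * (2 / h) ^ r := by
      rw [abs_mul, abs_mul, habs, one_mul, abs_of_nonneg hA0]
      exact mul_le_mul_of_nonneg_left (bmp_nab r h a t) hA0
    have h2 : A * (2 / (h : ℝ)) ^ r = C * (r : ℝ) ^ (r - 1) * 2 ^ r * (m / h) := by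
      rw [hA, div_pow, mul_pow]
      obtain ⟨r', hr'⟩ : ∃ k, r = k + 1 := ⟨r - 1, by omega⟩
      have : (h : ℝ) ^ r = (h : ℝ) ^ (r - 1) * h := by
        rw [← pow_succ]; congr 1; omega
      rw [this]
      field_simp
    have h3 := hw3 t
    have h4 := abs_sub (rst a (r * h) z t - (nab ^ r) w t) (ε * A * (nab ^ r) (bmp r h a) t)
    rw [← sub_sub]
    have h5 : 0 ≤ C * (m / h) := by positivity
    have h6 : (2 * C + C * (r : ℝ) ^ (r - 1) * 2 ^ r) * (m / h)
      = C * (m / h) + C * (m / h) + C * (r : ℝ) ^ (r - 1) * 2 ^ r * (m / h) := by ring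
    linarith
  · intro t ht
    rw [map_add, map_smul]
    simp only [Pi.add_apply, Pi.smul_apply, smul_eq_mul]
    rw [hyz t, nab_pow_supp w a (a + r * h - r) hw1, bmp_nab_supp r h hh a t]
    · ring
    · rcases ht with ht | ht
      · left; linarith
      · right; linarith
    · rcases ht with ht | ht
      · left; linarith
      · right; linarith
    · rcases ht with ht | ht
      · left; nlinarith
      · right; nlinarith

/-! ### Whitney blocks -/

/-- Block length at level `j`. -/
def blen (r j : ℕ) : ℕ := r * 2 ^ j

/-- The enlarged block of index `a` at level `j` contains no event. -/
def goodB (r : ℕ) (E : Finset ℤ) (j a : ℕ) : Prop :=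
  ∀ e ∈ E, ¬ (((a : ℤ) - 2) * (blen r j : ℤ) ≤ e ∧ e < ((a : ℤ) + 3) * (blen r j : ℤ))

open Classical in
/-- The maximal good blocks. -/
def whit (r n J : ℕ) (E : Finset ℤ) : Finset (ℕ × ℕ) :=
  (Finset.Icc 1 J ×ˢ Finset.range n).filter fun p =>
    p.2 * blen r p.1 < n ∧ goodB r E p.1 p.2 ∧ (p.1 = J ∨ ¬ goodB r E (p.1 + 1) (p.2 / 2))

lemma blen_succ (r j : ℕ) : blen r (j + 1) = 2 * blen r j := by unfold blen; rw [pow_succ]; ring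

lemma blen_pos (r j : ℕ) (hr : 1 ≤ r) : 1 ≤ blen r j := by
  unfold blen; exact Nat.one_le_iff_ne_zero.2 (by positivity)

lemma blen_add (r j i : ℕ) : blen r (j + i) = blen r j * 2 ^ i := by
  unfold blen; rw [pow_add]; ring

lemma mem_whit {r n J : ℕ} {E : Finset ℤ} {p : ℕ × ℕ} (hr : 1 ≤ r) :
    p ∈ whit r n J E ↔ (1 ≤ p.1 ∧ p.1 ≤ J) ∧ p.2 * blen r p.1 < n ∧ goodB r E p.1 p.2 ∧
      (p.1 = J ∨ ¬ goodB r E (p.1 + 1) (p.2 / 2)) := by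
  classical
  unfold whit
  rw [Finset.mem_filter, Finset.mem_product, Finset.mem_Icc, Finset.mem_range]
  constructor
  · rintro ⟨⟨h1, _⟩, h2⟩; exact ⟨h1, h2⟩
  · rintro ⟨h1, h2⟩
    refine ⟨⟨h1, ?_⟩, h2⟩
    have := blen_pos r p.1 hr
    nlinarith [h2.1]

lemma goodB_mono {r : ℕ} {E : Finset ℤ} {j a : ℕ} (h : goodB r E (j + 1) (a / 2)) :
    goodB r E j a := by
  intro e he ⟨h1, h2⟩
  apply h e he
  rw [blen_succ]
  push_cast
  have h3 : (2 * ((a : ℤ) / 2)) ≤ a ∧ (a : ℤ) ≤ 2 * ((a : ℤ) / 2) + 1 := by omega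
  have hb : (0 : ℤ) ≤ blen r j := by positivity
  constructor
  · nlinarith
  · nlinarith

lemma goodB_mono_pow {r : ℕ} {E : Finset ℤ} {j a : ℕ} (i : ℕ)
    (h : goodB r E (j + i) (a / 2 ^ i)) : goodB r E j a := by
  induction i generalizing j a with
  | zero => simpa using h
  | succ i ih =>
    apply goodB_mono
    apply ih
    rw [Nat.div_div_eq_div_mul, ← pow_succ', show j + 1 + i = j + (i + 1) by ring]
    exact h

lemma whit_disj_aux {r n J : ℕ} {E : Finset ℤ} (hr : 1 ≤ r) {j j' x : ℕ} (hjj : j < j')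
    (h : (j, x / blen r j) ∈ whit r n J E) (h' : (j', x / blen r j') ∈ whit r n J E) : False := by
  rw [mem_whit hr] at h h'
  obtain ⟨⟨_, h2⟩, _, _, h5⟩ := h
  obtain ⟨⟨_, h2'⟩, _, h4', _⟩ := h'
  simp only at *
  rcases h5 with h5 | h5
  · omega
  · apply h5
    obtain ⟨i, rfl⟩ : ∃ i, j' = j + 1 + i := ⟨j' - j - 1, by omega⟩
    apply goodB_mono_pow i
    rw [blen_add, ← Nat.div_div_eq_div_mul, blen_succ, mul_comm 2, ← Nat.div_div_eq_div_mul] at h4'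
    exact h4'

/-- each natural number lies in at most one Whitney block. -/
lemma whit_disj {r n J : ℕ} {E : Finset ℤ} (hr : 1 ≤ r) {x : ℕ} {p q : ℕ × ℕ}
    (hp : p ∈ whit r n J E) (hq : q ∈ whit r n J E)
    (hpx : p.2 = x / blen r p.1) (hqx : q.2 = x / blen r q.1) : p = q := by
  obtain ⟨j, a⟩ := p
  obtain ⟨j', a'⟩ := q
  simp only at hpx hqx
  subst hpx hqx
  rcases lt_trichotomy j j' with h | h | h
  · exact (whit_disj_aux hr h hp hq).elim
  · subst h; rfl
  · exact (whit_disj_aux hr h hq hp).elim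

lemma whit_cover {r n J : ℕ} {E : Finset ℤ} (hr : 1 ≤ r) {x : ℕ} (hx : x < n) (hJ : 1 ≤ J)
    (hg : goodB r E 1 (x / blen r 1)) : ∃ j, (j, x / blen r j) ∈ whit r n J E := by
  classical
  set j := Nat.findGreatest (fun j => goodB r E j (x / blen r j)) J with hj
  have h1 : 1 ≤ j := Nat.le_findGreatest hJ hg
  have h2 : goodB r E j (x / blen r j) :=
    Nat.findGreatest_spec (P := fun j => goodB r E j (x / blen r j)) hJ hg
  have h3 : j ≤ J := Nat.findGreatest_le J
  refine ⟨j, ?_⟩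
  rw [mem_whit hr]
  refine ⟨⟨h1, h3⟩, lt_of_le_of_lt (Nat.div_mul_le_self _ _) hx, h2, ?_⟩
  rcases h3.eq_or_lt with h | h
  · left; exact h
  · right
    intro h4
    have h5 : goodB r E (j + 1) (x / blen r (j + 1)) := by
      rw [blen_succ, mul_comm 2, ← Nat.div_div_eq_div_mul]; exact h4
    exact Nat.findGreatest_is_greatest (P := fun j => goodB r E j (x / blen r j))
      (Nat.lt_succ_self j) h h5

/-- `x` lies in the tripled block. -/
def inNb (r : ℕ) (x : ℤ) (p : ℕ × ℕ) : Prop :=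
  ((p.2 : ℤ) - 1) * (blen r p.1 : ℤ) ≤ x ∧ x < ((p.2 : ℤ) + 2) * (blen r p.1 : ℤ)

lemma whit_level {r n J : ℕ} {E : Finset ℤ} (hr : 1 ≤ r) {x : ℤ} {p q : ℕ × ℕ}
    (hp : p ∈ whit r n J E) (hq : q ∈ whit r n J E) (hpx : inNb r x p) (hqx : inNb r x q) :
    q.1 < p.1 + 4 := by
  by_contra hlt
  push Not at hlt
  rw [mem_whit hr] at hp hq
  obtain ⟨j, a⟩ := p
  obtain ⟨j', a'⟩ := q
  simp only [inNb] at *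
  obtain ⟨_, _, _, h5⟩ := hp
  obtain ⟨⟨_, h2'⟩, _, h4', _⟩ := hq
  rcases h5 with h5 | h5
  · omega
  · unfold goodB at h5
    push Not at h5
    obtain ⟨e, he, h6, h7⟩ := h5
    have h8 := h4' e he
    apply h8
    obtain ⟨i, rfl⟩ : ∃ i, j' = j + 4 + i := ⟨j' - j - 4, by omega⟩
    have hl : (16 : ℤ) * blen r j ≤ blen r (j + 4 + i) := by
      rw [blen_add, blen_add]
      have : 1 ≤ 2 ^ i := Nat.one_le_two_pow
      push_cast
      have h3 : (1 : ℤ) ≤ 2 ^ i := by exact_mod_cast this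
      have hb : (0 : ℤ) ≤ blen r j := by positivity
      nlinarith
    rw [blen_succ] at h6 h7
    push_cast at h6 h7
    have h3 : (2 * ((a : ℤ) / 2)) ≤ a ∧ (a : ℤ) ≤ 2 * ((a : ℤ) / 2) + 1 := by omega
    have hb : (1 : ℤ) ≤ blen r j := by exact_mod_cast blen_pos r j hr
    constructor
    · nlinarith
    · nlinarith

lemma whit_overlap {r n J : ℕ} {E : Finset ℤ} (hr : 1 ≤ r) (x : ℤ) (s : Finset (ℕ × ℕ))
    (hs : s ⊆ whit r n J E) (hx : ∀ p ∈ s, inNb r x p) : s.card ≤ 12 := by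
  classical
  rcases s.eq_empty_or_nonempty with rfl | hne
  · simp
  obtain ⟨p0, hp0, hmin⟩ := s.exists_min_image (fun p => p.1) hne
  have hmap : ∀ p ∈ s, ((p.1 : ℤ) - p0.1, x / (blen r p.1 : ℤ) - (p.2 : ℤ)) ∈
      (Finset.Ico (0 : ℤ) 4) ×ˢ (Finset.Icc (-1 : ℤ) 1) := by
    intro p hp
    have h1 := hmin p hp
    have h2 := whit_level hr (hs hp0) (hs hp) (hx p0 hp0) (hx p hp)
    have hb : (0 : ℤ) < blen r p.1 := by exact_mod_cast blen_pos r p.1 hr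
    obtain ⟨h3, h4⟩ := hx p hp
    rw [Finset.mem_product, Finset.mem_Ico, Finset.mem_Icc]
    have h5 : (p.2 : ℤ) - 1 ≤ x / (blen r p.1 : ℤ) := (Int.le_ediv_iff_mul_le hb).2 h3
    have h6 : x / (blen r p.1 : ℤ) < (p.2 : ℤ) + 2 := (Int.ediv_lt_iff_lt_mul hb).2 h4
    simp only at *
    omega
  have hcard := Finset.card_le_card_of_injOn _ hmap (by
    intro p hp q hq hpq
    simp only [Prod.mk.injEq] at hpq
    have e1 : p.1 = q.1 := by omega
    have e2 : p.2 = q.2 := by rw [e1] at hpq; omega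
    exact Prod.ext e1 e2)
  simpa using hcard

open Classical in
lemma card_bad (r : ℕ) (hr : 1 ≤ r) (n j : ℕ) (E : Finset ℤ) :
    ((Finset.range n).filter fun a => ¬ goodB r E j a).card ≤ 5 * E.card := by
  classical
  have hb : (0 : ℤ) < blen r j := by exact_mod_cast blen_pos r j hr
  calc _ ≤ (E.biUnion fun e => Finset.Icc (e / (blen r j : ℤ) - 2) (e / (blen r j : ℤ) + 2)).card := by
        apply Finset.card_le_card_of_injOn (fun a : ℕ => (a : ℤ))
        · intro a ha
          have h2 := (Finset.mem_filter.1 (Finset.mem_coe.1 ha)).2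
          unfold goodB at h2
          push Not at h2
          obtain ⟨e, he, h3, h4⟩ := h2
          rw [Finset.mem_coe, Finset.mem_biUnion]
          refine ⟨e, he, ?_⟩
          rw [Finset.mem_Icc]
          have h5 := (Int.le_ediv_iff_mul_le hb).2 h3
          have h6 := (Int.ediv_lt_iff_lt_mul hb).2 h4
          dsimp only
          constructor <;> omega
        · intro a _ b _ hab; simpa using hab
    _ ≤ ∑ e ∈ E, (Finset.Icc (e / (blen r j : ℤ) - 2) (e / (blen r j : ℤ) + 2)).card :=
        Finset.card_biUnion_le
    _ = ∑ e ∈ E, 5 := by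
        apply Finset.sum_congr rfl
        intro e _
        rw [Int.card_Icc]
        omega
    _ = 5 * E.card := by rw [Finset.sum_const, smul_eq_mul, mul_comm]

lemma card_whit (r : ℕ) (hr : 1 ≤ r) (n J : ℕ) (E : Finset ℤ) :
    (whit r n J E).card ≤ (n / blen r J + 1) + J * (10 * E.card) := by
  classical
  have hsub : whit r n J E ⊆ ((Finset.range (n / blen r J + 1)).image fun a => (J, a)) ∪
      (Finset.range J).biUnion fun j =>
        (((Finset.range n).filter fun a => ¬ goodB r E (j + 1) a) ×ˢ Finset.range 2).image
          fun q => (j, 2 * q.1 + q.2) := by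
    intro p hp
    have hlt : p.2 < n := by
      unfold whit at hp
      rw [Finset.mem_filter, Finset.mem_product] at hp
      exact Finset.mem_range.1 hp.1.2
    rw [mem_whit hr] at hp
    obtain ⟨⟨h1, h2⟩, h3, h4, h5⟩ := hp
    rw [Finset.mem_union]
    by_cases hJ : p.1 = J
    · left
      rw [Finset.mem_image]
      refine ⟨p.2, ?_, Prod.ext hJ.symm rfl⟩
      rw [Finset.mem_range, Nat.lt_succ_iff, ← hJ, Nat.le_div_iff_mul_le (blen_pos r _ hr)]
      exact h3.le
    · right
      rw [Finset.mem_biUnion]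
      refine ⟨p.1, Finset.mem_range.2 (by omega), ?_⟩
      rw [Finset.mem_image]
      refine ⟨(p.2 / 2, p.2 % 2), ?_, ?_⟩
      · rw [Finset.mem_product, Finset.mem_filter, Finset.mem_range, Finset.mem_range]
        refine ⟨⟨by simp only; omega, ?_⟩, by simp only; omega⟩
        rcases h5 with h5 | h5
        · exact absurd h5 hJ
        · exact h5
      · exact Prod.ext rfl (by simp only; omega)
  refine (Finset.card_le_card hsub).trans ((Finset.card_union_le _ _).trans ?_)
  apply add_le_add
  · exact Finset.card_image_le.trans (by simp)
  · refine Finset.card_biUnion_le.trans ?_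
    calc _ ≤ ∑ j ∈ Finset.range J, 10 * E.card := by
          apply Finset.sum_le_sum
          intro j _
          refine Finset.card_image_le.trans ?_
          rw [Finset.card_product, Finset.card_range]
          have := card_bad r hr n (j + 1) E
          omega
      _ = _ := by rw [Finset.sum_const, smul_eq_mul, Finset.card_range]

open Classical in
/-- The untracked points. -/
def untr (r n J : ℕ) (E : Finset ℤ) : Finset ℕ :=
  (Finset.range n).filter fun x => ¬ ∃ j, (j, x / blen r j) ∈ whit r n J E

lemma card_untr (r : ℕ) (hr : 1 ≤ r) (n J : ℕ) (hJ : 1 ≤ J) (E : Finset ℤ) :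
    (untr r n J E).card ≤ 10 * r * E.card := by
  classical
  have hsub : untr r n J E ⊆
      (((Finset.range n).filter fun a => ¬ goodB r E 1 a) ×ˢ Finset.range (blen r 1)).image
        fun q => blen r 1 * q.1 + q.2 := by
    intro x hx
    unfold untr at hx
    rw [Finset.mem_filter, Finset.mem_range] at hx
    have hng : ¬ goodB r E 1 (x / blen r 1) := fun hg => hx.2 (whit_cover hr hx.1 hJ hg)
    rw [Finset.mem_image]
    refine ⟨(x / blen r 1, x % blen r 1), ?_, Nat.div_add_mod x _⟩
    rw [Finset.mem_product, Finset.mem_filter, Finset.mem_range, Finset.mem_range]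
    exact ⟨⟨lt_of_le_of_lt (Nat.div_le_self _ _) hx.1, hng⟩, Nat.mod_lt _ (blen_pos r 1 hr)⟩
  refine (Finset.card_le_card hsub).trans (Finset.card_image_le.trans ?_)
  rw [Finset.card_product, Finset.card_range]
  have h1 := card_bad r hr n 1 E
  calc _ ≤ 5 * E.card * blen r 1 := Nat.mul_le_mul_right _ h1
    _ = _ := by unfold blen; ring

end

section


/-- Smoothing window in the gap `i`. -/
def gh (r : ℕ) (p : ℕ → ℤ) (i : ℕ) : ℕ := (p (i + 1) - p i - 1).toNat / (2 * r) + 1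

/-- The middle event in the gap `i`. -/
def gtau (r : ℕ) (p : ℕ → ℤ) (i : ℕ) : ℤ := p (i + 1) - r * ((gh r p i : ℤ) - 1)

open Classical in
/-- The transition in the gap `i`. -/
def gapf (r : ℕ) (p : ℕ → ℤ) (s : ℕ → ℝ) (i : ℕ) : ℤ → ℝ :=
  if s i ≠ s (i + 1) then
    (-s i) • stp r (gh r p i) (p i + 1) + (s (i + 1)) • stp r (gh r p i) (gtau r p i)
  else 0

/-- The sign profile. -/
def chi (r k : ℕ) (p : ℕ → ℤ) (s : ℕ → ℝ) : ℤ → ℝ := ∑ i ∈ Finset.range (k + 1), gapf r p s i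

lemma gh_pos (r : ℕ) (p : ℕ → ℤ) (i : ℕ) : 1 ≤ gh r p i := Nat.le_add_left 1 _

lemma gh_le (r : ℕ) (p : ℕ → ℤ) (i : ℕ) (h : p i < p (i + 1)) :
    1 + 2 * ((r : ℤ) * ((gh r p i : ℤ) - 1)) ≤ p (i + 1) - p i := by
  unfold gh
  have h1 := Nat.div_mul_le_self (p (i + 1) - p i - 1).toNat (2 * r)
  have h2 : (((p (i + 1) - p i - 1).toNat : ℕ) : ℤ) = p (i + 1) - p i - 1 := Int.toNat_of_nonneg (by omega)
  generalize (p (i + 1) - p i - 1).toNat = q at *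
  generalize hd : q / (2 * r) = d at *
  zify at h1
  push_cast
  linarith

lemma le_gh (r : ℕ) (hr : 1 ≤ r) (p : ℕ → ℤ) (i : ℕ) (h : p i < p (i + 1)) :
    p (i + 1) - p i ≤ 2 * ((r : ℤ) * (gh r p i : ℤ)) := by
  unfold gh
  have h1 := Nat.lt_div_mul_add (a := (p (i + 1) - p i - 1).toNat) (b := 2 * r) (by omega)
  have h2 : (((p (i + 1) - p i - 1).toNat : ℕ) : ℤ) = p (i + 1) - p i - 1 := Int.toNat_of_nonneg (by omega)
  generalize (p (i + 1) - p i - 1).toNat = q at *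
  generalize hd : q / (2 * r) = d at *
  zify at h1
  push_cast
  linarith

lemma gtau_ge (r : ℕ) (p : ℕ → ℤ) (i : ℕ) (h : p i < p (i + 1)) :
    p i + 1 + r * ((gh r p i : ℤ) - 1) ≤ gtau r p i := by
  have := gh_le r p i h
  unfold gtau
  linarith

lemma gtau_le (r : ℕ) (p : ℕ → ℤ) (i : ℕ) : gtau r p i ≤ p (i + 1) := by
  unfold gtau
  have : (0 : ℤ) ≤ r * ((gh r p i : ℤ) - 1) := by
    have := gh_pos r p i
    apply mul_nonneg <;> omega
  linarith

lemma gh_nn (r : ℕ) (p : ℕ → ℤ) (i : ℕ) : (0 : ℤ) ≤ r * ((gh r p i : ℤ) - 1) := by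
  have := gh_pos r p i
  apply mul_nonneg <;> omega

lemma gapf_left (r : ℕ) (p : ℕ → ℤ) (s : ℕ → ℝ) (i : ℕ) (h : p i < p (i + 1)) (t : ℤ)
    (ht : t ≤ p i) : gapf r p s i t = 0 := by
  unfold gapf
  split_ifs with hs
  · have := gtau_ge r p i h
    have := gh_nn r p i
    simp only [Pi.add_apply, Pi.smul_apply, smul_eq_mul]
    rw [stp_zero _ _ (gh_pos r p i) _ _ (by omega), stp_zero _ _ (gh_pos r p i) _ _ (by omega)]
    ring
  · rfl

lemma gapf_right (r : ℕ) (p : ℕ → ℤ) (s : ℕ → ℝ) (i : ℕ) (h : p i < p (i + 1)) (t : ℤ)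
    (ht : p (i + 1) ≤ t) : gapf r p s i t = s (i + 1) - s i := by
  unfold gapf
  split_ifs with hs
  · have := gtau_ge r p i h
    have := gtau_le r p i
    simp only [Pi.add_apply, Pi.smul_apply, smul_eq_mul]
    rw [stp_one _ _ (gh_pos r p i) _ _ (by omega),
      stp_one _ _ (gh_pos r p i) _ _ (by unfold gtau; omega)]
    ring
  · push Not at hs
    rw [hs]; simp

lemma p_mono (k : ℕ) (p : ℕ → ℤ) (hp : ∀ i ≤ k, p i < p (i + 1)) (a b : ℕ) (hab : a ≤ b)
    (hb : b ≤ k + 1) : p a + (b - a : ℕ) ≤ p b := by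
  induction b, hab using Nat.le_induction with
  | base => simp
  | succ b hab ih =>
    have h1 := ih (by omega)
    have h2 := hp b (by omega)
    omega

lemma chi_gap (r k : ℕ) (p : ℕ → ℤ) (s : ℕ → ℝ) (hp : ∀ i ≤ k, p i < p (i + 1)) (hs0 : s 0 = 0)
    (i : ℕ) (hi : i ≤ k) (t : ℤ) (h1 : p i ≤ t) (h2 : t ≤ p (i + 1)) :
    chi r k p s t = s i + gapf r p s i t := by
  unfold chi
  rw [Finset.sum_apply, ← Finset.sum_range_add_sum_Ico _ (show i + 1 ≤ k + 1 by omega),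
    Finset.sum_range_succ]
  have e1 : ∑ l ∈ Finset.range i, gapf r p s l t = ∑ l ∈ Finset.range i, (s (l + 1) - s l) := by
    apply Finset.sum_congr rfl
    intro l hl
    rw [Finset.mem_range] at hl
    apply gapf_right r p s l (hp l (by omega))
    have := p_mono k p hp (l + 1) i (by omega) (by omega)
    omega
  have e2 : ∑ l ∈ Finset.Ico (i + 1) (k + 1), gapf r p s l t = 0 := by
    apply Finset.sum_eq_zero
    intro l hl
    rw [Finset.mem_Ico] at hl
    apply gapf_left r p s l (hp l (by omega))
    have := p_mono k p hp (i + 1) l (by omega) (by omega)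
    omega
  rw [e1, e2, Finset.sum_range_sub, hs0]
  ring

lemma chi_p (r k : ℕ) (p : ℕ → ℤ) (s : ℕ → ℝ) (hp : ∀ i ≤ k, p i < p (i + 1)) (hs0 : s 0 = 0)
    (i : ℕ) (hi : i ≤ k) : chi r k p s (p i) = s i := by
  rw [chi_gap r k p s hp hs0 i hi _ le_rfl (hp i hi).le, gapf_left r p s i (hp i hi) _ le_rfl, add_zero]

lemma chi_out (r k : ℕ) (p : ℕ → ℤ) (s : ℕ → ℝ) (hp : ∀ i ≤ k, p i < p (i + 1)) (hs0 : s 0 = 0)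
    (hsk : s (k + 1) = 0) (t : ℤ) (ht : t ≤ p 0 ∨ p (k + 1) ≤ t) : chi r k p s t = 0 := by
  unfold chi
  rw [Finset.sum_apply]
  rcases ht with ht | ht
  · apply Finset.sum_eq_zero
    intro l hl
    rw [Finset.mem_range] at hl
    apply gapf_left r p s l (hp l (by omega))
    have := p_mono k p hp 0 l (by omega) (by omega)
    omega
  · have e1 : ∑ l ∈ Finset.range (k + 1), gapf r p s l t
        = ∑ l ∈ Finset.range (k + 1), (s (l + 1) - s l) := by
      apply Finset.sum_congr rfl
      intro l hl
      rw [Finset.mem_range] at hl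
      apply gapf_right r p s l (hp l (by omega))
      have := p_mono k p hp (l + 1) (k + 1) (by omega) (by omega)
      omega
    rw [e1, Finset.sum_range_sub, hs0, hsk, sub_zero]

/-- In a gap, the profile has the form constant times nonnegative. -/
lemma chi_form (r k : ℕ) (p : ℕ → ℤ) (s : ℕ → ℝ) (hp : ∀ i ≤ k, p i < p (i + 1)) (hs0 : s 0 = 0)
    (i : ℕ) (hi : i ≤ k) (t : ℤ) (h1 : p i ≤ t) (h2 : t ≤ p (i + 1)) :
    ∃ w : ℝ, 0 ≤ w ∧ w ≤ 1 ∧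
      chi r k p s t = (if t < gtau r p i then s i else s (i + 1)) * w := by
  rw [chi_gap r k p s hp hs0 i hi t h1 h2]
  unfold gapf
  by_cases hs : s i = s (i + 1)
  · refine ⟨1, zero_le_one, le_rfl, ?_⟩
    rw [if_neg (by simpa using hs)]
    split_ifs
    · simp
    · rw [hs]; simp
  · rw [if_pos hs]
    simp only [Pi.add_apply, Pi.smul_apply, smul_eq_mul]
    have hm1 := stp_mem r (gh r p i) (gh_pos r p i) (p i + 1) t
    have hm2 := stp_mem r (gh r p i) (gh_pos r p i) (gtau r p i) t
    by_cases ht : t < gtau r p i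
    · rw [if_pos ht, stp_zero r (gh r p i) (gh_pos r p i) _ t ht]
      exact ⟨1 - stp r (gh r p i) (p i + 1) t, by linarith [hm1.2], by linarith [hm1.1], by ring⟩
    · rw [if_neg ht, stp_one r (gh r p i) (gh_pos r p i) (p i + 1) t
        (by have := gtau_ge r p i (hp i hi); omega)]
      exact ⟨_, hm2.1, hm2.2, by ring⟩

lemma exists_gap (k : ℕ) (p : ℕ → ℤ) (x : ℤ) (h0 : p 0 ≤ x) (h1 : x < p (k + 1)) :
    ∃ i ≤ k, p i ≤ x ∧ x < p (i + 1) := by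
  induction k with
  | zero => exact ⟨0, le_rfl, h0, h1⟩
  | succ k ih =>
    by_cases h : x < p (k + 1)
    · obtain ⟨i, hi, h⟩ := ih h
      exact ⟨i, by omega, h⟩
    · exact ⟨k + 1, le_rfl, by omega, h1⟩

lemma chi_abs (r k : ℕ) (p : ℕ → ℤ) (s : ℕ → ℝ) (hp : ∀ i ≤ k, p i < p (i + 1)) (hs0 : s 0 = 0)
    (hsk : s (k + 1) = 0) (hs : ∀ i, |s i| ≤ 1) (t : ℤ) : |chi r k p s t| ≤ 1 := by
  by_cases ht : t < p 0 ∨ p (k + 1) ≤ t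
  · rw [chi_out r k p s hp hs0 hsk t (by omega)]; simp
  · push Not at ht
    obtain ⟨i, hi, h1, h2⟩ := exists_gap k p t ht.1 ht.2
    obtain ⟨w, hw0, hw1, hw⟩ := chi_form r k p s hp hs0 i hi t h1 h2.le
    rw [hw, abs_mul, abs_of_nonneg hw0]
    have : |if t < gtau r p i then s i else s (i + 1)| ≤ 1 := by split_ifs <;> exact hs _
    nlinarith [abs_nonneg (if t < gtau r p i then s i else s (i + 1))]

/-- The events. -/
def evs (r k : ℕ) (p : ℕ → ℤ) : Finset ℤ :=
  (Finset.range (k + 2)).image p ∪ (Finset.range (k + 1)).image (gtau r p)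

lemma card_evs (r k : ℕ) (p : ℕ → ℤ) : (evs r k p).card ≤ 2 * k + 3 := by
  unfold evs
  refine (Finset.card_union_le _ _).trans ?_
  have h1 := Finset.card_image_le (s := Finset.range (k + 2)) (f := p)
  have h2 := Finset.card_image_le (s := Finset.range (k + 1)) (f := gtau r p)
  rw [Finset.card_range] at h1 h2
  omega

lemma chi_sign (r k : ℕ) (p : ℕ → ℤ) (s : ℕ → ℝ) (hp : ∀ i ≤ k, p i < p (i + 1)) (hs0 : s 0 = 0)
    (lo hi : ℤ) (x : ℤ) (hx1 : lo ≤ x) (hx2 : x < hi) (hx3 : p 0 ≤ x) (hx4 : x < p (k + 1))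
    (hE : ∀ e ∈ evs r k p, ¬ (lo ≤ e ∧ e < hi)) :
    p 0 < lo ∧ hi ≤ p (k + 1) ∧
      ∃ ε : ℝ, ε ^ 2 = 1 ∧ ∀ t, lo ≤ t → t < hi → 0 ≤ ε * chi r k p s t := by
  have hEp : ∀ i ≤ k + 1, ¬ (lo ≤ p i ∧ p i < hi) := by
    intro i hi'
    apply hE
    unfold evs
    exact Finset.mem_union_left _ (Finset.mem_image_of_mem _ (Finset.mem_range.2 (by omega)))
  have hEt : ∀ i ≤ k, ¬ (lo ≤ gtau r p i ∧ gtau r p i < hi) := by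
    intro i hi'
    apply hE
    unfold evs
    exact Finset.mem_union_right _ (Finset.mem_image_of_mem _ (Finset.mem_range.2 (by omega)))
  obtain ⟨i, hik, h1, h2⟩ := exists_gap k p x hx3 hx4
  have ha := hEp i (by omega)
  have hb := hEp (i + 1) (by omega)
  have hc := hEt i hik
  have h0 := hEp 0 (by omega)
  have hk := hEp (k + 1) (by omega)
  refine ⟨by omega, by omega, ?_⟩
  set c : ℝ := if x < gtau r p i then s i else s (i + 1) with hcdef
  refine ⟨if 0 ≤ c then 1 else -1, by split_ifs <;> norm_num, ?_⟩
  intro t ht1 ht2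
  obtain ⟨w, hw0, _, hw⟩ := chi_form r k p s hp hs0 i hik t (by omega) (by omega)
  have : (if t < gtau r p i then s i else s (i + 1)) = c := by
    rw [hcdef]
    by_cases h : x < gtau r p i
    · rw [if_pos h, if_pos (by omega)]
    · rw [if_neg h, if_neg (by omega)]
  rw [hw, this]
  split_ifs with hc0
  · rw [one_mul]; exact mul_nonneg hc0 hw0
  · push Not at hc0
    nlinarith

lemma gapf_nab (r : ℕ) (p : ℕ → ℤ) (s : ℕ → ℝ) (hs : ∀ i, |s i| ≤ 1)
    (i : ℕ) (t : ℤ) : |(nab ^ r) (gapf r p s i) t| ≤ 2 * (2 / (gh r p i : ℝ)) ^ r := by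
  unfold gapf
  split_ifs with h
  · rw [map_add, map_smul, map_smul]
    simp only [Pi.add_apply, Pi.smul_apply, smul_eq_mul]
    refine (abs_add_le _ _).trans ?_
    rw [abs_mul, abs_mul, abs_neg]
    have h1 := stp_nab r (gh r p i) (p i + 1) t
    have h2 := stp_nab r (gh r p i) (gtau r p i) t
    have a1 := mul_le_mul (hs i) h1 (abs_nonneg _) zero_le_one
    have a2 := mul_le_mul (hs (i + 1)) h2 (abs_nonneg _) zero_le_one
    linarith
  · rw [map_zero, Pi.zero_apply, abs_zero]; positivity

lemma gapf_nab_supp (r : ℕ) (hr : 1 ≤ r) (p : ℕ → ℤ) (s : ℕ → ℝ)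
    (i : ℕ) (h : p i < p (i + 1)) (t : ℤ) (ht : t ≤ p i ∨ p (i + 1) + r ≤ t) :
    (nab ^ r) (gapf r p s i) t = 0 := by
  rcases ht with ht | ht
  · rw [nab_pow_congr _ (fun _ => 0) r t, nab_pow_const _ _ hr]
    intro u _ h2
    exact gapf_left r p s i h u (by omega)
  · rw [nab_pow_congr _ (fun _ => s (i + 1) - s i) r t, nab_pow_const _ _ hr]
    intro u h1 h2
    exact gapf_right r p s i h u (by omega)

open Classical in
lemma chi_nab (r k : ℕ) (hr : 1 ≤ r) (p : ℕ → ℤ) (s : ℕ → ℝ) (hp : ∀ i ≤ k, p i < p (i + 1))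
    (hs : ∀ i, |s i| ≤ 1) (T : Finset ℤ) :
    ∑ t ∈ T, ((nab ^ r) (chi r k p s) t) ^ 2 ≤
      (r * (3 * r * (4 * 4 ^ r)) : ℝ) * ∑ i ∈ Finset.range (k + 1),
        if s i ≠ s (i + 1) then ((gh r p i : ℝ) ^ (2 * r - 1))⁻¹ else 0 := by
  have hpt : ∀ t, ((nab ^ r) (chi r k p s) t) ^ 2 ≤
      r * ∑ i ∈ Finset.range (k + 1), ((nab ^ r) (gapf r p s i) t) ^ 2 := by
    intro t
    unfold chi
    rw [map_sum, Finset.sum_apply]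
    set F := (Finset.range (k + 1)).filter fun i => p i < t ∧ t < p (i + 1) + r with hF
    have hz : ∀ i ∈ Finset.range (k + 1), i ∉ F → (nab ^ r) (gapf r p s i) t = 0 := by
      intro i hi hiF
      rw [hF, Finset.mem_filter] at hiF
      rw [Finset.mem_range] at hi
      apply gapf_nab_supp r hr p s i (hp i (by omega))
      by_contra hcon
      push Not at hcon
      exact hiF ⟨Finset.mem_range.2 hi, hcon⟩
    have hsub : F ⊆ Finset.range (k + 1) := Finset.filter_subset _ _
    rw [← Finset.sum_subset hsub hz,
      ← Finset.sum_subset hsub (fun i hi hn => by rw [hz i hi hn]; ring)]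
    have hcard : F.card ≤ r := by
      rcases F.eq_empty_or_nonempty with h | hne
      · rw [h]; simp
      · obtain ⟨a, ha, hmin⟩ := F.exists_min_image id hne
        have : F ⊆ Finset.Ico a (a + r) := by
          intro b hb
          have hab := hmin b hb
          simp only [id] at hab
          rw [hF, Finset.mem_filter, Finset.mem_range] at ha hb
          rw [Finset.mem_Ico]
          refine ⟨hab, ?_⟩
          rcases hab.eq_or_lt with h | h
          · omega
          · have := p_mono k p hp (a + 1) b (by omega) (by omega)
            omega
        have := Finset.card_le_card this
        rw [Nat.card_Ico] at this
        omega
    have := sq_sum_le_card_mul_sum_sq (s := F) (f := fun i => (nab ^ r) (gapf r p s i) t)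
    refine this.trans ?_
    apply mul_le_mul_of_nonneg_right (by exact_mod_cast hcard)
    exact Finset.sum_nonneg fun i _ => sq_nonneg _
  calc _ ≤ ∑ t ∈ T, r * ∑ i ∈ Finset.range (k + 1), ((nab ^ r) (gapf r p s i) t) ^ 2 :=
        Finset.sum_le_sum fun t _ => hpt t
    _ = r * ∑ i ∈ Finset.range (k + 1), ∑ t ∈ T, ((nab ^ r) (gapf r p s i) t) ^ 2 := by
        rw [← Finset.mul_sum, Finset.sum_comm]
    _ ≤ r * ∑ i ∈ Finset.range (k + 1), (3 * r * (4 * 4 ^ r) : ℝ) *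
        (if s i ≠ s (i + 1) then ((gh r p i : ℝ) ^ (2 * r - 1))⁻¹ else 0) := by
        apply mul_le_mul_of_nonneg_left _ (by positivity)
        apply Finset.sum_le_sum
        intro i hi
        rw [Finset.mem_range] at hi
        split_ifs with h
        · have hg0 : (1 : ℝ) ≤ gh r p i := by exact_mod_cast gh_pos r p i
          calc _ = ∑ t ∈ T.filter (fun t => p i < t ∧ t < p (i + 1) + r),
                ((nab ^ r) (gapf r p s i) t) ^ 2 := by
                symm
                apply Finset.sum_subset (Finset.filter_subset _ _)
                intro t ht hn
                rw [gapf_nab_supp r hr p s i (hp i (by omega)) t]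
                · ring
                · by_contra hcon
                  push Not at hcon
                  exact hn (Finset.mem_filter.2 ⟨ht, hcon⟩)
            _ ≤ ∑ t ∈ T.filter (fun t => p i < t ∧ t < p (i + 1) + r),
                (2 * (2 / (gh r p i : ℝ)) ^ r) ^ 2 := by
                apply Finset.sum_le_sum
                intro t _
                rw [← sq_abs]
                exact pow_le_pow_left₀ (abs_nonneg _) (gapf_nab r p s hs i t) 2
            _ = ((T.filter (fun t => p i < t ∧ t < p (i + 1) + r)).card : ℝ) *
                (2 * (2 / (gh r p i : ℝ)) ^ r) ^ 2 := by
                rw [Finset.sum_const, nsmul_eq_mul]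
            _ ≤ (3 * r * gh r p i) * (2 * (2 / (gh r p i : ℝ)) ^ r) ^ 2 := by
                apply mul_le_mul_of_nonneg_right _ (by positivity)
                have h1 : (T.filter (fun t => p i < t ∧ t < p (i + 1) + r)).card
                    ≤ (Finset.Ioo (p i) (p (i + 1) + r)).card := by
                  apply Finset.card_le_card
                  intro t ht
                  rw [Finset.mem_filter] at ht
                  exact Finset.mem_Ioo.2 ht.2
                rw [Int.card_Ioo] at h1
                have h2 := le_gh r hr p i (hp i (by omega))
                have h3 : (((p (i + 1) + r - p i - 1).toNat : ℕ) : ℤ) ≤ 3 * r * gh r p i := by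
                  have h4 := hp i (by omega)
                  rw [Int.toNat_of_nonneg (by omega)]
                  have := gh_pos r p i
                  have h5 : (r : ℤ) ≤ r * gh r p i := by
                    exact_mod_cast Nat.le_mul_of_pos_right r this
                  linarith
                have h4 : (T.filter (fun t => p i < t ∧ t < p (i + 1) + r)).card
                    ≤ 3 * r * gh r p i := by
                  refine h1.trans ?_
                  exact_mod_cast h3
                exact_mod_cast h4
            _ = _ := by
                obtain ⟨q, rfl⟩ : ∃ q, r = q + 1 := ⟨r - 1, by omega⟩
                rw [show 2 * (q + 1) - 1 = 2 * q + 1 by omega]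
                have : (gh (q + 1) p i : ℝ) ≠ 0 := by positivity
                rw [div_pow, mul_pow, div_pow]
                rw [← pow_mul 2, mul_comm (q + 1) 2, pow_mul 2]
                norm_num
                field_simp
                ring
        · push Not at h
          rw [mul_zero]
          apply le_of_eq
          apply Finset.sum_eq_zero
          intro t _
          unfold gapf
          rw [if_neg (by simpa using h), map_zero, Pi.zero_apply]
          ring
    _ = _ := by rw [← Finset.mul_sum, ← mul_assoc]

end

section


/-- Start of a block. -/
def bst (r : ℕ) (B : ℕ × ℕ) : ℤ := (B.2 : ℤ) * (blen r B.1 : ℤ)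

lemma whit_chi (r k n J : ℕ) (hr : 1 ≤ r) (p : ℕ → ℤ) (s : ℕ → ℝ)
    (hp : ∀ i ≤ k, p i < p (i + 1)) (hs0 : s 0 = 0) (hp0 : p 0 = -1) (hpk : p (k + 1) = (n : ℤ) - r)
    (B : ℕ × ℕ) (hB : B ∈ whit r n J (evs r k p)) :
    0 ≤ bst r B - 2 * blen r B.1 ∧ bst r B + 3 * blen r B.1 ≤ (n : ℤ) - r ∧
      (∀ i ≤ k + 1, ¬ (bst r B - 2 * blen r B.1 ≤ p i ∧ p i < bst r B + 3 * blen r B.1)) ∧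
      ∃ ε : ℝ, ε ^ 2 = 1 ∧ ∀ t, bst r B - 2 * blen r B.1 ≤ t → t < bst r B + 3 * blen r B.1 →
        0 ≤ ε * chi r k p s t := by
  rw [mem_whit hr] at hB
  obtain ⟨_, h1, h2, _⟩ := hB
  have hE : ∀ e ∈ evs r k p, ¬ (bst r B - 2 * blen r B.1 ≤ e ∧ e < bst r B + 3 * blen r B.1) := by
    intro e he hcon
    apply h2 e he
    unfold bst at hcon
    constructor
    · linarith [hcon.1]
    · linarith [hcon.2]
  have hEp : ∀ i ≤ k + 1, ¬ (bst r B - 2 * blen r B.1 ≤ p i ∧ p i < bst r B + 3 * blen r B.1) := by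
    intro i hi'
    apply hE
    unfold evs
    exact Finset.mem_union_left _ (Finset.mem_image_of_mem _ (Finset.mem_range.2 (by omega)))
  have hl : (r : ℤ) ≤ blen r B.1 := by
    unfold blen
    exact_mod_cast Nat.le_mul_of_pos_right r (by positivity)
  have hx0 : 0 ≤ bst r B := by unfold bst; positivity
  have hxn : bst r B < n := by unfold bst; exact_mod_cast h1
  have hk := hEp (k + 1) le_rfl
  rw [hpk] at hk
  obtain ⟨c1, c2, c3⟩ := chi_sign r k p s hp hs0 (bst r B - 2 * blen r B.1)
    (bst r B + 3 * blen r B.1) (bst r B) (by omega) (by omega) (by omega) (by omega) hE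
  exact ⟨by omega, by omega, hEp, c3⟩

open Classical in
theorem pathwise (r : ℕ) (hr : 1 ≤ r) : ∃ C : ℝ, 0 < C ∧
    ∀ (n k J : ℕ) (p : ℕ → ℤ) (s : ℕ → ℝ), r ≤ n →
    (∀ i ≤ k, p i < p (i + 1)) → s 0 = 0 → s (k + 1) = 0 → (∀ i, |s i| ≤ 1) →
    p 0 = -1 → p (k + 1) = (n : ℤ) - r →
    ∀ (z : ℤ → ℝ) (m : ℕ × ℕ → ℝ) (ko : Finset (ℕ × ℕ)) (Q lam : ℝ), 
    (∀ B ∈ whit r n J (evs r k p), ∀ t,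
      |cs (bst r B) (rst (bst r B) (blen r B.1) z) t| ≤ m B) →
    (∀ B ∈ whit r n J (evs r k p), B ∉ ko → (blen r B.1 : ℝ) ^ (r - 1) * m B ≤ Q) →
    0 ≤ Q → C * Q ≤ lam →
    ∃ u : ℤ → ℝ, (∀ t, t < 0 ∨ (n : ℤ) - r ≤ t → u t = 0) ∧ (∀ t, |u t| ≤ lam) ∧
      (∀ i ≤ k, u (p i) = lam * s i) ∧
      ∑ x ∈ Finset.range n, (z (x : ℤ) - (nab ^ r) u (x : ℤ)) ^ 2 ≤
        C * (lam ^ 2 * ∑ x ∈ Finset.range n, ((nab ^ r) (chi r k p s) (x : ℤ)) ^ 2 +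
          ∑ B ∈ whit r n J (evs r k p), (m B ^ 2 / blen r B.1 +
            if B ∈ ko then ∑ x ∈ Finset.range n,
              (if x / blen r B.1 = B.2 then z (x : ℤ) ^ 2 else 0) else 0) +
          ∑ x ∈ untr r n J (evs r k p), z (x : ℤ) ^ 2) := by
  obtain ⟨C, hC, H⟩ := block_g r hr
  refine ⟨12 * C + 36 + 36 * (3 * r ^ 2 * C ^ 2), by positivity, ?_⟩
  intro n k J p s _ hp hs0 hsk hs hp0 hpk z m ko Q lam hm hQ hQ0 hlam
  set E := evs r k p with hE
  set W := whit r n J E with hW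
  have hlam12 : 12 * (C * Q) ≤ lam := by
    refine le_trans ?_ hlam
    have : 0 ≤ (36 + 36 * (3 * r ^ 2 * C ^ 2)) * Q := by positivity
    linarith
  have hlam0 : 0 ≤ lam := le_trans (by positivity) hlam12
  -- choose the block functions
  have hch : ∀ B : ℕ × ℕ, ∃ (g : ℤ → ℝ), B ∈ W →
      (∀ t, ¬ inNb r t B → g t = 0) ∧
      (∃ ε : ℝ, ε ^ 2 = 1 ∧ (∀ t, 0 ≤ ε * g t) ∧ ∀ t, inNb r t B → ε * chi r k p s t ≤ 0) ∧
      (∀ t, |g t| ≤ C * Q) ∧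
      (∀ t, ¬ inNb r t B → rst (bst r B) (blen r B.1) z t - (nab ^ r) g t = 0) ∧
      ∑ x ∈ Finset.range n, (rst (bst r B) (blen r B.1) z (x : ℤ) - (nab ^ r) g (x : ℤ)) ^ 2 ≤
        3 * r ^ 2 * C ^ 2 * (m B ^ 2 / blen r B.1) + if B ∈ ko then ∑ x ∈ Finset.range n,
              (if x / blen r B.1 = B.2 then z (x : ℤ) ^ 2 else 0) else 0 := by
    intro B
    by_cases hBW : B ∈ W
    swap
    · exact ⟨0, fun h => absurd h hBW⟩
    obtain ⟨w1, w2, w3, ε, hε, w4⟩ := whit_chi r k n J hr p s hp hs0 hp0 hpk B hBW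
    have hbp : (0 : ℤ) < blen r B.1 := by exact_mod_cast blen_pos r B.1 hr
    have hnb : ∀ t, inNb r t B ↔ bst r B - blen r B.1 ≤ t ∧ t < bst r B + 2 * blen r B.1 := by
      intro t
      unfold inNb bst
      rw [sub_mul, add_mul, one_mul]
    by_cases hko : B ∈ ko
    · refine ⟨0, fun _ => ⟨fun t _ => rfl, ⟨-ε, by rw [neg_sq]; exact hε, by simp, ?_⟩, ?_, ?_, ?_⟩⟩
      · intro t ht
        rw [hnb] at ht
        have := w4 t (by omega) (by omega)
        linarith
      · intro t; simp; positivity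
      · intro t ht
        rw [map_zero, Pi.zero_apply, sub_zero]
        unfold rst
        rw [if_neg]
        rw [hnb] at ht
        omega
      · rw [if_pos hko]
        have h0 : (0 : ℝ) ≤ 3 * r ^ 2 * C ^ 2 * (m B ^ 2 / blen r B.1) := by positivity
        have h1 : ∑ x ∈ Finset.range n, (rst (bst r B) (blen r B.1) z (x : ℤ)
            - (nab ^ r) (0 : ℤ → ℝ) (x : ℤ)) ^ 2 = ∑ x ∈ Finset.range n,
              (if x / blen r B.1 = B.2 then z (x : ℤ) ^ 2 else 0) := by
          apply Finset.sum_congr rfl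
          intro x _
          rw [map_zero, Pi.zero_apply, sub_zero]
          unfold rst bst
          have : x / blen r B.1 = B.2 ↔
              ((B.2 : ℤ) * (blen r B.1 : ℤ) ≤ x ∧ (x : ℤ) < B.2 * blen r B.1 + blen r B.1) := by
            rw [Nat.div_eq_iff (by omega)]
            zify
            omega
          by_cases hc : x / blen r B.1 = B.2
          · rw [if_pos hc, if_pos (this.1 hc)]
          · rw [if_neg hc, if_neg (fun h => hc (this.2 h))]; ring
        rw [h1]
        linarith
    · have hbl : (blen r B.1 : ℤ) = (r : ℤ) * ((2 ^ B.1 : ℕ) : ℤ) := by unfold blen; push_cast; ring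
      have hblr : (blen r B.1 : ℝ) = (r : ℝ) * ((2 ^ B.1 : ℕ) : ℝ) := by unfold blen; push_cast; ring
      obtain ⟨g, g1, g2, g3, g4, g5⟩ := H (2 ^ B.1) Nat.one_le_two_pow (bst r B) z (m B)
        (by rw [← hbl]; exact hm B hBW) (-ε) (by rw [neg_sq]; exact hε)
      rw [← hbl] at g1 g4 g5
      rw [← hblr] at g3
      refine ⟨g, fun _ => ⟨?_, ⟨-ε, by rw [neg_sq]; exact hε, g2, ?_⟩, ?_, ?_, ?_⟩⟩
      · intro t ht
        rw [hnb] at ht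
        exact g1 t (by omega)
      · intro t ht
        rw [hnb] at ht
        have := w4 t (by omega) (by omega)
        linarith
      · intro t
        refine (g3 t).trans ?_
        rw [mul_assoc]
        exact mul_le_mul_of_nonneg_left (hQ B hBW hko) hC.le
      · intro t ht
        rw [hnb] at ht
        exact g5 t (by omega)
      · rw [if_neg hko, add_zero]
        set y : ℤ → ℝ := fun t => rst (bst r B) (blen r B.1) z t - (nab ^ r) g t with hy
        calc ∑ x ∈ Finset.range n, y (x : ℤ) ^ 2
            = ∑ t ∈ (Finset.range n).image (fun x : ℕ => (x : ℤ)), y t ^ 2 := by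
              rw [Finset.sum_image (by intro a _ b _ h; simpa using h)]
          _ = ∑ t ∈ ((Finset.range n).image (fun x : ℕ => (x : ℤ))).filter (fun t => inNb r t B),
                y t ^ 2 := by
              symm
              apply Finset.sum_subset (Finset.filter_subset _ _)
              intro t ht hn
              have : y t = 0 := by
                apply g5 t
                by_contra hcon
                apply hn
                rw [Finset.mem_filter, hnb]
                exact ⟨ht, by omega⟩
              rw [this]; ring
          _ ≤ ∑ t ∈ ((Finset.range n).image (fun x : ℕ => (x : ℤ))).filter (fun t => inNb r t B),
                (C * (m B / ((2 ^ B.1 : ℕ) : ℝ))) ^ 2 := by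
              apply Finset.sum_le_sum
              intro t _
              rw [← sq_abs]
              exact pow_le_pow_left₀ (abs_nonneg _) (g4 t) 2
          _ ≤ (3 * blen r B.1) * (C * (m B / ((2 ^ B.1 : ℕ) : ℝ))) ^ 2 := by
              rw [Finset.sum_const, nsmul_eq_mul]
              apply mul_le_mul_of_nonneg_right _ (by positivity)
              have h1 : (((Finset.range n).image (fun x : ℕ => (x : ℤ))).filter
                  (fun t => inNb r t B)).card ≤
                  (Finset.Ico (bst r B - blen r B.1) (bst r B + 2 * blen r B.1)).card := by
                apply Finset.card_le_card
                intro t ht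
                rw [Finset.mem_filter, hnb] at ht
                exact Finset.mem_Ico.2 ht.2
              rw [Int.card_Ico] at h1
              have h2 : (bst r B + 2 * blen r B.1 - (bst r B - blen r B.1)).toNat
                  = 3 * blen r B.1 := by omega
              rw [h2] at h1
              exact_mod_cast h1
          _ = _ := by
              rw [hblr]
              have h1 : ((2 ^ B.1 : ℕ) : ℝ) ≠ 0 := by positivity
              have h2 : (r : ℝ) ≠ 0 := by positivity
              field_simp
  choose g hg using hch
  have hsmall : ∀ t : ℤ, (W.filter fun B => inNb r t B).card ≤ 12 := by
    intro t
    apply whit_overlap hr t _ (Finset.filter_subset _ _)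
    intro B hB
    exact (Finset.mem_filter.1 hB).2
  have hgsum : ∀ t, ∑ B ∈ W, g B t = ∑ B ∈ W.filter (fun B => inNb r t B), g B t := by
    intro t
    symm
    apply Finset.sum_subset (Finset.filter_subset _ _)
    intro B hB hn
    apply (hg B hB).1 t
    intro h
    exact hn (Finset.mem_filter.2 ⟨hB, h⟩)
  have hgabs : ∀ t, |∑ B ∈ W, g B t| ≤ 12 * (C * Q) := by
    intro t
    rw [hgsum]
    refine (Finset.abs_sum_le_sum_abs _ _).trans ?_
    refine (Finset.sum_le_card_nsmul _ _ (C * Q) ?_).trans ?_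
    · intro B hB
      exact (hg B (Finset.mem_filter.1 hB).1).2.2.1 t
    · rw [nsmul_eq_mul]
      apply mul_le_mul_of_nonneg_right _ (by positivity)
      exact_mod_cast hsmall t
  have hgz : ∀ t, (∀ B ∈ W, ¬ inNb r t B) → ∑ B ∈ W, g B t = 0 := by
    intro t ht
    apply Finset.sum_eq_zero
    intro B hB
    exact (hg B hB).1 t (ht B hB)
  refine ⟨lam • chi r k p s + ∑ B ∈ W, g B, ?_, ?_, ?_, ?_⟩
  · intro t ht
    rw [Pi.add_apply, Pi.smul_apply, Finset.sum_apply, chi_out r k p s hp hs0 hsk t (by omega),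
      hgz t, smul_zero, add_zero]
    intro B hB hcon
    obtain ⟨w1, w2, _⟩ := whit_chi r k n J hr p s hp hs0 hp0 hpk B hB
    have hbp : (0 : ℤ) < blen r B.1 := by exact_mod_cast blen_pos r B.1 hr
    unfold inNb at hcon
    unfold bst at w1 w2
    rw [sub_mul, add_mul] at hcon
    omega
  · intro t
    rw [Pi.add_apply, Pi.smul_apply, Finset.sum_apply, smul_eq_mul]
    have hx := abs_le.1 (chi_abs r k p s hp hs0 hsk hs t)
    have hg' := abs_le.1 (hgabs t)
    rw [abs_le]
    rcases lt_trichotomy (chi r k p s t) 0 with h | h | h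
    · have h2 : 0 ≤ ∑ B ∈ W, g B t := by
        rw [hgsum]
        apply Finset.sum_nonneg
        intro B hB
        rw [Finset.mem_filter] at hB
        obtain ⟨ε, e1, e2, e3⟩ := (hg B hB.1).2.1
        have := e2 t
        have h3 := e3 t hB.2
        rcases (show ε = 1 ∨ ε = -1 by simpa using e1) with e | e
        · rw [e] at this; linarith
        · rw [e] at h3; linarith
      constructor <;> nlinarith
    · rw [h]; constructor <;> linarith
    · have h2 : ∑ B ∈ W, g B t ≤ 0 := by
        rw [hgsum]
        apply Finset.sum_nonpos
        intro B hB
        rw [Finset.mem_filter] at hB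
        obtain ⟨ε, e1, e2, e3⟩ := (hg B hB.1).2.1
        have := e2 t
        have h3 := e3 t hB.2
        rcases (show ε = 1 ∨ ε = -1 by simpa using e1) with e | e
        · rw [e] at h3; linarith
        · rw [e] at this; linarith
      constructor <;> nlinarith
  · intro i hi
    rw [Pi.add_apply, Pi.smul_apply, Finset.sum_apply, smul_eq_mul, chi_p r k p s hp hs0 i hi,
      hgz, add_zero]
    intro B hB hcon
    obtain ⟨w1, w2, w3, _⟩ := whit_chi r k n J hr p s hp hs0 hp0 hpk B hB
    have hbp : (0 : ℤ) < blen r B.1 := by exact_mod_cast blen_pos r B.1 hr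
    have := w3 i (by omega)
    unfold inNb at hcon
    unfold bst at this
    rw [sub_mul, add_mul] at hcon
    omega
  · set y : ℕ × ℕ → ℤ → ℝ := fun B t => rst (bst r B) (blen r B.1) z t - (nab ^ r) (g B) t with hy
    have hyz : ∀ B ∈ W, ∀ t, ¬ inNb r t B → y B t = 0 := fun B hB t ht => (hg B hB).2.2.2.1 t ht
    have hdec : ∀ x ∈ Finset.range n, z (x : ℤ) = ∑ B ∈ W, rst (bst r B) (blen r B.1) z (x : ℤ)
        + if x ∈ untr r n J E then z (x : ℤ) else 0 := by
      intro x hx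
      have hrst : ∀ B : ℕ × ℕ, rst (bst r B) (blen r B.1) z (x : ℤ) =
          if B.2 = x / blen r B.1 then z x else 0 := by
        intro B
        have hbp : 0 < blen r B.1 := blen_pos r B.1 hr
        have : B.2 = x / blen r B.1 ↔
              ((B.2 : ℤ) * (blen r B.1 : ℤ) ≤ x ∧ (x : ℤ) < B.2 * blen r B.1 + blen r B.1) := by
            rw [eq_comm, Nat.div_eq_iff hbp]
            zify
            omega
        unfold rst bst
        by_cases hc : B.2 = x / blen r B.1
        · rw [if_pos hc, if_pos (this.1 hc)]
        · rw [if_neg hc, if_neg (fun h => hc (this.2 h))]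
      simp only [hrst]
      by_cases hu : x ∈ untr r n J E
      · rw [if_pos hu, Finset.sum_eq_zero, zero_add]
        intro B hB
        rw [if_neg]
        intro h
        apply (Finset.mem_filter.1 hu).2
        exact ⟨B.1, by rw [← h]; exact hB⟩
      · rw [if_neg hu, add_zero]
        have : ∃ j, (j, x / blen r j) ∈ W := by
          by_contra hcon
          exact hu (Finset.mem_filter.2 ⟨hx, hcon⟩)
        obtain ⟨j, hj⟩ := this
        rw [Finset.sum_eq_single_of_mem _ hj, if_pos rfl]
        intro B hB hne
        rw [if_neg]
        intro h
        exact hne (whit_disj hr hB hj h rfl)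
    have hpt : ∀ x ∈ Finset.range n,
        (z (x : ℤ) - (nab ^ r) (lam • chi r k p s + ∑ B ∈ W, g B) (x : ℤ)) ^ 2 ≤
        3 * (lam ^ 2 * ((nab ^ r) (chi r k p s) (x : ℤ)) ^ 2) + 36 * ∑ B ∈ W, y B x ^ 2 +
          3 * (if x ∈ untr r n J E then z (x : ℤ) ^ 2 else 0) := by
      intro x hx
      have e1 : z (x : ℤ) - (nab ^ r) (lam • chi r k p s + ∑ B ∈ W, g B) (x : ℤ) =
          -(lam * (nab ^ r) (chi r k p s) x) + ∑ B ∈ W, y B x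
            + (if x ∈ untr r n J E then z (x : ℤ) else 0) := by
        have hd := hdec x hx
        rw [map_add, map_smul, map_sum, Pi.add_apply, Pi.smul_apply, Finset.sum_apply,
          smul_eq_mul]
        have : ∑ B ∈ W, y B x = ∑ B ∈ W, rst (bst r B) (blen r B.1) z (x : ℤ)
            - ∑ B ∈ W, (nab ^ r) (g B) (x : ℤ) := by
          rw [← Finset.sum_sub_distrib]
        rw [this]
        linarith
      have e2 : (∑ B ∈ W, y B x) ^ 2 ≤ 12 * ∑ B ∈ W, y B x ^ 2 := by
        have hz' : ∀ B ∈ W, B ∉ W.filter (fun B => inNb r x B) → y B x = 0 := by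
          intro B hB hn
          apply hyz B hB
          intro h
          exact hn (Finset.mem_filter.2 ⟨hB, h⟩)
        rw [← Finset.sum_subset (Finset.filter_subset (fun B => inNb r x B) W) hz',
          ← Finset.sum_subset (Finset.filter_subset (fun B => inNb r x B) W)
            (fun B hB hn => by rw [hz' B hB hn]; ring)]
        refine sq_sum_le_card_mul_sum_sq.trans ?_
        apply mul_le_mul_of_nonneg_right
        · exact_mod_cast hsmall x
        · exact Finset.sum_nonneg fun i _ => sq_nonneg _
      have e3 : (if x ∈ untr r n J E then z (x : ℤ) ^ 2 else 0)
          = (if x ∈ untr r n J E then z (x : ℤ) else 0) ^ 2 := by split_ifs <;> ring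
      rw [e1, e3]
      set a := lam * (nab ^ r) (chi r k p s) x with ha
      have ha2 : lam ^ 2 * ((nab ^ r) (chi r k p s) (x : ℤ)) ^ 2 = a ^ 2 := by rw [ha]; ring
      rw [ha2]
      generalize (if x ∈ untr r n J E then z (x : ℤ) else 0) = c at *
      generalize ∑ B ∈ W, y B x = b at *
      nlinarith [sq_nonneg (a + b), sq_nonneg (a + c), sq_nonneg (b - c)]
    refine (Finset.sum_le_sum hpt).trans ?_
    rw [Finset.sum_add_distrib, Finset.sum_add_distrib, ← Finset.mul_sum, ← Finset.mul_sum,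
      ← Finset.mul_sum, ← Finset.mul_sum, Finset.sum_comm, Finset.sum_ite_mem]
    have h_int : Finset.range n ∩ untr r n J E = untr r n J E :=
      Finset.inter_eq_right.2 (Finset.filter_subset _ _)
    rw [h_int]
    have hb : ∑ B ∈ W, ∑ x ∈ Finset.range n, y B x ^ 2 ≤ ∑ B ∈ W,
        (3 * r ^ 2 * C ^ 2 * (m B ^ 2 / blen r B.1) + if B ∈ ko then ∑ x ∈ Finset.range n,
              (if x / blen r B.1 = B.2 then z (x : ℤ) ^ 2 else 0) else 0) :=
      Finset.sum_le_sum fun B hB => (hg B hB).2.2.2.2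
    rw [Finset.sum_add_distrib, ← Finset.mul_sum] at hb
    rw [Finset.sum_add_distrib]
    have n1 : 0 ≤ lam ^ 2 * ∑ x ∈ Finset.range n, ((nab ^ r) (chi r k p s) (x : ℤ)) ^ 2 := by positivity
    have n2 : 0 ≤ ∑ B ∈ W, (m B ^ 2 / (blen r B.1 : ℝ)) := by positivity
    have n3 : 0 ≤ ∑ B ∈ W, (if B ∈ ko then ∑ x ∈ Finset.range n,
              (if x / blen r B.1 = B.2 then z (x : ℤ) ^ 2 else 0) else 0) := by
      apply Finset.sum_nonneg
      intro B _
      split_ifs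
      · apply Finset.sum_nonneg
        intro x _
        split_ifs <;> positivity
      · exact le_rfl
    have n4 : 0 ≤ ∑ x ∈ untr r n J E, z (x : ℤ) ^ 2 := by positivity
    generalize lam ^ 2 * ∑ x ∈ Finset.range n, ((nab ^ r) (chi r k p s) (x : ℤ)) ^ 2 = a1 at *
    generalize ∑ B ∈ W, (m B ^ 2 / (blen r B.1 : ℝ)) = a2 at *
    generalize ∑ B ∈ W, (if B ∈ ko then ∑ x ∈ Finset.range n,
              (if x / blen r B.1 = B.2 then z (x : ℤ) ^ 2 else 0) else 0) = a3 at *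
    generalize ∑ x ∈ untr r n J E, z (x : ℤ) ^ 2 = a4 at *
    have m1 : 0 ≤ 12 * C := by positivity
    have m2 : 0 ≤ 3 * (r : ℝ) ^ 2 * C ^ 2 := by positivity
    generalize 12 * C = c1 at *
    generalize 3 * (r : ℝ) ^ 2 * C ^ 2 = c2 at *
    have q1 : 0 ≤ c1 * (a1 + (a2 + a3) + a4) := by positivity
    have q2 : 0 ≤ c2 * (a1 + a3 + a4) := by positivity
    linarith
end

section


lemma sbp_one (M : ℕ) (w : ℤ → ℝ) (f : ℕ → ℝ) (hw : ∀ t, t < 0 ∨ (M : ℤ) ≤ t → w t = 0) :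
    ∑ t ∈ Finset.range M, w t * dseq f t = -∑ x ∈ Finset.range (M + 1), nab w x * f x := by
  have key : ∀ m : ℕ, ∑ t ∈ Finset.range m, w t * dseq f t =
      -∑ x ∈ Finset.range (m + 1), nab w x * f x + w m * f m := by
    intro m
    induction m with
    | zero =>
      simp [nab_apply, hw (-1) (by omega)]
    | succ m ih =>
      rw [Finset.sum_range_succ, ih, Finset.sum_range_succ _ (m + 1)]
      unfold dseq
      rw [nab_apply]
      push_cast
      rw [add_sub_cancel_right]
      ring
  rw [key, hw M (by omega)]
  ring

lemma sbp (r M : ℕ) (w : ℤ → ℝ) (f : ℕ → ℝ) (hw : ∀ t, t < 0 ∨ (M : ℤ) ≤ t → w t = 0) :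
    ∑ t ∈ Finset.range M, w t * (dseq^[r] f) t =
      (-1) ^ r * ∑ x ∈ Finset.range (M + r), (nab ^ r) w x * f x := by
  induction r generalizing f with
  | zero => simp
  | succ r ih =>
    rw [Function.iterate_succ_apply, ih, sbp_one, pow_succ' nab, ← add_assoc, pow_succ]
    · simp only [Module.End.mul_apply]
      ring
    · intro t ht
      apply nab_pow_supp w 0 M hw r
      push_cast at ht
      exact ht

lemma cert (r n : ℕ) (hn : r ≤ n) (θ : Fin n → ℝ) (lam : ℝ) (hlam : 0 < lam)
    (u : ℤ → ℝ) (hu : ∀ t, t < 0 ∨ (n : ℤ) - r ≤ t → u t = 0) (hu2 : ∀ t, |u t| ≤ lam)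
    (hu3 : ∀ t : ℕ, t < n - r → (-1) ^ r * u t * DD r θ t = lam * |DD r θ t|) :
    ∃ v ∈ subdiff (fun α => Dl1 r α) θ, ∀ i : Fin n, lam * v i = (nab ^ r) u (i : ℕ) := by
  refine ⟨fun i => (nab ^ r) u (i : ℕ) / lam, ?_, fun i => by field_simp⟩
  have key : ∀ y : Fin n → ℝ, ∑ i : Fin n, (nab ^ r) u (i : ℕ) / lam * y i =
      ∑ t ∈ Finset.range (n - r), ((-1) ^ r * u t * DD r y t) / lam := by
    intro y
    have h := sbp r (n - r) u (pad y) (by intro t ht; apply hu; omega)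
    rw [Nat.sub_add_cancel hn] at h
    have h2 : ∑ t ∈ Finset.range (n - r), ((-1) ^ r * u t * DD r y t) / lam =
        (-1) ^ r * (∑ t ∈ Finset.range (n - r), u t * (dseq^[r] (pad y)) t) / lam := by
      rw [Finset.mul_sum, Finset.sum_div]
      apply Finset.sum_congr rfl
      intro t _
      unfold DD
      ring
    rw [h2, h, ← mul_assoc, ← mul_pow, neg_one_mul, neg_neg, one_pow, one_mul, Finset.sum_div,
      Finset.sum_range]
    apply Finset.sum_congr rfl
    intro i _
    have : pad y i = y i := by simp [pad]
    rw [this]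
    ring
  intro y
  dsimp only
  have h1 : Dl1 r θ = ∑ i : Fin n, (nab ^ r) u (i : ℕ) / lam * θ i := by
    rw [key]
    unfold Dl1
    apply Finset.sum_congr rfl
    intro t ht
    rw [hu3 t (Finset.mem_range.1 ht)]
    field_simp
  have h2 : ∑ i : Fin n, (nab ^ r) u (i : ℕ) / lam * y i ≤ Dl1 r y := by
    rw [key]
    unfold Dl1
    apply Finset.sum_le_sum
    intro t _
    rw [div_le_iff₀ hlam]
    refine (le_abs_self _).trans ?_
    rw [abs_mul, abs_mul, abs_pow, abs_neg, abs_one, one_pow, one_mul, mul_comm]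
    exact mul_le_mul_of_nonneg_left (hu2 _) (abs_nonneg _)
  simp only [mul_sub, Finset.sum_sub_distrib]
  linarith

/-- The (0-indexed) knot positions, on `ℤ`. -/
def kp (n r k : ℕ) (j : Fin k → ℕ) (i : ℕ) : ℤ := (jext n r k j i : ℤ) - 2

/-- The signs twisted by `(-1)^r`. -/
def ks (r k : ℕ) (sg : Fin k → ℝ) (i : ℕ) : ℝ := (-1) ^ r * sgext k sg i

section knots
variable {r n : ℕ} {θ : Fin n → ℝ} {k : ℕ} {j : Fin k → ℕ} {sg : Fin k → ℝ}

lemma DD_succ (hr : 1 ≤ r) (t : ℕ) : DD r θ t = DD (r - 1) θ (t + 1) - DD (r - 1) θ t := by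
  obtain ⟨q, rfl⟩ : ∃ q, r = q + 1 := ⟨r - 1, by omega⟩
  unfold DD
  rw [Function.iterate_succ_apply']
  rfl

lemma jext_mid (i : ℕ) (hi : i < k) : jext n r k j (i + 1) = j ⟨i, hi⟩ := by
  unfold jext
  rw [if_neg (by omega)]
  simp [hi]

lemma jext_last : jext n r k j (k + 1) = n - r + 2 := by
  unfold jext
  simp

lemma sgext_mid (i : ℕ) (hi : i < k) : sgext k sg (i + 1) = sg ⟨i, hi⟩ := by
  unfold sgext
  simp [hi]

lemma kp_lt (hr : 1 ≤ r) (hn : r < n) (h : IsKnotSeq r n θ k j sg) (i : ℕ) (hi : i ≤ k) :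
    kp n r k j i < kp n r k j (i + 1) := by
  obtain ⟨h1, h2, h3, h4⟩ := h
  unfold kp
  have : jext n r k j i < jext n r k j (i + 1) := by
    rcases hi.eq_or_lt with rfl | hi
    · rw [jext_last]
      rcases Nat.eq_zero_or_pos i with rfl | h0
      · unfold jext; simp
      · obtain ⟨q, rfl⟩ : ∃ q, i = q + 1 := ⟨i - 1, by omega⟩
        rw [jext_mid q (by omega)]
        have := (h2 ⟨q, by omega⟩).2
        omega
    · rw [jext_mid i hi]
      rcases Nat.eq_zero_or_pos i with rfl | h0
      · unfold jext; simp; have := (h2 ⟨0, hi⟩).1; omega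
      · obtain ⟨q, rfl⟩ : ∃ q, i = q + 1 := ⟨i - 1, by omega⟩
        rw [jext_mid q (by omega)]
        apply h1
        simp
  omega

lemma kp_zero : kp n r k j 0 = -1 := by unfold kp jext; simp

lemma kp_last (hn : r ≤ n) : kp n r k j (k + 1) = (n : ℤ) - r := by
  unfold kp
  rw [jext_last]
  omega

lemma ks_zero : ks r k sg 0 = 0 := by unfold ks sgext; simp

lemma ks_last : ks r k sg (k + 1) = 0 := by unfold ks sgext; simp

lemma ks_abs (h : IsKnotSeq r n θ k j sg) (i : ℕ) : |ks r k sg i| ≤ 1 := by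
  obtain ⟨h1, h2, h3, h4⟩ := h
  unfold ks sgext
  rw [abs_mul, abs_pow, abs_neg, abs_one, one_pow, one_mul]
  split_ifs with hh
  · rw [h4]
    split_ifs <;> simp
  · simp

lemma ks_cert (hr : 1 ≤ r) (hn : r < n) (h : IsKnotSeq r n θ k j sg) (lam : ℝ) (u : ℤ → ℝ)
    (hu : ∀ i ≤ k, u (kp n r k j i) = lam * ks r k sg i) (t : ℕ) (ht : t < n - r) :
    (-1) ^ r * u t * DD r θ t = lam * |DD r θ t| := by
  obtain ⟨h1, h2, h3, h4⟩ := h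
  by_cases h0 : DD r θ t = 0
  · rw [h0]; simp
  · have hd := DD_succ (θ := θ) hr t
    obtain ⟨i, hi⟩ := (h3 (t + 2) (by omega) (by omega)).1 (by
      intro hcon
      simp only [Nat.add_sub_cancel] at hcon
      apply h0
      rw [hd, hcon]
      simp)
    have e1 := hu (i + 1) (by omega)
    unfold kp ks at e1
    rw [jext_mid i i.2, sgext_mid i i.2, Fin.eta, hi] at e1
    push_cast at e1
    rw [add_sub_cancel_right, h4, hi] at e1
    simp only [Nat.add_sub_cancel, show t + 2 - 1 = t + 1 by omega] at e1
    rw [e1]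
    have hsq : ((-1 : ℝ) ^ r) * (-1) ^ r = 1 := by rw [← mul_pow]; simp
    split_ifs with hlt
    · rw [abs_of_pos (by linarith)]
      linear_combination lam * DD r θ t * hsq
    · have : DD r θ t < 0 := lt_of_le_of_ne (by linarith) h0
      rw [abs_of_neg this]
      linear_combination -lam * DD r θ t * hsq

lemma k_pos (hr : 1 ≤ r) (h : IsKnotSeq r n θ k j sg) (hne : ∃ t < n - r, DD r θ t ≠ 0) :
    1 ≤ k := by
  obtain ⟨h1, h2, h3, h4⟩ := h
  obtain ⟨t, ht, h0⟩ := hne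
  have hd := DD_succ (θ := θ) hr t
  obtain ⟨i, hi⟩ := (h3 (t + 2) (by omega) (by omega)).1 (by
      intro hcon
      simp only [Nat.add_sub_cancel] at hcon
      apply h0
      rw [hd, hcon]
      simp)
  have := i.2
  omega

lemma nstar_bd (hr : 1 ≤ r) (hn : r < n) (h : IsKnotSeq r n θ k j sg) (i : ℕ) (hi : i ≤ k) :
    0 < nstar n r k j i ∧ nstar n r k j i ≤ 2 * r ^ 2 * gh r (kp n r k j) i := by
  have hk := kp_lt hr hn h i hi
  have hg := le_gh r hr _ i hk
  have hg1 := gh_pos r (kp n r k j) i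
  have hlen : 1 ≤ nlen n r k j i ∧ (nlen n r k j i : ℤ) ≤
      r * (kp n r k j (i + 1) - kp n r k j i) := by
    unfold nlen
    split_ifs with h0
    · subst h0
      clear hg
      unfold kp at *
      have e : jext n r k j 0 = 1 := by unfold jext; simp
      rw [e] at hk ⊢
      simp only [zero_add] at *
      generalize jext n r k j 1 = q at *
      push_cast at *
      refine ⟨by omega, ?_⟩
      have h1 : (1 : ℤ) ≤ q - 1 := by omega
      have h2 : (1 : ℤ) ≤ r := by exact_mod_cast hr
      rw [Nat.cast_sub (by omega)]
      push_cast
      nlinarith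
    · unfold kp at *
      refine ⟨by omega, ?_⟩
      have h2 : (1 : ℤ) ≤ r := by exact_mod_cast hr
      rw [Nat.cast_sub (by omega)]
      nlinarith
  have hn0 : (0 : ℝ) < n := by exact_mod_cast (by omega : 0 < n)
  constructor
  · unfold nstar
    apply lt_min
    · exact_mod_cast hlen.1
    · positivity
  · refine (min_le_left _ _).trans ?_
    have : (nlen n r k j i : ℤ) ≤ 2 * r ^ 2 * gh r (kp n r k j) i := by
      refine hlen.2.trans ?_
      calc _ ≤ (r : ℤ) * (2 * ((r : ℤ) * (gh r (kp n r k j) i : ℤ))) :=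
            mul_le_mul_of_nonneg_left hg (by positivity)
        _ = _ := by ring
    exact_mod_cast this

open Classical in
lemma delta_bd (hr : 1 ≤ r) (hn : r < n) (h : IsKnotSeq r n θ k j sg) (hk : 1 ≤ k) :
    ∑ i ∈ Finset.range (k + 1), (if ks r k sg i ≠ ks r k sg (i + 1) then
      ((gh r (kp n r k j) i : ℝ) ^ (2 * r - 1))⁻¹ else 0) ≤
      (2 * (r : ℝ) ^ 2) ^ (2 * r - 1) * deltaSq n r k j sg := by
  have hone : ∀ i ≤ k, ((gh r (kp n r k j) i : ℝ) ^ (2 * r - 1))⁻¹ ≤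
      (2 * (r : ℝ) ^ 2) ^ (2 * r - 1) * nstar n r k j i ^ (1 - 2 * (r : ℤ)) := by
    intro i hi
    obtain ⟨a1, a2⟩ := nstar_bd hr hn h i hi
    have hg1 : (0 : ℝ) < gh r (kp n r k j) i := by exact_mod_cast gh_pos r (kp n r k j) i
    have e : (1 - 2 * (r : ℤ)) = -((2 * r - 1 : ℕ) : ℤ) := by omega
    rw [e, zpow_neg, zpow_natCast]
    rw [← div_eq_mul_inv, le_div_iff₀ (by positivity), inv_mul_le_iff₀ (by positivity), ← mul_pow]
    apply pow_le_pow_left₀ a1.le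
    linarith
  have hsg : ∀ i, ks r k sg i ≠ ks r k sg (i + 1) ↔ sgext k sg i ≠ sgext k sg (i + 1) := by
    intro i
    unfold ks
    rw [not_iff_not]
    constructor
    · intro h
      exact mul_left_cancel₀ (by positivity) h
    · intro h; rw [h]
  have hnn : ∀ i ≤ k, 0 ≤ (2 * (r : ℝ) ^ 2) ^ (2 * r - 1) * nstar n r k j i ^ (1 - 2 * (r : ℤ)) := by
    intro i hi
    have := (nstar_bd hr hn h i hi).1
    positivity
  rw [Finset.sum_range_succ, Finset.range_eq_Ico, Finset.sum_eq_sum_Ico_succ_bot (by omega)]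
  unfold deltaSq
  rw [mul_add, mul_add, Finset.mul_sum]
  have t1 : ∀ i ≤ k, (if ks r k sg i ≠ ks r k sg (i + 1) then
      ((gh r (kp n r k j) i : ℝ) ^ (2 * r - 1))⁻¹ else 0) ≤
      (2 * (r : ℝ) ^ 2) ^ (2 * r - 1) * nstar n r k j i ^ (1 - 2 * (r : ℤ)) := by
    intro i hi
    split_ifs
    · exact hone i hi
    · exact hnn i hi
  have t2 : ∑ i ∈ Finset.Ico (0 + 1) k, (if ks r k sg i ≠ ks r k sg (i + 1) then
      ((gh r (kp n r k j) i : ℝ) ^ (2 * r - 1))⁻¹ else 0) ≤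
      ∑ i ∈ Finset.Ico 1 k, (2 * (r : ℝ) ^ 2) ^ (2 * r - 1) *
        (if sgext k sg i ≠ sgext k sg (i + 1) then nstar n r k j i ^ (1 - 2 * (r : ℤ)) else 0) := by
    apply Finset.sum_le_sum
    intro i hi
    rw [Finset.mem_Ico] at hi
    by_cases hc : sgext k sg i ≠ sgext k sg (i + 1)
    · rw [if_pos hc, if_pos ((hsg i).2 hc)]
      exact hone i (by omega)
    · rw [if_neg hc, if_neg (fun hh => hc ((hsg i).1 hh))]
      simp
  have := t1 0 (by omega)
  have := t1 k le_rfl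
  linarith

lemma deltaSq_nonneg (hr : 1 ≤ r) (hn : r < n) (h : IsKnotSeq r n θ k j sg) :
    0 ≤ deltaSq n r k j sg := by
  have hnn : ∀ i ≤ k, 0 ≤ nstar n r k j i ^ (1 - 2 * (r : ℤ)) := by
    intro i hi
    have := (nstar_bd hr hn h i hi).1
    positivity
  unfold deltaSq
  have a := hnn 0 (by omega)
  have b := hnn k le_rfl
  have : 0 ≤ ∑ i ∈ Finset.Ico 1 k,
      if sgext k sg i ≠ sgext k sg (i + 1) then nstar n r k j i ^ (1 - 2 * (r : ℤ)) else 0 := by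
    apply Finset.sum_nonneg
    intro i hi
    rw [Finset.mem_Ico] at hi
    split_ifs
    · exact hnn i (by omega)
    · exact le_rfl
  linarith
end knots
end

section

lemma gaussVec_one (n : ℕ) : gaussVec n 1 = Measure.pi (fun _ : Fin n => gaussianReal 0 1) := by
  unfold gaussVec; simp

instance gaussVec_prob (n : ℕ) (σ : ℝ) : IsProbabilityMeasure (gaussVec n σ) := by
  unfold gaussVec; infer_instance

lemma gaussVec_eval (n : ℕ) (i : Fin n) :
    MeasurePreserving (fun z : Fin n → ℝ => z i) (gaussVec n 1) (gaussianReal 0 1) := by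
  rw [gaussVec_one]
  exact measurePreserving_eval (fun _ : Fin n => gaussianReal 0 1) i

lemma gaussVec_smul (n : ℕ) (σ : ℝ) :
    MeasurePreserving (fun z : Fin n → ℝ => fun i => σ * z i) (gaussVec n 1) (gaussVec n σ) := by
  rw [gaussVec_one]
  unfold gaussVec
  refine measurePreserving_pi (fun _ : Fin n => gaussianReal 0 1)
    (fun _ : Fin n => gaussianReal 0 (σ ^ 2).toNNReal) (f := fun _ x => σ * x) (fun i => ?_)
  refine ⟨by fun_prop, ?_⟩
  rw [gaussianReal_map_const_mul]
  congr 1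
  · simp
  · ext; simp [sq_nonneg]

lemma gaussVec_flip (n : ℕ) (i : Fin n) :
    MeasurePreserving (fun z : Fin n → ℝ => fun l => if l = i then - z l else z l)
      (gaussVec n 1) (gaussVec n 1) := by
  rw [gaussVec_one]
  refine measurePreserving_pi (fun _ : Fin n => gaussianReal 0 1)
    (fun _ : Fin n => gaussianReal 0 1) (f := fun l x => if l = i then - x else x) (fun l => ?_)
  by_cases h : l = i
  · simp only [h, if_true]
    refine ⟨by fun_prop, ?_⟩
    rw [gaussianReal_map_neg]; simp
  · simp only [h, if_false]
    exact MeasurePreserving.id _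

lemma gaussVec_odd (n : ℕ) (i : Fin n) (h : (Fin n → ℝ) → ℝ) (hm : Measurable h)
    (ho : ∀ z : Fin n → ℝ, h (fun l => if l = i then - z l else z l) = - h z) :
    ∫ z, h z ∂gaussVec n 1 = 0 := by
  have h1 : ∫ z, h (fun l => if l = i then - z l else z l) ∂gaussVec n 1 = ∫ z, h z ∂gaussVec n 1 := by
    have := (gaussVec_flip n i).map_eq
    conv_rhs => rw [← this]
    rw [integral_map (gaussVec_flip n i).measurable.aemeasurable hm.aestronglyMeasurable]
  simp_rw [ho, integral_neg] at h1
  linarith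

lemma gaussVec_memLp (n : ℕ) (i : Fin n) (p : NNReal) :
    MemLp (fun z : Fin n → ℝ => z i) p (gaussVec n 1) :=
  (memLp_id_gaussianReal (μ := 0) (v := 1) p).comp_measurePreserving (gaussVec_eval n i)

lemma gaussVec_int_comp (n : ℕ) (i : Fin n) (g : ℝ → ℝ) (hg : Measurable g) :
    ∫ z, g (z i) ∂gaussVec n 1 = ∫ x, g x ∂gaussianReal 0 1 := by
  rw [← (gaussVec_eval n i).map_eq,
    integral_map (gaussVec_eval n i).measurable.aemeasurable hg.aestronglyMeasurable]

lemma gauss_sq_int : ∫ x, x ^ 2 ∂gaussianReal 0 1 = 1 := by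
  have h := variance_fun_id_gaussianReal (μ := 0) (v := 1)
  have h2 : MemLp (fun x : ℝ => x) 2 (gaussianReal 0 1) := memLp_id_gaussianReal (μ := 0) (v := 1) 2
  rw [variance_eq_sub h2] at h
  simp [integral_id_gaussianReal] at h
  exact h

lemma gaussVec_int_sq (n : ℕ) (i : Fin n) : ∫ z, (z i) ^ 2 ∂gaussVec n 1 = 1 := by
  rw [gaussVec_int_comp n i (fun x => x ^ 2) (by fun_prop), gauss_sq_int]

lemma gaussVec_integrable_sq (n : ℕ) (i : Fin n) :
    Integrable (fun z : Fin n → ℝ => (z i) ^ 2) (gaussVec n 1) :=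
  (gaussVec_memLp n i 2).integrable_sq

lemma gaussVec_integrable_pow4 (n : ℕ) (i : Fin n) :
    Integrable (fun z : Fin n → ℝ => (z i) ^ 4) (gaussVec n 1) := by
  have := (gaussVec_memLp n i 4).integrable_norm_pow (by norm_num)
  refine this.congr (Filter.Eventually.of_forall fun z => ?_)
  simp only [Real.norm_eq_abs]
  exact Even.pow_abs (by decide) _

lemma gaussVec_integrable_mul (n : ℕ) (i l : Fin n) :
    Integrable (fun z : Fin n → ℝ => z i * z l) (gaussVec n 1) :=
  MemLp.integrable_mul (p := 2) (q := 2) (gaussVec_memLp n i 2) (gaussVec_memLp n l 2)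

lemma gaussVec_int_mul (n : ℕ) (i l : Fin n) :
    ∫ z, z i * z l ∂gaussVec n 1 = if i = l then 1 else 0 := by
  by_cases h : i = l
  · subst h
    simp only [if_true]
    have e : ∀ z : Fin n → ℝ, z i * z i = z i ^ 2 := fun z => by ring
    simp_rw [e]
    exact gaussVec_int_sq n i
  · simp only [h, if_false]
    refine gaussVec_odd n i _ (by fun_prop) (fun z => ?_)
    have h' : ¬ l = i := fun hh => h hh.symm
    simp [h']

lemma gaussVec_integrable_sqnorm (n : ℕ) : Integrable (fun z : Fin n → ℝ => sqnorm z) (gaussVec n 1) := by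
  unfold sqnorm
  exact integrable_finsetSum _ (fun i _ => gaussVec_integrable_sq n i)

lemma gaussVec_lin (n : ℕ) (a : Fin n → ℝ) :
    Integrable (fun z : Fin n → ℝ => (∑ i, a i * z i) ^ 2) (gaussVec n 1) ∧
    ∫ z, (∑ i, a i * z i) ^ 2 ∂gaussVec n 1 = ∑ i, a i ^ 2 := by
  have e : ∀ z : Fin n → ℝ, (∑ i, a i * z i) ^ 2 = ∑ i, ∑ l, a i * a l * (z i * z l) := by
    intro z
    rw [sq, Finset.sum_mul_sum]
    refine Finset.sum_congr rfl fun i _ => Finset.sum_congr rfl fun l _ => by ring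
  simp_rw [e]
  have hi : ∀ i l, Integrable (fun z : Fin n → ℝ => a i * a l * (z i * z l)) (gaussVec n 1) :=
    fun i l => (gaussVec_integrable_mul n i l).const_mul _
  refine ⟨integrable_finsetSum _ fun i _ => integrable_finsetSum _ fun l _ => hi i l, ?_⟩
  rw [integral_finsetSum _ fun i _ => integrable_finsetSum _ fun l _ => hi i l]
  refine Finset.sum_congr rfl fun i _ => ?_
  rw [integral_finsetSum _ fun l _ => hi i l]
  simp_rw [integral_const_mul, gaussVec_int_mul]
  simp; ring

lemma pi_ac (n : ℕ) (μ ν : Measure ℝ) [SigmaFinite μ] [SigmaFinite ν] (h : μ ≪ ν) :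
    Measure.pi (fun _ : Fin n => μ) ≪ Measure.pi (fun _ : Fin n => ν) := by
  induction n with
  | zero => 
    rw [Measure.pi_of_empty, Measure.pi_of_empty]
  | succ n ih =>
    have e1 := (measurePreserving_piFinSuccAbove (fun _ : Fin (n+1) => μ) 0).symm
    have e2 := (measurePreserving_piFinSuccAbove (fun _ : Fin (n+1) => ν) 0).symm
    rw [← e1.map_eq, ← e2.map_eq]
    exact (h.prod ih).map e1.measurable

lemma gaussVec_ac (n : ℕ) : gaussVec n 1 ≪ volume := by
  rw [gaussVec_one, volume_pi]
  exact pi_ac n _ _ (gaussianReal_absolutelyContinuous 0 (by simp))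

instance gaussVec_gaussian (n : ℕ) : IsGaussian (gaussVec n 1) := by
  have h : gaussVec n 1 = (stdGaussian (EuclideanSpace ℝ (Fin n))).map
      (EuclideanSpace.equiv (Fin n) ℝ) := by
    rw [← map_pi_eq_stdGaussian, gaussVec_one, Measure.map_map (by fun_prop) (by fun_prop)]
    exact Measure.map_id.symm
  rw [h]; infer_instance

lemma gaussVec_mean (n : ℕ) : ∫ z, id z ∂gaussVec n 1 = 0 := by
  ext i
  have := ContinuousLinearMap.integral_comp_comm (ContinuousLinearMap.proj (R := ℝ) (φ := fun _ : Fin n => ℝ) i)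
    (IsGaussian.integrable_id (μ := gaussVec n 1))
  simp only [ContinuousLinearMap.proj_apply] at this
  rw [← this]
  simp only [id_eq, Pi.zero_apply]
  refine gaussVec_odd n i _ (by fun_prop) (fun z => by simp)

lemma gauss_rot (n : ℕ) (t : ℝ) :
    MeasurePreserving (ContinuousLinearMap.rotation (E := Fin n → ℝ) t)
      ((gaussVec n 1).prod (gaussVec n 1)) ((gaussVec n 1).prod (gaussVec n 1)) :=
  ⟨by fun_prop, IsGaussian.map_rotation_eq_self (gaussVec_mean n) t⟩
end

section

lemma eunorm_eq {n : ℕ} (x : Fin n → ℝ) : eunorm x = ‖(WithLp.toLp 2 x : EuclideanSpace ℝ (Fin n))‖ := by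
  rw [EuclideanSpace.norm_eq]; simp [eunorm, sqnorm]

lemma eunorm_nonneg {n : ℕ} (x : Fin n → ℝ) : 0 ≤ eunorm x := Real.sqrt_nonneg _

lemma sqnorm_nonneg {n : ℕ} (x : Fin n → ℝ) : 0 ≤ sqnorm x := Finset.sum_nonneg fun _ _ => sq_nonneg _

lemma eunorm_sq {n : ℕ} (x : Fin n → ℝ) : eunorm x ^ 2 = sqnorm x := Real.sq_sqrt (sqnorm_nonneg x)

lemma eunorm_add {n : ℕ} (x y : Fin n → ℝ) : eunorm (x + y) ≤ eunorm x + eunorm y := by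
  simp only [eunorm_eq]; exact norm_add_le _ _

lemma eunorm_smul {n : ℕ} (c : ℝ) (x : Fin n → ℝ) : eunorm (c • x) = |c| * eunorm x := by
  simp only [eunorm_eq, WithLp.toLp_smul, norm_smul, Real.norm_eq_abs]

lemma eunorm_le_sup {n : ℕ} (x : Fin n → ℝ) : eunorm x ≤ Real.sqrt n * ‖x‖ := by
  unfold eunorm
  rw [← Real.sqrt_sq (norm_nonneg x), ← Real.sqrt_mul (by positivity)]
  apply Real.sqrt_le_sqrt
  unfold sqnorm
  calc ∑ i, x i ^ 2 ≤ ∑ i : Fin n, ‖x‖ ^ 2 := by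
        refine Finset.sum_le_sum fun i _ => ?_
        rw [← sq_abs]
        exact pow_le_pow_left₀ (abs_nonneg _) (norm_le_pi_norm x i) 2
    _ = _ := by simp

section poincare
variable {n : ℕ} {f : (Fin n → ℝ) → ℝ} {L : ℝ}

lemma eulip_lipschitz (hL : 0 ≤ L) (hf : ∀ x y, |f x - f y| ≤ L * eunorm (x - y)) :
    LipschitzWith (Real.toNNReal (L * Real.sqrt n)) f := by
  refine LipschitzWith.of_dist_le_mul fun x y => ?_
  rw [Real.dist_eq, dist_eq_norm, Real.coe_toNNReal _ (by positivity), mul_assoc]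
  exact (hf x y).trans (mul_le_mul_of_nonneg_left (eunorm_le_sup _) hL)

lemma eulip_bound (hf : ∀ x y, |f x - f y| ≤ L * eunorm (x - y)) (hL : 0 ≤ L) :
    MemLp f 2 (gaussVec n 1) := by
  have hm : Measurable f := (eulip_lipschitz hL hf).continuous.measurable
  have hb : MemLp (fun x : Fin n → ℝ => |f 0| + L * eunorm x) 2 (gaussVec n 1) := by
    have hme : Measurable (fun x : Fin n → ℝ => eunorm x) := by unfold eunorm sqnorm; fun_prop
    have h0 : MemLp (fun x : Fin n → ℝ => eunorm x) 2 (gaussVec n 1) := by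
      rw [memLp_two_iff_integrable_sq hme.aestronglyMeasurable]
      simp_rw [eunorm_sq]; exact gaussVec_integrable_sqnorm n
    have h1 : MemLp (fun x : Fin n → ℝ => L * eunorm x) 2 (gaussVec n 1) := h0.const_mul L
    have h2 : MemLp (fun _ : Fin n → ℝ => |f 0|) 2 (gaussVec n 1) := memLp_const _
    exact h2.add h1
  refine hb.mono hm.aestronglyMeasurable (Filter.Eventually.of_forall fun x => ?_)
  have h1 := hf x 0
  rw [sub_zero] at h1
  have h3 : 0 ≤ L * eunorm x := mul_nonneg hL (eunorm_nonneg x)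
  rw [Real.norm_eq_abs, Real.norm_eq_abs, abs_of_nonneg (add_nonneg (abs_nonneg _) h3)]
  have h2 : |f x| ≤ |f x - f 0| + |f 0| := by
    have := abs_add_le (f x - f 0) (f 0); simpa using this
  linarith

lemma fderiv_sq_le (hL : 0 ≤ L) (hf : ∀ x y, |f x - f y| ≤ L * eunorm (x - y)) (x : Fin n → ℝ)
    (hd : DifferentiableAt ℝ f x) :
    ∑ i, (fderiv ℝ f x (Pi.single i 1)) ^ 2 ≤ L ^ 2 := by
  set a : Fin n → ℝ := fun i => fderiv ℝ f x (Pi.single i 1) with ha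
  have hlin : ∀ y : Fin n → ℝ, fderiv ℝ f x y = ∑ i, a i * y i := by
    intro y
    have : y = ∑ i, y i • (Pi.single i (1:ℝ) : Fin n → ℝ) := by
      ext l; simp [Finset.sum_apply, Pi.single_apply]
    conv_lhs => rw [this]
    rw [map_sum]
    refine Finset.sum_congr rfl fun i _ => ?_
    rw [map_smul, smul_eq_mul, mul_comm]
  have hb : ∀ y, |fderiv ℝ f x y| ≤ L * eunorm y := by
    intro y
    have h1 : HasLineDerivAt ℝ f (fderiv ℝ f x y) x y := hd.hasFDerivAt.hasLineDerivAt y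
    have h2 := h1.tendsto_slope_zero.abs
    refine le_of_tendsto h2 ?_
    filter_upwards [self_mem_nhdsWithin] with t ht
    have ht' : 0 < |t| := abs_pos.2 ht
    rw [smul_eq_mul, abs_mul, abs_inv]
    have h3 := hf (x + t • y) x
    rw [add_sub_cancel_left, eunorm_smul] at h3
    rw [inv_mul_le_iff₀ ht']
    linarith
  have h4 := hb a
  have h5 : fderiv ℝ f x a = sqnorm a := by
    rw [hlin]; unfold sqnorm; exact Finset.sum_congr rfl fun i _ => by ring
  rw [h5, abs_of_nonneg (sqnorm_nonneg a), ← eunorm_sq] at h4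
  have h6 : eunorm a ≤ L := by
    by_contra hc
    push Not at hc
    nlinarith [eunorm_nonneg a]
  change sqnorm a ≤ _
  rw [← eunorm_sq]
  exact pow_le_pow_left₀ (eunorm_nonneg a) h6 2

lemma fderiv_lin (x y : Fin n → ℝ) :
    fderiv ℝ f x y = ∑ i, fderiv ℝ f x (Pi.single i 1) * y i := by
  have : y = ∑ i, y i • (Pi.single i (1:ℝ) : Fin n → ℝ) := by
    ext l; simp [Finset.sum_apply, Pi.single_apply]
  conv_lhs => rw [this]
  rw [map_sum]
  refine Finset.sum_congr rfl fun i _ => ?_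
  rw [map_smul, smul_eq_mul, mul_comm]

/-- increment along a rotation -/
def rinc (f : (Fin n → ℝ) → ℝ) (t : ℝ) (p : (Fin n → ℝ) × (Fin n → ℝ)) : ℝ :=
  f (Real.cos t • p.1 + Real.sin t • p.2) - f p.1

lemma rinc_bound (hL : 0 ≤ L) (hf : ∀ x y, |f x - f y| ≤ L * eunorm (x - y)) (t : ℝ)
    (p : (Fin n → ℝ) × (Fin n → ℝ)) :
    rinc f t p ^ 2 ≤ t ^ 2 * (2 * L ^ 2 * (sqnorm p.1 + sqnorm p.2)) := by
  have h1 : |rinc f t p| ≤ L * (|t| * eunorm p.1 + |t| * eunorm p.2) := by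
    refine (hf _ _).trans (mul_le_mul_of_nonneg_left ?_ hL)
    have e : Real.cos t • p.1 + Real.sin t • p.2 - p.1 = (Real.cos t - 1) • p.1 + Real.sin t • p.2 := by
      module
    rw [e]
    refine (eunorm_add _ _).trans ?_
    rw [eunorm_smul, eunorm_smul]
    have h2 : |Real.sin t| ≤ |t| := Real.abs_sin_le_abs
    have h3 : |Real.cos t - 1| ≤ |t| := by
      have hl := Real.lipschitzWith_cos.dist_le_mul t 0
      simpa [Real.dist_eq] using hl
    gcongr <;> exact eunorm_nonneg _
  have h2 := pow_le_pow_left₀ (abs_nonneg _) h1 2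
  rw [sq_abs] at h2
  refine h2.trans ?_
  rw [← eunorm_sq, ← eunorm_sq]
  have e : (L * (|t| * eunorm p.1 + |t| * eunorm p.2)) ^ 2 = |t| ^ 2 * L ^ 2 * (eunorm p.1 + eunorm p.2) ^ 2 := by ring
  rw [e, sq_abs]
  have : (eunorm p.1 + eunorm p.2) ^ 2 ≤ 2 * (eunorm p.1 ^ 2 + eunorm p.2 ^ 2) := by
    nlinarith [sq_nonneg (eunorm p.1 - eunorm p.2)]
  calc t ^ 2 * L ^ 2 * (eunorm p.1 + eunorm p.2) ^ 2 ≤ t ^ 2 * L ^ 2 * (2 * (eunorm p.1 ^ 2 + eunorm p.2 ^ 2)) := by gcongr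
    _ = _ := by ring

lemma rinc_dom_integrable : Integrable (fun p : (Fin n → ℝ) × (Fin n → ℝ) =>
    (2 * L ^ 2 * (sqnorm p.1 + sqnorm p.2))) ((gaussVec n 1).prod (gaussVec n 1)) := by
  refine Integrable.const_mul ?_ _
  exact ((gaussVec_integrable_sqnorm n).comp_fst _).add ((gaussVec_integrable_sqnorm n).comp_snd _)

lemma rinc_meas (hL : 0 ≤ L) (hf : ∀ x y, |f x - f y| ≤ L * eunorm (x - y)) (t : ℝ) :
    Continuous (rinc f t) := by
  have := (eulip_lipschitz hL hf).continuous
  unfold rinc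
  fun_prop

lemma rinc_sq_integrable (hL : 0 ≤ L) (hf : ∀ x y, |f x - f y| ≤ L * eunorm (x - y)) (t : ℝ) :
    Integrable (fun p => rinc f t p ^ 2) ((gaussVec n 1).prod (gaussVec n 1)) := by
  refine ((rinc_dom_integrable (L := L)).const_mul (t ^ 2)).mono'
    ((rinc_meas hL hf t).pow 2).aestronglyMeasurable (Filter.Eventually.of_forall fun p => ?_)
  rw [Real.norm_eq_abs, abs_of_nonneg (sq_nonneg _)]
  exact rinc_bound hL hf t p

lemma rot_step (hL : 0 ≤ L) (hf : ∀ x y, |f x - f y| ≤ L * eunorm (x - y)) (M : ℕ) (hM : 1 ≤ M) :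
    ∫ p, (f p.2 - f p.1) ^ 2 ∂((gaussVec n 1).prod (gaussVec n 1)) ≤
      ∫ p, ((M:ℝ) * rinc f (Real.pi / 2 * (M:ℝ)⁻¹) p) ^ 2 ∂((gaussVec n 1).prod (gaussVec n 1)) := by
  set t : ℝ := Real.pi / 2 * (M:ℝ)⁻¹ with ht
  have hMt : (M:ℝ) * t = Real.pi / 2 := by
    rw [ht]; field_simp
  have key : ∀ p : (Fin n → ℝ) × (Fin n → ℝ), (f p.2 - f p.1) ^ 2 ≤
      M * ∑ m ∈ Finset.range M, rinc f t (ContinuousLinearMap.rotation (m * t) p) ^ 2 := by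
    intro p
    have e1 : ∀ m : ℕ, rinc f t (ContinuousLinearMap.rotation (m * t) p) =
        f (Real.cos ((m+1:ℕ) * t) • p.1 + Real.sin ((m+1:ℕ) * t) • p.2) -
          f (Real.cos (m * t) • p.1 + Real.sin (m * t) • p.2) := by
      intro m
      unfold rinc
      rw [ContinuousLinearMap.rotation_apply]
      congr 2
      have : ((m+1:ℕ):ℝ) * t = m * t + t := by push_cast; ring
      rw [this, Real.cos_add, Real.sin_add]
      simp only
      module
    have e2 := Finset.sum_range_sub (fun m : ℕ => f (Real.cos (m * t) • p.1 + Real.sin (m * t) • p.2)) M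
    rw [hMt] at e2
    simp only [Real.cos_pi_div_two, Real.sin_pi_div_two, Nat.cast_zero, zero_mul, Real.cos_zero,
      Real.sin_zero, zero_smul, one_smul, zero_add, add_zero] at e2
    rw [← e2]
    have := sq_sum_le_card_mul_sum_sq (s := Finset.range M) (f := fun m : ℕ =>
      rinc f t (ContinuousLinearMap.rotation (m * t) p))
    simp only [Finset.card_range] at this
    refine le_trans (le_of_eq ?_) this
    congr 1
    exact Finset.sum_congr rfl fun m _ => (e1 m).symm
  have hi : ∀ m : ℕ, Integrable (fun p => rinc f t (ContinuousLinearMap.rotation (m * t) p) ^ 2)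
      ((gaussVec n 1).prod (gaussVec n 1)) := fun m =>
    (gauss_rot n (m * t)).integrable_comp_of_integrable (rinc_sq_integrable hL hf t)
  have h_int : ∀ m : ℕ, ∫ p, rinc f t (ContinuousLinearMap.rotation (m * t) p) ^ 2 ∂((gaussVec n 1).prod (gaussVec n 1)) =
     ∫ p, rinc f t p ^ 2 ∂((gaussVec n 1).prod (gaussVec n 1)) := by
    intro m
    conv_rhs => rw [← (gauss_rot n (m * t)).map_eq]
    have hmm : Continuous (fun p => rinc f t p ^ 2) := (rinc_meas hL hf t).pow 2
    rw [integral_map (gauss_rot n (m*t)).measurable.aemeasurable hmm.aestronglyMeasurable]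
  calc _ ≤ ∫ p, M * ∑ m ∈ Finset.range M, rinc f t (ContinuousLinearMap.rotation (m * t) p) ^ 2 ∂((gaussVec n 1).prod (gaussVec n 1)) := by
        refine integral_mono_of_nonneg (Filter.Eventually.of_forall fun p => sq_nonneg _)
          ((integrable_finsetSum _ fun m _ => hi m).const_mul _) (Filter.Eventually.of_forall key)
    _ = _ := by
        rw [integral_const_mul, integral_finsetSum _ fun m _ => hi m]
        simp_rw [h_int, mul_pow]
        rw [integral_const_mul]
        simp; ring

theorem poincare (hL : 0 ≤ L) (hf : ∀ x y, |f x - f y| ≤ L * eunorm (x - y)) :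
    ∫ p, (f p.2 - f p.1) ^ 2 ∂((gaussVec n 1).prod (gaussVec n 1)) ≤ 5 / 2 * L ^ 2 := by
  set γ := gaussVec n 1 with hγ
  have hdiff : ∀ᵐ x ∂γ, DifferentiableAt ℝ f x :=
    (gaussVec_ac n).ae_le (eulip_lipschitz hL hf).ae_differentiableAt
  have hdiff2 : ∀ᵐ p ∂(γ.prod γ), DifferentiableAt ℝ f p.1 :=
    Measure.quasiMeasurePreserving_fst.ae hdiff
  set h : (Fin n → ℝ) × (Fin n → ℝ) → ℝ := fun p => (Real.pi / 2 * fderiv ℝ f p.1 p.2) ^ 2 with hh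
  have hlim : ∀ᵐ p ∂(γ.prod γ), Filter.Tendsto (fun M : ℕ => ((M:ℝ) * rinc f (Real.pi / 2 * (M:ℝ)⁻¹) p) ^ 2)
      Filter.atTop (nhds (h p)) := by
    filter_upwards [hdiff2] with p hp
    have hc : HasDerivAt (fun t : ℝ => Real.cos t • p.1 + Real.sin t • p.2) p.2 0 := by
      have h1 := ((Real.hasDerivAt_cos 0).smul_const p.1).add ((Real.hasDerivAt_sin 0).smul_const p.2)
      have h2 : (-Real.sin 0) • p.1 + Real.cos 0 • p.2 = p.2 := by simp
      rw [h2] at h1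
      exact h1
    have hc0 : Real.cos 0 • p.1 + Real.sin 0 • p.2 = p.1 := by simp
    have hd : HasDerivAt (fun t : ℝ => f (Real.cos t • p.1 + Real.sin t • p.2)) (fderiv ℝ f p.1 p.2) 0 := by
      have h1 : HasFDerivAt f (fderiv ℝ f p.1) (Real.cos 0 • p.1 + Real.sin 0 • p.2) := by
        rw [hc0]; exact hp.hasFDerivAt
      exact h1.comp_hasDerivAt (0:ℝ) hc
    have hs := hd.tendsto_slope_zero
    simp only [zero_add] at hs
    rw [hc0] at hs
    have htt : Filter.Tendsto (fun M : ℕ => Real.pi / 2 * (M:ℝ)⁻¹) Filter.atTop (nhdsWithin 0 {0}ᶜ) := by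
      rw [tendsto_nhdsWithin_iff]
      constructor
      · have := (tendsto_inv_atTop_nhds_zero_nat (𝕜 := ℝ)).const_mul (Real.pi / 2)
        simpa using this
      · filter_upwards [Filter.eventually_ge_atTop 1] with M hM
        have : (0:ℝ) < M := by exact_mod_cast hM
        have := Real.pi_pos
        simp only [Set.mem_compl_iff, Set.mem_singleton_iff]
        positivity
    have h2 := ((hs.comp htt).const_mul (Real.pi / 2)).pow 2
    refine h2.congr' ?_
    filter_upwards [Filter.eventually_ge_atTop 1] with M hM
    have : (0:ℝ) < M := by exact_mod_cast hM
    have := Real.pi_pos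
    simp only [Function.comp, smul_eq_mul, rinc]
    congr 1
    field_simp
  have hbd : ∀ M : ℕ, 1 ≤ M → ∀ p, ((M:ℝ) * rinc f (Real.pi / 2 * (M:ℝ)⁻¹) p) ^ 2 ≤
      (Real.pi / 2) ^ 2 * (2 * L ^ 2 * (sqnorm p.1 + sqnorm p.2)) := by
    intro M hM p
    have : (0:ℝ) < M := by exact_mod_cast hM
    rw [mul_pow]
    calc _ ≤ (M:ℝ) ^ 2 * ((Real.pi / 2 * (M:ℝ)⁻¹) ^ 2 * (2 * L ^ 2 * (sqnorm p.1 + sqnorm p.2))) := by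
          gcongr; exact rinc_bound hL hf _ p
      _ = _ := by field_simp
  have hT := tendsto_integral_filter_of_dominated_convergence (μ := γ.prod γ) (l := Filter.atTop)
    (F := fun (M : ℕ) p => ((M:ℝ) * rinc f (Real.pi / 2 * (M:ℝ)⁻¹) p) ^ 2) (f := h)
    (fun p => (Real.pi / 2) ^ 2 * (2 * L ^ 2 * (sqnorm p.1 + sqnorm p.2)))
    (Filter.Eventually.of_forall fun M => (((rinc_meas hL hf _).const_mul _).pow 2).aestronglyMeasurable)
    (by
      filter_upwards [Filter.eventually_ge_atTop 1] with M hM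
      refine Filter.Eventually.of_forall fun p => ?_
      rw [Real.norm_eq_abs, abs_of_nonneg (sq_nonneg _)]
      exact hbd M hM p)
    ((rinc_dom_integrable (L := L)).const_mul _) hlim
  have h1 : ∫ p, (f p.2 - f p.1) ^ 2 ∂(γ.prod γ) ≤ ∫ p, h p ∂(γ.prod γ) := by
    refine ge_of_tendsto hT ?_
    filter_upwards [Filter.eventually_ge_atTop 1] with M hM
    exact rot_step hL hf M hM
  have hhm : Measurable h := by
    have : h = fun p => (Real.pi / 2 * ∑ i, fderiv ℝ f p.1 (Pi.single i 1) * p.2 i) ^ 2 := by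
      ext p; simp only [hh]; rw [fderiv_lin]
    rw [this]
    have hmm : ∀ i : Fin n, Measurable (fun p : (Fin n → ℝ) × (Fin n → ℝ) => fderiv ℝ f p.1 (Pi.single i 1)) :=
      fun i => (measurable_fderiv_apply_const ℝ f (Pi.single i 1)).comp measurable_fst
    fun_prop
  have hhi : Integrable h (γ.prod γ) := by
    refine ((rinc_dom_integrable (L := L)).const_mul ((Real.pi / 2) ^ 2)).mono' hhm.aestronglyMeasurable ?_
    filter_upwards [hlim] with p hp
    rw [Real.norm_eq_abs, abs_of_nonneg (sq_nonneg _)]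
    refine le_of_tendsto hp ?_
    filter_upwards [Filter.eventually_ge_atTop 1] with M hM
    exact hbd M hM p
  refine h1.trans ?_
  rw [integral_prod _ hhi]
  have h2 : ∀ᵐ x ∂γ, ∫ y, h (x, y) ∂γ ≤ (Real.pi / 2) ^ 2 * L ^ 2 := by
    filter_upwards [hdiff] with x hx
    simp only [hh]
    have e : ∀ y, (Real.pi / 2 * fderiv ℝ f x y) ^ 2 =
        (Real.pi / 2) ^ 2 * (∑ i, fderiv ℝ f x (Pi.single i 1) * y i) ^ 2 := by
      intro y; rw [fderiv_lin x y, mul_pow]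
    rw [integral_congr_ae (Filter.Eventually.of_forall e), integral_const_mul, (gaussVec_lin n _).2]
    exact mul_le_mul_of_nonneg_left (fderiv_sq_le hL hf x hx) (by positivity)
  have h3 : ∫ x, ∫ y, h (x, y) ∂γ ∂γ ≤ ∫ x, (Real.pi / 2) ^ 2 * L ^ 2 ∂γ :=
    integral_mono_of_nonneg (Filter.Eventually.of_forall fun x => integral_nonneg fun y => sq_nonneg _)
      (integrable_const _) h2
  refine h3.trans ?_
  simp only [integral_const, probReal_univ, smul_eq_mul, one_mul]
  have hpi := Real.pi_lt_d2
  have hpi0 := Real.pi_pos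
  gcongr
  nlinarith

theorem poincare_var (hL : 0 ≤ L) (hf : ∀ x y, |f x - f y| ≤ L * eunorm (x - y)) :
    ∫ x, f x ^ 2 ∂(gaussVec n 1) - (∫ x, f x ∂(gaussVec n 1)) ^ 2 ≤ 5 / 4 * L ^ 2 := by
  have h := poincare hL hf
  set γ := gaussVec n 1 with hγ
  have hm := eulip_bound hf hL
  have hi : Integrable f γ := hm.integrable (by norm_num)
  have hi2 : Integrable (fun x => f x ^ 2) γ := hm.integrable_sq
  have hcr : Integrable (fun p : (Fin n → ℝ) × (Fin n → ℝ) => f p.2 * f p.1) (γ.prod γ) :=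
    (hi.mul_prod hi).congr (Filter.Eventually.of_forall fun p => mul_comm _ _)
  have e : ∀ p : (Fin n → ℝ) × (Fin n → ℝ), (f p.2 - f p.1) ^ 2 = f p.2 ^ 2 + f p.1 ^ 2 - 2 * (f p.2 * f p.1) := by
    intro p; ring
  simp_rw [e] at h
  have hA : Integrable (fun p : (Fin n → ℝ) × (Fin n → ℝ) => f p.2 ^ 2) (γ.prod γ) := hi2.comp_snd γ
  have hB : Integrable (fun p : (Fin n → ℝ) × (Fin n → ℝ) => f p.1 ^ 2) (γ.prod γ) := hi2.comp_fst γ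
  have hAB : Integrable (fun p : (Fin n → ℝ) × (Fin n → ℝ) => f p.2 ^ 2 + f p.1 ^ 2) (γ.prod γ) := hA.add hB
  rw [integral_sub hAB (hcr.const_mul 2), integral_add hA hB, integral_const_mul] at h
  have e1 : ∫ p : (Fin n → ℝ) × (Fin n → ℝ), f p.2 * f p.1 ∂(γ.prod γ) = (∫ x, f x ∂γ) ^ 2 := by
    have := integral_prod_mul (μ := γ) (ν := γ) f f
    rw [sq, ← this]
    exact integral_congr_ae (Filter.Eventually.of_forall fun p => mul_comm _ _)
  have e2 : ∫ p : (Fin n → ℝ) × (Fin n → ℝ), f p.2 ^ 2 ∂(γ.prod γ) = ∫ x, f x ^ 2 ∂γ := by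
    have := integral_fun_snd (μ := γ) (ν := γ) (fun x => f x ^ 2)
    simpa using this
  have e3 : ∫ p : (Fin n → ℝ) × (Fin n → ℝ), f p.1 ^ 2 ∂(γ.prod γ) = ∫ x, f x ^ 2 ∂γ := by
    have := integral_fun_fst (μ := γ) (ν := γ) (fun x => f x ^ 2)
    simpa using this
  rw [e1, e2, e3] at h
  linarith
end poincare
end

section

/-- extension of a vector to a function on the integers by zero -/
def zx {n : ℕ} (z : Fin n → ℝ) (x : ℤ) : ℝ := ∑ l : Fin n, (if (l : ℤ) = x then 1 else 0) * z l

lemma zx_coe {n : ℕ} (z : Fin n → ℝ) (i : Fin n) : zx z (i : ℕ) = z i := by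
  unfold zx
  rw [Finset.sum_eq_single i]
  · simp
  · intro b _ hb
    rw [if_neg]
    · simp
    · intro h; apply hb; ext; exact_mod_cast h
  · simp

lemma zx_out {n : ℕ} (z : Fin n → ℝ) (x : ℤ) (hx : ∀ l : Fin n, (l : ℤ) ≠ x) : zx z x = 0 := by
  unfold zx
  exact Finset.sum_eq_zero fun l _ => by simp [hx l]

/-- partial sums -/
def psum {n : ℕ} (a : ℤ) (z : Fin n → ℝ) (i : ℕ) : ℝ := ∑ x ∈ Finset.range i, zx z (a + x)

/-- running maximum of the partial sums multiplied by `s` -/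
def rmax {n : ℕ} (a : ℤ) (s : ℝ) (z : Fin n → ℝ) : ℕ → ℝ
  | 0 => 0
  | (i + 1) => max (rmax a s z i) (s * psum a z (i + 1))

lemma rmax_nonneg {n : ℕ} (a : ℤ) (s : ℝ) (z : Fin n → ℝ) (i : ℕ) : 0 ≤ rmax a s z i := by
  induction i with
  | zero => exact le_refl _
  | succ i ih => exact ih.trans (le_max_left _ _)

lemma rmax_mono {n : ℕ} (a : ℤ) (s : ℝ) (z : Fin n → ℝ) : Monotone (rmax a s z) :=
  monotone_nat_of_le_succ fun _ => le_max_left _ _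

lemma le_rmax {n : ℕ} (a : ℤ) (s : ℝ) (z : Fin n → ℝ) (i l : ℕ) (h : i ≤ l) :
    s * psum a z i ≤ rmax a s z l := by
  refine le_trans ?_ (rmax_mono a s z h)
  cases i with
  | zero => simp [psum, rmax]
  | succ i => exact le_max_right _ _

lemma rmax_att {n : ℕ} (a : ℤ) (s : ℝ) (z : Fin n → ℝ) (l : ℕ) :
    ∃ i ≤ l, rmax a s z l = s * psum a z i := by
  induction l with
  | zero => exact ⟨0, le_refl _, by simp [rmax, psum]⟩
  | succ l ih =>
    obtain ⟨i, hi, h⟩ := ih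
    rcases max_choice (rmax a s z l) (s * psum a z (l + 1)) with h1 | h1
    · exact ⟨i, by omega, by rw [rmax, h1, h]⟩
    · exact ⟨l + 1, le_refl _, by rw [rmax, h1]⟩

lemma zx_meas {n : ℕ} (x : ℤ) : Measurable (fun z : Fin n → ℝ => zx z x) := by
  unfold zx; fun_prop

lemma psum_meas {n : ℕ} (a : ℤ) (i : ℕ) : Measurable (fun z : Fin n → ℝ => psum a z i) := by
  unfold psum
  exact Finset.measurable_sum _ fun x _ => zx_meas _

lemma rmax_meas {n : ℕ} (a : ℤ) (s : ℝ) (i : ℕ) : Measurable (fun z : Fin n → ℝ => rmax a s z i) := by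
  induction i with
  | zero => simp only [rmax]; exact measurable_const
  | succ i ih => exact ih.max ((psum_meas a (i+1)).const_mul s)

lemma psum_lin {n : ℕ} (a : ℤ) (z : Fin n → ℝ) (i : ℕ) :
    psum a z i = ∑ l : Fin n, (if a ≤ (l:ℤ) ∧ (l:ℤ) < a + i then 1 else 0) * z l := by
  unfold psum zx
  rw [Finset.sum_comm]
  refine Finset.sum_congr rfl fun l _ => ?_
  rw [← Finset.sum_mul]
  congr 1
  split_ifs with h
  · rw [Finset.sum_eq_single ((l:ℤ) - a).toNat]
    · rw [if_pos]; omega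
    · intro b _ hb; rw [if_neg]; omega
    · intro hb; exfalso; apply hb; rw [Finset.mem_range]; omega
  · refine Finset.sum_eq_zero fun x hx => ?_
    rw [Finset.mem_range] at hx
    rw [if_neg]; omega

lemma ind_sum_le (n : ℕ) (a : ℤ) (i : ℕ) :
    ∑ l : Fin n, ((if a ≤ (l:ℤ) ∧ (l:ℤ) < a + i then 1 else 0 : ℝ)) ≤ i := by
  rw [Finset.sum_boole]
  have : (Finset.univ.filter fun l : Fin n => a ≤ (l:ℤ) ∧ (l:ℤ) < a + i).card ≤ (Finset.Ico a (a + i)).card := by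
    apply Finset.card_le_card_of_injOn (fun l : Fin n => (l : ℤ))
    · intro l hl
      simp only [Finset.coe_filter, Finset.mem_univ, true_and] at hl
      simp only [Finset.coe_Ico]
      exact hl
    · intro x _ y _ hxy
      simp only [Nat.cast_inj] at hxy
      exact Fin.ext hxy
  rw [Int.card_Ico] at this
  have h2 : (a + i - a).toNat = i := by omega
  rw [h2] at this
  exact_mod_cast this

lemma psum_sq_int (n : ℕ) (a : ℤ) (i : ℕ) :
    Integrable (fun z : Fin n → ℝ => psum a z i ^ 2) (gaussVec n 1) ∧
      ∫ z : Fin n → ℝ, psum a z i ^ 2 ∂gaussVec n 1 ≤ i := by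
  simp_rw [psum_lin]
  have := gaussVec_lin n (fun l : Fin n => (if a ≤ (l:ℤ) ∧ (l:ℤ) < a + i then 1 else 0 : ℝ))
  refine ⟨this.1, ?_⟩
  rw [this.2]
  refine le_trans (le_of_eq ?_) (ind_sum_le n a i)
  refine Finset.sum_congr rfl fun l _ => ?_
  split_ifs <;> simp

lemma psum_memLp (n : ℕ) (a : ℤ) (i : ℕ) : MemLp (fun z : Fin n → ℝ => psum a z i) 2 (gaussVec n 1) := by
  rw [memLp_two_iff_integrable_sq (psum_meas a i).aestronglyMeasurable]
  exact (psum_sq_int n a i).1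

lemma zx_memLp (n : ℕ) (x : ℤ) : MemLp (fun z : Fin n → ℝ => zx z x) 2 (gaussVec n 1) := by
  have := psum_memLp n x 1
  simpa [psum] using this

lemma rmax_memLp (n : ℕ) (a : ℤ) (s : ℝ) (i : ℕ) :
    MemLp (fun z : Fin n → ℝ => rmax a s z i) 2 (gaussVec n 1) := by
  induction i with
  | zero => simp only [rmax]; exact memLp_const _
  | succ i ih => 
    have h2 : MemLp (fun z : Fin n → ℝ => s * psum a z (i+1)) 2 (gaussVec n 1) := (psum_memLp n a (i+1)).const_mul s
    exact ih.sup h2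

lemma doob_path {n : ℕ} (a : ℤ) (s : ℝ) (z : Fin n → ℝ) (i : ℕ) :
    rmax a s z i ^ 2 ≤ 2 * rmax a s z i * (s * psum a z i) -
      2 * ∑ x ∈ Finset.range i, rmax a s z x * (s * zx z (a + x)) := by
  induction i with
  | zero => simp [rmax, psum]
  | succ i ih =>
    rw [Finset.sum_range_succ]
    have h1 : psum a z (i + 1) = psum a z i + zx z (a + i) := by
      unfold psum; rw [Finset.sum_range_succ]
    have h2 : s * zx z (a + i) = s * psum a z (i+1) - s * psum a z i := by rw [h1]; ring
    rw [h2]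
    simp only [rmax]
    set M := rmax a s z i
    set S := s * psum a z i
    set S' := s * psum a z (i+1)
    rcases max_choice M S' with h | h
    · rw [h]; nlinarith
    · rw [h]; nlinarith [sq_nonneg (M - S')]

lemma rmax_zx_int (n : ℕ) (a : ℤ) (s : ℝ) (i : ℕ) :
    ∫ z : Fin n → ℝ, rmax a s z i * (s * zx z (a + i)) ∂gaussVec n 1 = 0 := by
  by_cases h : ∃ l : Fin n, (l : ℤ) = a + i
  · obtain ⟨l, hl⟩ := h
    have hz : ∀ z : Fin n → ℝ, zx z (a + i) = z l := fun z => by rw [← hl]; exact zx_coe z l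
    refine gaussVec_odd n l _ ((rmax_meas a s i).mul ((zx_meas _).const_mul s)) (fun z => ?_)
    rw [hz, hz]
    have hr : ∀ x ≤ i, rmax a s (fun m => if m = l then - z m else z m) x = rmax a s z x := by
      intro x
      induction x with
      | zero => intro _; rfl
      | succ x ih =>
        intro hx
        simp only [rmax]
        rw [ih (by omega)]
        congr 2
        rw [psum_lin, psum_lin]
        refine Finset.sum_congr rfl fun m _ => ?_
        by_cases hm : m = l
        · subst hm
          rw [if_neg (by push_cast; omega)]; simp
        · simp [hm]
    rw [hr i le_rfl]
    simp
  · push Not at h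
    have hz : ∀ z : Fin n → ℝ, zx z (a + i) = 0 := fun z => zx_out z _ h
    simp [hz]

lemma doob (n : ℕ) (a : ℤ) (s : ℝ) (hs : s ^ 2 = 1) (i : ℕ) :
    ∫ z : Fin n → ℝ, rmax a s z i ^ 2 ∂gaussVec n 1 ≤ 4 * i := by
  have hp : ∀ z : Fin n → ℝ, rmax a s z i ^ 2 ≤ 4 * psum a z i ^ 2 -
      4 * ∑ x ∈ Finset.range i, rmax a s z x * (s * zx z (a + x)) := by
    intro z
    have h1 := doob_path a s z i
    have h2 : (s * psum a z i) ^ 2 = psum a z i ^ 2 := by rw [mul_pow, hs, one_mul]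
    nlinarith [sq_nonneg (rmax a s z i - 2 * (s * psum a z i))]
  have hi : ∀ x : ℕ, Integrable (fun z : Fin n → ℝ => rmax a s z x * (s * zx z (a + x))) (gaussVec n 1) := by
    intro x
    have h2 : MemLp (fun z : Fin n → ℝ => s * zx z (a + x)) 2 (gaussVec n 1) := (zx_memLp n _).const_mul s
    exact MemLp.integrable_mul (p := 2) (q := 2) (rmax_memLp n a s x) h2
  have hS := psum_sq_int n a i
  have hs1 : Integrable (fun z : Fin n → ℝ => ∑ x ∈ Finset.range i, rmax a s z x * (s * zx z (a + x))) (gaussVec n 1) :=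
    integrable_finsetSum _ fun x _ => hi x
  have h1 := integral_mono_of_nonneg (μ := gaussVec n 1) (Filter.Eventually.of_forall fun z : Fin n → ℝ => sq_nonneg (rmax a s z i))
    ((hS.1.const_mul 4).sub (hs1.const_mul 4)) (Filter.Eventually.of_forall hp)
  refine h1.trans ?_
  rw [integral_sub' (hS.1.const_mul 4) (hs1.const_mul 4), integral_const_mul, integral_const_mul,
    integral_finsetSum _ fun x _ => hi x]
  simp_rw [rmax_zx_int]
  simp only [Finset.sum_const_zero, mul_zero, sub_zero]
  linarith [hS.2]

/-- maximal absolute partial sum over a block -/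
def bmx {n : ℕ} (a : ℤ) (l : ℕ) (z : Fin n → ℝ) : ℝ := max (rmax a 1 z l) (rmax a (-1) z l)

lemma bmx_meas {n : ℕ} (a : ℤ) (l : ℕ) : Measurable (fun z : Fin n → ℝ => bmx a l z) :=
  (rmax_meas a 1 l).max (rmax_meas a (-1) l)

lemma bmx_nonneg {n : ℕ} (a : ℤ) (l : ℕ) (z : Fin n → ℝ) : 0 ≤ bmx a l z :=
  (rmax_nonneg a 1 z l).trans (le_max_left _ _)

lemma bmx_int (n : ℕ) (a : ℤ) (l : ℕ) :
    Integrable (fun z : Fin n → ℝ => bmx a l z ^ 2) (gaussVec n 1) ∧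
    ∫ z : Fin n → ℝ, bmx a l z ^ 2 ∂gaussVec n 1 ≤ 8 * l := by
  have h1 : MemLp (fun z : Fin n → ℝ => bmx a l z) 2 (gaussVec n 1) :=
    (rmax_memLp n a 1 l).sup (rmax_memLp n a (-1) l)
  have hi := h1.integrable_sq
  refine ⟨hi, ?_⟩
  have ha := (rmax_memLp n a 1 l).integrable_sq
  have hb := (rmax_memLp n a (-1) l).integrable_sq
  have h2 := integral_mono hi (ha.add hb) (fun z => by
    simp only [Pi.add_apply, bmx]
    rcases max_choice (rmax a 1 z l) (rmax a (-1) z l) with h | h <;> rw [h] <;> nlinarith [sq_nonneg (rmax a 1 z l), sq_nonneg (rmax a (-1) z l)])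
  rw [integral_add' ha hb] at h2
  have := doob n a 1 (by norm_num) l
  have := doob n a (-1) (by norm_num) l
  linarith

lemma psum_le_bmx {n : ℕ} (a : ℤ) (l : ℕ) (z : Fin n → ℝ) (i : ℕ) (h : i ≤ l) :
    |psum a z i| ≤ bmx a l z := by
  rw [abs_le]
  have h1 := le_rmax a 1 z i l h
  have h2 := le_rmax a (-1) z i l h
  have h3 := le_max_left (rmax a 1 z l) (rmax a (-1) z l)
  have h4 := le_max_right (rmax a 1 z l) (rmax a (-1) z l)
  constructor <;> unfold bmx <;> linarith

lemma cs_le_bmx {n : ℕ} (a : ℤ) (l : ℕ) (z : Fin n → ℝ) (t : ℤ) :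
    |cs a (rst a l (zx z)) t| ≤ bmx a l z := by
  have key : ∀ i : ℕ, i ≤ l → ∑ s ∈ Finset.Ico a (a + i), rst a l (zx z) s = psum a z i := by
    intro i hi
    unfold psum
    rw [Finset.sum_bij' (fun (s:ℤ) _ => (s - a).toNat) (fun (x:ℕ) _ => a + (x:ℤ))]
    · intro s hs; rw [Finset.mem_Ico] at hs; rw [Finset.mem_range]; omega
    · intro x hx; rw [Finset.mem_range] at hx; rw [Finset.mem_Ico]; omega
    · intro s hs; rw [Finset.mem_Ico] at hs; omega
    · intro x hx; rw [Finset.mem_range] at hx; omega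
    · intro s hs; rw [Finset.mem_Ico] at hs
      unfold rst
      rw [if_pos (by omega)]
      congr 1; omega
  by_cases h1 : t < a
  · rw [cs_lt _ _ _ h1]; simpa using bmx_nonneg a l z
  · by_cases h2 : t + 1 ≤ a + l
    · have := key (t + 1 - a).toNat (by omega)
      have e : a + ((t + 1 - a).toNat : ℤ) = t + 1 := by omega
      rw [e] at this
      unfold cs
      rw [this]
      exact psum_le_bmx a l z _ (by omega)
    · rw [cs_ge a (a + l) _ (fun t ht => by unfold rst; rw [if_neg (by omega)]) t (by omega), key l le_rfl]
      exact psum_le_bmx a l z _ le_rfl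

lemma gaussVec_exp (n : ℕ) (c : Fin n → ℝ) :
    Integrable (fun z : Fin n → ℝ => Real.exp (∑ i, c i * z i)) (gaussVec n 1) ∧
    ∫ z : Fin n → ℝ, Real.exp (∑ i, c i * z i) ∂gaussVec n 1 = Real.exp ((∑ i, c i ^ 2) / 2) := by
  simp_rw [Real.exp_sum]
  rw [gaussVec_one]
  refine ⟨Integrable.fintype_prod (f := fun i x => Real.exp (c i * x)) fun i => integrable_exp_mul_gaussianReal (c i), ?_⟩
  rw [integral_fintype_prod_eq_prod (fun i x => Real.exp (c i * x))]
  rw [Finset.sum_div, Real.exp_sum]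
  refine Finset.prod_congr rfl fun i _ => ?_
  have := mgf_gaussianReal (p := gaussianReal 0 1) (X := id) (μ := 0) (v := 1) (by simp) (c i)
  simp only [mgf, id_eq] at this
  rw [this]; simp

lemma psum_exp (n : ℕ) (a : ℤ) (i : ℕ) (α : ℝ) :
    Integrable (fun z : Fin n → ℝ => Real.exp (α * psum a z i)) (gaussVec n 1) ∧
    ∫ z : Fin n → ℝ, Real.exp (α * psum a z i) ∂gaussVec n 1 ≤ Real.exp (α ^ 2 * i / 2) := by
  have e : ∀ z : Fin n → ℝ, α * psum a z i = ∑ l : Fin n, (α * (if a ≤ (l:ℤ) ∧ (l:ℤ) < a + i then 1 else 0 : ℝ)) * z l := by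
    intro z
    rw [psum_lin, Finset.mul_sum]
    exact Finset.sum_congr rfl fun l _ => by ring
  simp_rw [e]
  have := gaussVec_exp n (fun l : Fin n => α * (if a ≤ (l:ℤ) ∧ (l:ℤ) < a + i then 1 else 0 : ℝ))
  refine ⟨this.1, ?_⟩
  rw [this.2]
  apply Real.exp_le_exp.2
  have h2 : ∑ l : Fin n, (α * (if a ≤ (l:ℤ) ∧ (l:ℤ) < a + i then 1 else 0 : ℝ)) ^ 2 ≤ α ^ 2 * i := by
    refine le_trans (le_of_eq ?_) (mul_le_mul_of_nonneg_left (ind_sum_le n a i) (sq_nonneg α))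
    rw [Finset.mul_sum]
    refine Finset.sum_congr rfl fun l _ => ?_
    split_ifs <;> ring
  linarith

open Classical in
lemma tail (n : ℕ) (a : ℤ) (l : ℕ) (hl : 1 ≤ l) (c : ℝ) (hc : 0 ≤ c) :
    ∫ z : Fin n → ℝ, (if c < bmx a l z then (1:ℝ) else 0) ∂gaussVec n 1 ≤
      2 * (l + 1) * Real.exp (- (c ^ 2 / (2 * l))) := by
  have hl0 : (0:ℝ) < l := by exact_mod_cast hl
  set α : ℝ := c / l with hα
  have hα0 : 0 ≤ α := by positivity
  have hp : ∀ z : Fin n → ℝ, (if c < bmx a l z then (1:ℝ) else 0) ≤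
      ∑ i ∈ Finset.range (l + 1), (Real.exp (- (α * c)) * Real.exp (α * psum a z i) +
        Real.exp (- (α * c)) * Real.exp ((-α) * psum a z i)) := by
    intro z
    have hnn : ∀ i ∈ Finset.range (l+1), 0 ≤ (Real.exp (- (α * c)) * Real.exp (α * psum a z i) +
        Real.exp (- (α * c)) * Real.exp ((-α) * psum a z i)) := fun i _ => by positivity
    split_ifs with h
    · have : ∃ i ≤ l, c < psum a z i ∨ c < - psum a z i := by
        rcases max_choice (rmax a 1 z l) (rmax a (-1) z l) with h1 | h1
        · obtain ⟨i, hi, h2⟩ := rmax_att a 1 z l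
          refine ⟨i, hi, Or.inl ?_⟩
          unfold bmx at h; rw [h1, h2] at h; linarith
        · obtain ⟨i, hi, h2⟩ := rmax_att a (-1) z l
          refine ⟨i, hi, Or.inr ?_⟩
          unfold bmx at h; rw [h1, h2] at h; linarith
      obtain ⟨i, hi, h1⟩ := this
      refine le_trans ?_ (Finset.single_le_sum hnn (Finset.mem_range.2 (Nat.lt_succ_of_le hi)))
      rw [← Real.exp_add, ← Real.exp_add]
      rcases h1 with h1 | h1
      · have : 0 ≤ -(α * c) + α * psum a z i := by nlinarith
        have := Real.one_le_exp this
        linarith [Real.exp_pos (-(α * c) + -α * psum a z i)]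
      · have : 0 ≤ -(α * c) + -α * psum a z i := by nlinarith
        have := Real.one_le_exp this
        linarith [Real.exp_pos (-(α * c) + α * psum a z i)]
    · exact Finset.sum_nonneg hnn
  have hi1 : ∀ i, Integrable (fun z : Fin n → ℝ => Real.exp (- (α * c)) * Real.exp (α * psum a z i)) (gaussVec n 1) :=
    fun i => (psum_exp n a i α).1.const_mul _
  have hi2 : ∀ i, Integrable (fun z : Fin n → ℝ => Real.exp (- (α * c)) * Real.exp ((-α) * psum a z i)) (gaussVec n 1) :=
    fun i => (psum_exp n a i (-α)).1.const_mul _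
  have hi3 : ∀ i, Integrable (fun z : Fin n → ℝ => Real.exp (- (α * c)) * Real.exp (α * psum a z i) +
     Real.exp (- (α * c)) * Real.exp ((-α) * psum a z i)) (gaussVec n 1) := fun i => (hi1 i).add (hi2 i)
  have h1 := integral_mono_of_nonneg (μ := gaussVec n 1)
    (f := fun z : Fin n → ℝ => (if c < bmx a l z then (1:ℝ) else 0))
    (Filter.Eventually.of_forall fun z => by simp only [Pi.zero_apply]; split_ifs <;> norm_num)
    (integrable_finsetSum (Finset.range (l+1)) fun i _ => hi3 i) (Filter.Eventually.of_forall hp)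
  refine h1.trans ?_
  rw [integral_finsetSum _ fun i _ => hi3 i]
  have h2 : ∀ i ∈ Finset.range (l+1), ∫ z : Fin n → ℝ, (Real.exp (- (α * c)) * Real.exp (α * psum a z i) +
     Real.exp (- (α * c)) * Real.exp ((-α) * psum a z i)) ∂gaussVec n 1 ≤ 2 * Real.exp (- (c ^ 2 / (2 * l))) := by
    intro i hi
    rw [Finset.mem_range] at hi
    rw [integral_add (hi1 i) (hi2 i), integral_const_mul, integral_const_mul]
    have e1 := (psum_exp n a i α).2
    have e2 := (psum_exp n a i (-α)).2
    rw [neg_sq] at e2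
    have hil : (i:ℝ) ≤ l := by exact_mod_cast Nat.lt_succ_iff.1 hi
    have e3 : Real.exp (- (α * c)) * Real.exp (α ^ 2 * i / 2) ≤ Real.exp (- (c ^ 2 / (2 * l))) := by
      rw [← Real.exp_add]
      apply Real.exp_le_exp.2
      have : α ^ 2 * i ≤ α ^ 2 * l := by gcongr
      have e4 : α * c = c ^ 2 / l := by rw [hα]; ring
      have e5 : α ^ 2 * l = c ^ 2 / l := by rw [hα]; field_simp
      have e6 : c ^ 2 / (2 * l) = c ^ 2 / l / 2 := by field_simp
      rw [e6]; linarith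
    have e0 := (Real.exp_pos (- (α * c))).le
    nlinarith [mul_le_mul_of_nonneg_left e1 e0, mul_le_mul_of_nonneg_left e2 e0]
  refine (Finset.sum_le_sum h2).trans (le_of_eq ?_)
  simp; ring
end

section

/-- fourth moment -/
def M4 : ℝ := ∫ x, x ^ 4 ∂gaussianReal 0 1

lemma M4_nonneg : 0 ≤ M4 := integral_nonneg fun x => by positivity

lemma zx_nat_eq {n : ℕ} (z : Fin n → ℝ) (x : ℕ) (hx : x < n) : zx z (x : ℤ) = z ⟨x, hx⟩ :=
  zx_coe z ⟨x, hx⟩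

lemma zx4 (n x : ℕ) (hx : x < n) :
    Integrable (fun z : Fin n → ℝ => zx z (x:ℤ) ^ 4) (gaussVec n 1) ∧
    ∫ z : Fin n → ℝ, zx z (x:ℤ) ^ 4 ∂gaussVec n 1 = M4 := by
  simp_rw [zx_nat_eq _ x hx]
  exact ⟨gaussVec_integrable_pow4 n _, gaussVec_int_comp n _ (fun x => x ^ 4) (by fun_prop)⟩

lemma zx2 (n x : ℕ) (hx : x < n) :
    Integrable (fun z : Fin n → ℝ => zx z (x:ℤ) ^ 2) (gaussVec n 1) ∧
    ∫ z : Fin n → ℝ, zx z (x:ℤ) ^ 2 ∂gaussVec n 1 = 1 := by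
  simp_rw [zx_nat_eq _ x hx]
  exact ⟨gaussVec_integrable_sq n _, gaussVec_int_sq n _⟩

lemma block_count (n l b : ℕ) (hl : 1 ≤ l) : ((Finset.range n).filter fun x => x / l = b).card ≤ l := by
  have : ((Finset.range n).filter fun x => x / l = b) ⊆ Finset.Ico (l * b) (l * b + l) := by
    intro x hx
    rw [Finset.mem_filter] at hx
    rw [Finset.mem_Ico]
    have h1 := Nat.div_add_mod x l
    have h2 := Nat.mod_lt x hl
    rw [hx.2] at h1
    omega
  refine (Finset.card_le_card this).trans ?_
  simp

open Classical in
/-- cost of a block -/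
def bcost {n : ℕ} (a : ℤ) (l b : ℕ) (c : ℝ) (z : Fin n → ℝ) : ℝ :=
  bmx a l z ^ 2 / l + if c < bmx a l z then
    ∑ x ∈ Finset.range n, (if x / l = b then zx z (x:ℤ) ^ 2 else 0) else 0

lemma bcost_int (r : ℕ) (hr : 1 ≤ r) (n : ℕ) (a : ℤ) (l b : ℕ) (hl : 1 ≤ l) (N : ℝ) (hN : 1 ≤ N)
    (hlN : (l:ℝ) ≤ r * N) :
    Integrable (fun z : Fin n → ℝ => bcost a l b (Real.sqrt (6 * (1 + Real.log N) * l)) z) (gaussVec n 1) ∧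
    ∫ z : Fin n → ℝ, bcost a l b (Real.sqrt (6 * (1 + Real.log N) * l)) z ∂gaussVec n 1 ≤
      8 + r * (M4 / 2 + 2 * r) := by
  classical
  have hl0 : (1:ℝ) ≤ l := by exact_mod_cast hl
  have hr0 : (1:ℝ) ≤ r := by exact_mod_cast hr
  have hlog : 0 ≤ Real.log N := Real.log_nonneg hN
  set c := Real.sqrt (6 * (1 + Real.log N) * l) with hc
  have hc0 : 0 ≤ c := Real.sqrt_nonneg _
  have hm := bmx_int n a l
  set T := (Finset.range n).filter fun x => x / l = b with hT
  have hTn : ∀ x ∈ T, x < n := fun x hx => by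
    rw [hT, Finset.mem_filter, Finset.mem_range] at hx; exact hx.1
  have hsum : ∀ z : Fin n → ℝ, ∑ x ∈ Finset.range n, (if x / l = b then zx z (x:ℤ) ^ 2 else 0) =
      ∑ x ∈ T, zx z (x:ℤ) ^ 2 := fun z => by rw [hT, Finset.sum_filter]
  have hset : MeasurableSet {z : Fin n → ℝ | c < bmx a l z} :=
    measurableSet_lt measurable_const (bmx_meas a l)
  set g : (Fin n → ℝ) → ℝ := fun z => if c < bmx a l z then (1:ℝ) else 0 with hg
  have hgm : Measurable g := Measurable.ite hset measurable_const measurable_const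
  have hgi : Integrable g (gaussVec n 1) := by
    refine (integrable_const (1:ℝ)).mono' hgm.aestronglyMeasurable (Filter.Eventually.of_forall fun z => ?_)
    simp only [hg]; split_ifs <;> simp
  set h : (Fin n → ℝ) → ℝ := fun z => if c < bmx a l z then ∑ x ∈ T, zx z (x:ℤ) ^ 2 else 0 with hh
  have hSi : Integrable (fun z : Fin n → ℝ => ∑ x ∈ T, zx z (x:ℤ) ^ 2) (gaussVec n 1) :=
    integrable_finsetSum _ fun x hx => (zx2 n x (hTn x hx)).1
  have hhi : Integrable h (gaussVec n 1) := by
    have := hSi.indicator hset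
    refine this.congr (Filter.Eventually.of_forall fun z => ?_)
    simp only [hh, Set.indicator, Set.mem_ofPred_eq]
  have hb : ∀ z, bcost a l b c z = bmx a l z ^ 2 / l + h z := by
    intro z
    unfold bcost
    simp only [hh]
    rw [hsum]
  simp_rw [hb]
  have hmi := hm.1.div_const (l:ℝ)
  refine ⟨hmi.add hhi, ?_⟩
  rw [integral_add hmi hhi, integral_div]
  have h1 : (∫ z : Fin n → ℝ, bmx a l z ^ 2 ∂gaussVec n 1) / l ≤ 8 := by
    rw [div_le_iff₀ (by linarith)]; exact hm.2
  have hN0 : 0 < N := by linarith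
  have hp : ∀ z, h z ≤ ∑ x ∈ T, (zx z (x:ℤ) ^ 4 / (2 * N) + N / 2 * g z) := by
    intro z
    have hg0 : 0 ≤ g z := by simp only [hg]; split_ifs <;> norm_num
    by_cases hz : c < bmx a l z
    · simp only [hh, hg, if_pos hz]
      refine Finset.sum_le_sum fun x _ => ?_
      have : 0 ≤ (zx z (x:ℤ) ^ 2 - N) ^ 2 / (2 * N) := by positivity
      have e : (zx z (x:ℤ) ^ 2 - N) ^ 2 / (2 * N) = zx z (x:ℤ) ^ 4 / (2 * N) + N / 2 * 1 - zx z (x:ℤ) ^ 2 := by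
        field_simp; ring
      linarith
    · have : h z = 0 := by simp only [hh, if_neg hz]
      rw [this]
      exact Finset.sum_nonneg fun x _ => by positivity
  have hi4 : ∀ x ∈ T, Integrable (fun z : Fin n → ℝ => zx z (x:ℤ) ^ 4 / (2 * N)) (gaussVec n 1) :=
    fun x hx => (zx4 n x (hTn x hx)).1.div_const _
  have hii : ∀ x ∈ T, Integrable (fun z : Fin n → ℝ => zx z (x:ℤ) ^ 4 / (2 * N) + N / 2 * g z) (gaussVec n 1) :=
    fun x hx => (hi4 x hx).add (hgi.const_mul _)
  have h2 := integral_mono hhi (integrable_finsetSum _ hii) hp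
  rw [integral_finsetSum _ hii] at h2
  have htail := tail n a l hl c hc0
  have hexp : Real.exp (- (c ^ 2 / (2 * l))) ≤ (N ^ 3)⁻¹ := by
    have : c ^ 2 = 6 * (1 + Real.log N) * l := Real.sq_sqrt (by positivity)
    rw [this]
    have e : 6 * (1 + Real.log N) * l / (2 * l) = 3 * (1 + Real.log N) := by field_simp; ring
    rw [e, Real.exp_neg]
    gcongr
    calc N ^ 3 = Real.exp (3 * Real.log N) := by
          rw [mul_comm, Real.exp_mul, Real.exp_log hN0]; norm_cast
      _ ≤ _ := Real.exp_le_exp.2 (by linarith)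
  have hP : ∫ z, g z ∂gaussVec n 1 ≤ 4 * r / N ^ 2 := by
    refine htail.trans ?_
    calc 2 * ((l:ℝ) + 1) * Real.exp (- (c ^ 2 / (2 * l))) ≤ 2 * (2 * (r * N)) * (N ^ 3)⁻¹ := by
          gcongr; linarith
      _ = 4 * r / N ^ 2 := by field_simp; ring
  have h3 : ∀ x ∈ T, ∫ z : Fin n → ℝ, (zx z (x:ℤ) ^ 4 / (2 * N) + N / 2 * g z) ∂gaussVec n 1 ≤ (M4 / 2 + 2 * r) / N := by
    intro x hx
    rw [integral_add (hi4 x hx) (hgi.const_mul _), integral_div, integral_const_mul, (zx4 n x (hTn x hx)).2]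
    have : N / 2 * ∫ z, g z ∂gaussVec n 1 ≤ N / 2 * (4 * r / N ^ 2) := by gcongr
    have e : M4 / (2 * N) + N / 2 * (4 * r / N ^ 2) = (M4 / 2 + 2 * r) / N := by field_simp; ring
    linarith
  have h4 := Finset.sum_le_sum h3
  rw [Finset.sum_const, nsmul_eq_mul] at h4
  have hcard : (T.card : ℝ) ≤ r * N := by
    refine le_trans ?_ hlN
    exact_mod_cast block_count n l b hl
  have hM := M4_nonneg
  have h5 : (T.card : ℝ) * ((M4 / 2 + 2 * r) / N) ≤ r * N * ((M4 / 2 + 2 * r) / N) := by gcongr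
  have e : r * N * ((M4 / 2 + 2 * r) / N) = r * (M4 / 2 + 2 * r) := by field_simp
  linarith

lemma k_le {r n : ℕ} {θ : Fin n → ℝ} {k : ℕ} {j : Fin k → ℕ} {sg : Fin k → ℝ}
    (h : IsKnotSeq r n θ k j sg) : k ≤ n - r := by
  obtain ⟨h1, h2, -, -⟩ := h
  have : (Finset.univ : Finset (Fin k)).card ≤ (Finset.Icc 2 (n - r + 1)).card :=
    Finset.card_le_card_of_injOn j (fun i _ => by
      simp only [Finset.coe_Icc, Set.mem_Icc]; exact h2 i) (h1.injective.injOn)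
  simpa using this

/-- level choice -/
lemma level (r : ℕ) (hr : 1 ≤ r) (n k : ℕ) (hk : k + 1 ≤ n) :
    ∃ J : ℕ, ((blen r J : ℝ) ≤ r * (n / (k + 1) : ℝ)) ∧ (n / blen r J ≤ 2 * (k + 1)) ∧
      ((J:ℝ) ≤ 2 * (1 + Real.log (n / (k + 1)))) ∧ (J = 0 → n ≤ 2 * r * (k + 1)) := by
  set N : ℝ := n / (k + 1) with hN
  have hk0 : (0:ℝ) < k + 1 := by positivity
  have hN1 : 1 ≤ N := by rw [hN, le_div_iff₀ hk0]; rw [one_mul]; exact_mod_cast hk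
  have hr0 : (1:ℝ) ≤ r := by exact_mod_cast hr
  have hlog : 0 ≤ Real.log N := Real.log_nonneg hN1
  set q := ⌊N / r⌋₊ with hq
  have hqlt : N / r < q + 1 := Nat.lt_floor_add_one _
  have hqle : (q:ℝ) ≤ N / r := Nat.floor_le (by positivity)
  refine ⟨Nat.log 2 q, ?_⟩
  have hup : q < 2 ^ (Nat.log 2 q + 1) := Nat.lt_pow_succ_log_self (by norm_num) q
  have hup2 : N / r < 2 ^ (Nat.log 2 q + 1) := by
    have : (q:ℝ) + 1 ≤ 2 ^ (Nat.log 2 q + 1) := by exact_mod_cast hup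
    linarith
  have hn : (n:ℝ) < (2 * (k + 1)) * blen r (Nat.log 2 q) := by
    unfold blen
    rw [hN, div_div, div_lt_iff₀ (by positivity)] at hup2
    push_cast
    rw [pow_succ] at hup2
    linarith
  have hn' : n < (2 * (k + 1)) * blen r (Nat.log 2 q) := by exact_mod_cast hn
  have hpw : ((2:ℝ) ^ (Nat.log 2 q) ≤ N) := by
    by_cases h0 : q = 0
    · rw [h0]; simpa using hN1
    · have : 2 ^ (Nat.log 2 q) ≤ q := Nat.pow_log_le_self 2 h0
      have h1 : ((2:ℝ) ^ (Nat.log 2 q)) ≤ q := by exact_mod_cast this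
      have h2 : N / r ≤ N := div_le_self (by linarith) hr0
      linarith
  refine ⟨?_, ?_, ?_, ?_⟩
  · unfold blen; push_cast; gcongr
  · exact (Nat.div_lt_of_lt_mul (by rw [mul_comm]; exact hn')).le
  · have h1 := Real.log_le_log (by positivity) hpw
    rw [Real.log_pow] at h1
    have h2 : (1:ℝ)/2 < Real.log 2 := by have := Real.log_two_gt_d9; linarith
    have h3 : (0:ℝ) ≤ (Nat.log 2 q : ℝ) := by positivity
    nlinarith
  · intro h0
    rw [h0] at hn'
    unfold blen at hn'
    simp at hn'
    nlinarith

set_option maxHeartbeats 1600000 in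
theorem gbound (r : ℕ) (hr : 1 ≤ r) : ∃ C : ℝ, 0 < C ∧ ∀ (n : ℕ), 2 * r ≤ n → ∀ θ : Fin n → ℝ,
    (∃ t < n - r, DD r θ t ≠ 0) → ∀ (k : ℕ) (j : Fin k → ℕ) (sg : Fin k → ℝ), IsKnotSeq r n θ k j sg →
    1 ≤ n * DeltaR n r k j sg ∧ ∃ U : (Fin n → ℝ) → ℝ, Integrable U (gaussVec n 1) ∧
      ∫ z, U z ∂gaussVec n 1 ≤ C * (n * DeltaR n r k j sg) ∧
      ∀ z, ∃ c : ℝ, 0 ≤ c ∧ ∃ v ∈ subdiff (fun α => Dl1 r α) θ, sqnorm (z - c • v) ≤ U z := by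
  classical
  obtain ⟨C0, hC0, H⟩ := pathwise r hr
  set K1 : ℝ := (r * (3 * r * (4 * 4 ^ r)) : ℝ) with hK1
  set K2 : ℝ := (2 * (r : ℝ) ^ 2) ^ (2 * r - 1) with hK2
  have hr0 : (1:ℝ) ≤ r := by exact_mod_cast hr
  have hM := M4_nonneg
  refine ⟨C0 * (C0 ^ 2 * (6 * (r:ℝ) ^ (2 * r - 1)) * (K1 * K2) + 63 * (8 + r * (M4 / 2 + 2 * r)) + 30 * r), by positivity, ?_⟩
  intro n hn θ hne k j sg hks
  have hk1 := k_pos hr hks hne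
  have hkn := k_le hks
  have hrn : r < n := by omega
  obtain ⟨J, hJ1, hJ2, hJ3, hJ4⟩ := level r hr n k (by omega)
  set N : ℝ := n / (k + 1) with hN
  have hk0 : (0:ℝ) < k + 1 := by positivity
  have hN1 : 1 ≤ N := by
    rw [hN, le_div_iff₀ hk0]; rw [one_mul]; exact_mod_cast (by omega : k + 1 ≤ n)
  have hlog : 0 ≤ Real.log N := Real.log_nonneg hN1
  set L := 1 + Real.log N with hL
  have hL1 : 1 ≤ L := by linarith
  set p := kp n r k j with hp
  set s := ks r k sg with hs
  set W := whit r n J (evs r k p) with hW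
  set V := untr r n J (evs r k p) with hV
  set Q := Real.sqrt (6 * L) * Real.sqrt ((r * N) ^ (2 * r - 1)) with hQ
  have hQ0 : 0 < Q := by positivity
  set lam := C0 * Q with hlam
  have hlam0 : 0 < lam := by positivity
  set X := ∑ x ∈ Finset.range n, ((nab ^ r) (chi r k p s) (x : ℤ)) ^ 2 with hX
  set cB : ℕ × ℕ → ℝ := fun B => Real.sqrt (6 * L * (blen r B.1 : ℕ)) with hcB
  have hblen : ∀ B ∈ W, (blen r B.1 : ℝ) ≤ r * N := by
    intro B hB
    rw [hW, mem_whit hr] at hB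
    refine le_trans ?_ hJ1
    have : blen r B.1 ≤ blen r J := by
      unfold blen; exact Nat.mul_le_mul_left _ (Nat.pow_le_pow_right (by norm_num) hB.1.2)
    exact_mod_cast this
  set U : (Fin n → ℝ) → ℝ := fun z => C0 * (lam ^ 2 * X + ∑ B ∈ W, bcost (bst r B) (blen r B.1) B.2 (cB B) z +
    ∑ x ∈ V, zx z (x:ℤ) ^ 2) with hU
  have hVn : ∀ x ∈ V, x < n := fun x hx => by
    rw [hV, untr, Finset.mem_filter, Finset.mem_range] at hx; exact hx.1
  have hBi : ∀ B ∈ W, _ := fun B hB => bcost_int r hr n (bst r B) (blen r B.1) B.2 (blen_pos r B.1 hr) N hN1 (hblen B hB)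
  have hi1 : Integrable (fun z : Fin n → ℝ => ∑ B ∈ W, bcost (bst r B) (blen r B.1) B.2 (cB B) z) (gaussVec n 1) :=
    integrable_finsetSum _ fun B hB => (hBi B hB).1
  have hi2 : Integrable (fun z : Fin n → ℝ => ∑ x ∈ V, zx z (x:ℤ) ^ 2) (gaussVec n 1) :=
    integrable_finsetSum _ fun x hx => (zx2 n x (hVn x hx)).1
  have hi0 : Integrable (fun z : Fin n → ℝ => lam ^ 2 * X + ∑ B ∈ W, bcost (bst r B) (blen r B.1) B.2 (cB B) z) (gaussVec n 1) :=
    (integrable_const _).add hi1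
  have hd := deltaSq_nonneg hr hrn hks
  set D := deltaSq n r k j sg with hD
  have hn0 : (0:ℝ) < n := by exact_mod_cast (by omega : 0 < n)
  have hlogeq : Real.log (Real.exp 1 * (n : ℝ) / ((k : ℝ) + 1)) = L := by
    rw [mul_div_assoc, Real.log_mul (Real.exp_ne_zero 1) (by positivity), Real.log_exp]
  have hDel : (k + 1) * L + D * N ^ (2 * r - 1) * L ≤ n * DeltaR n r k j sg := by
    unfold DeltaR
    rw [hlogeq, ← hD]
    have e2 : (n / (k + 1) : ℝ) ^ (2 * (r:ℤ) - 1) = N ^ (2 * r - 1) := by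
      rw [← hN, ← zpow_natCast]
      congr 1
      omega
    rw [e2]
    have h9 : 0 ≤ (Real.sqrt D / Real.sqrt (n : ℝ)) ^ ((1 : ℝ) / (r : ℝ)) := by positivity
    have e3 : (n:ℝ) * (((k : ℝ) + 1) / (n : ℝ) * L + D / n * N ^ (2 * r - 1) * L +
        (Real.sqrt D / Real.sqrt (n : ℝ)) ^ ((1 : ℝ) / (r : ℝ))) = (k + 1) * L + D * N ^ (2 * r - 1) * L +
        n * (Real.sqrt D / Real.sqrt (n : ℝ)) ^ ((1 : ℝ) / (r : ℝ)) := by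
      field_simp
    rw [e3]
    have := mul_nonneg hn0.le h9
    linarith
  have hone : 1 ≤ n * DeltaR n r k j sg := by
    have h1 : (0:ℝ) ≤ D * N ^ (2 * r - 1) * L := by positivity
    have h2 : (0:ℝ) ≤ k := by positivity
    nlinarith
  refine ⟨hone, U, (hi0.add hi2).const_mul C0, ?_, ?_⟩
  · -- expectation
    have e1 : ∫ z, U z ∂gaussVec n 1 = C0 * (lam ^ 2 * X +
        ∑ B ∈ W, ∫ z, bcost (bst r B) (blen r B.1) B.2 (cB B) z ∂gaussVec n 1 + V.card) := by
      simp only [hU]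
      rw [integral_const_mul, integral_add hi0 hi2, integral_add (integrable_const _) hi1,
        integral_finsetSum _ fun B hB => (hBi B hB).1, integral_finsetSum _ fun x hx => (zx2 n x (hVn x hx)).1,
        Finset.sum_congr rfl fun x hx => (zx2 n x (hVn x hx)).2]
      simp only [integral_const, probReal_univ, one_smul, Finset.sum_const, nsmul_eq_mul, mul_one]
      rfl
    rw [e1]
    -- X bound
    have hX1 : X ≤ K1 * (K2 * D) := by
      have h1 := chi_nab r k hr p s (fun i hi => kp_lt hr hrn hks i hi) (ks_abs hks)
        ((Finset.range n).map ⟨fun x : ℕ => (x:ℤ), Nat.cast_injective⟩)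
      rw [Finset.sum_map] at h1
      have h2 := delta_bd hr hrn hks hk1
      simp only [Function.Embedding.coeFn_mk] at h1
      refine h1.trans ?_
      refine mul_le_mul_of_nonneg_left ?_ (by positivity)
      refine le_trans (le_of_eq ?_) h2
      refine Finset.sum_congr rfl fun i _ => ?_
      split_ifs <;> rfl
    have hlam2 : lam ^ 2 = C0 ^ 2 * (6 * (r:ℝ) ^ (2 * r - 1)) * (N ^ (2 * r - 1) * L) := by
      rw [hlam, hQ, mul_pow, mul_pow, Real.sq_sqrt (by positivity), Real.sq_sqrt (by positivity), mul_pow]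
      ring
    have hA : lam ^ 2 * X ≤ C0 ^ 2 * (6 * (r:ℝ) ^ (2 * r - 1)) * (K1 * K2) * (D * N ^ (2 * r - 1) * L) := by
      calc lam ^ 2 * X ≤ lam ^ 2 * (K1 * (K2 * D)) := by gcongr
        _ = _ := by rw [hlam2]; ring
    have hev := card_evs r k p
    have hWc : (W.card : ℝ) ≤ 63 * ((k + 1) * L) := by
      have h1 := card_whit r hr n J (evs r k p)
      have h2 : W.card ≤ (2 * (k + 1) + 1) + J * (10 * (2 * k + 3)) := by
        refine h1.trans ?_
        gcongr
      have h3 : (W.card : ℝ) ≤ (2 * (k + 1) + 1) + J * (10 * (2 * k + 3)) := by exact_mod_cast h2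
      have h4 : (J:ℝ) * (10 * (2 * k + 3)) ≤ 2 * L * (10 * (3 * (k + 1))) := by
        have : (1:ℝ) ≤ k := by exact_mod_cast hk1
        gcongr
        linarith
      have h5 : (k:ℝ) + 1 ≤ (k + 1) * L := le_mul_of_one_le_right hk0.le hL1
      have h6 : (0:ℝ) ≤ k := by positivity
      nlinarith
    have hVc : (V.card : ℝ) ≤ 30 * r * ((k + 1) * L) := by
      have h1 : V.card ≤ 30 * r * (k + 1) := by
        by_cases h0 : J = 0
        · have : V.card ≤ n := by
            have := Finset.card_filter_le (Finset.range n) (fun x => ¬ ∃ j, (j, x / blen r j) ∈ whit r n J (evs r k p))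
            rw [Finset.card_range] at this
            exact this
          have h4 := hJ4 h0
          nlinarith
        · have h2 := card_untr r hr n J (by omega) (evs r k p)
          have h3 : 10 * r * (evs r k p).card ≤ 10 * r * (3 * (k + 1)) := Nat.mul_le_mul_left _ (by omega)
          have h4 : V.card ≤ 10 * r * (3 * (k + 1)) := h2.trans h3
          nlinarith
      have h2 : (V.card : ℝ) ≤ 30 * r * (k + 1) := by exact_mod_cast h1
      refine h2.trans ?_
      have h5 : (k:ℝ) + 1 ≤ (k + 1) * L := le_mul_of_one_le_right hk0.le hL1
      gcongr
    have hBs : ∑ B ∈ W, ∫ z, bcost (bst r B) (blen r B.1) B.2 (cB B) z ∂gaussVec n 1 ≤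
        63 * ((k + 1) * L) * (8 + r * (M4 / 2 + 2 * r)) := by
      refine (Finset.sum_le_sum fun B hB => (hBi B hB).2).trans ?_
      rw [Finset.sum_const, nsmul_eq_mul]
      gcongr
    rw [mul_assoc]
    refine mul_le_mul_of_nonneg_left ?_ hC0.le
    refine le_trans ?_ (mul_le_mul_of_nonneg_left hDel (by positivity))
    set P := C0 ^ 2 * (6 * (r:ℝ) ^ (2 * r - 1)) * (K1 * K2) with hP
    set R := 8 + r * (M4 / 2 + 2 * r) with hR
    have a1 : 0 ≤ D * N ^ (2 * r - 1) * L := by positivity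
    have a2 : 0 ≤ (k + 1) * L := by positivity
    have a3 : 0 ≤ P := by positivity
    have a4 : 0 ≤ R := by positivity
    have b1 : 0 ≤ P * ((k + 1) * L) := by positivity
    have b2 : 0 ≤ (63 * R + 30 * r) * (D * N ^ (2 * r - 1) * L) := by positivity
    nlinarith
  · intro z
    set ko := W.filter fun B => cB B < bmx (bst r B) (blen r B.1) z with hko
    obtain ⟨u, hu1, hu2, hu3, hu4⟩ := H n k J p s hrn.le (fun i hi => kp_lt hr hrn hks i hi) ks_zero ks_last
      (ks_abs hks) kp_zero (kp_last hrn.le) (zx z) (fun B => bmx (bst r B) (blen r B.1) z) ko Q lam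
      (fun B _ t => cs_le_bmx _ _ z t)
      (by
        intro B hB hBk
        have h1 : bmx (bst r B) (blen r B.1) z ≤ cB B := by
          by_contra hcon
          push Not at hcon
          exact hBk (Finset.mem_filter.2 ⟨hB, hcon⟩)
        have hb := hblen B hB
        calc (blen r B.1 : ℝ) ^ (r - 1) * bmx (bst r B) (blen r B.1) z ≤ (blen r B.1 : ℝ) ^ (r - 1) * cB B := by gcongr
          _ = Real.sqrt (6 * L) * Real.sqrt ((blen r B.1 : ℝ) ^ (2 * r - 1)) := by
            simp only [hcB]
            rw [Real.sqrt_mul (by positivity : (0:ℝ) ≤ 6 * L)]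
            have : (blen r B.1 : ℝ) ^ (2 * r - 1) = ((blen r B.1 : ℝ) ^ (r - 1)) ^ 2 * blen r B.1 := by
              rw [← pow_mul, ← pow_succ]; congr 1; omega
            rw [this, Real.sqrt_mul (by positivity : (0:ℝ) ≤ ((blen r B.1 : ℝ) ^ (r - 1)) ^ 2), Real.sqrt_sq (by positivity)]
            ring
          _ ≤ Q := by
            rw [hQ]
            gcongr) hQ0.le le_rfl
    obtain ⟨v, hv, hv2⟩ := cert r n hrn.le θ lam hlam0 u hu1 hu2 (fun t ht => ks_cert hr hrn hks lam u hu3 t ht)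
    refine ⟨lam, hlam0.le, v, hv, ?_⟩
    have e1 : sqnorm (z - lam • v) = ∑ x ∈ Finset.range n, (zx z (x : ℤ) - (nab ^ r) u (x : ℤ)) ^ 2 := by
      rw [← Fin.sum_univ_eq_sum_range (fun x : ℕ => (zx z (x : ℤ) - (nab ^ r) u (x : ℤ)) ^ 2) n]
      unfold sqnorm
      refine Finset.sum_congr rfl fun i _ => ?_
      rw [zx_coe, ← hv2 i]
      simp
    rw [e1]
    refine hu4.trans (le_of_eq ?_)
    simp only [hU]
    congr 3
    refine Finset.sum_congr rfl fun B hB => ?_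
    unfold bcost
    congr 1
    have : B ∈ ko ↔ cB B < bmx (bst r B) (blen r B.1) z := by
      rw [hko, Finset.mem_filter]; exact ⟨fun h => h.2, fun h => ⟨hB, h⟩⟩
    simp only [this]
end

section

lemma dseq_lin (r : ℕ) (a b : ℝ) (f g : ℕ → ℝ) :
    dseq^[r] (fun t => a * f t + b * g t) = fun t => a * dseq^[r] f t + b * dseq^[r] g t := by
  induction r with
  | zero => rfl
  | succ r ih =>
    rw [Function.iterate_succ_apply', ih, Function.iterate_succ_apply', Function.iterate_succ_apply']
    funext t
    simp only [dseq]; ring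

lemma DD_lin (r : ℕ) {n : ℕ} (a b : ℝ) (x y : Fin n → ℝ) (t : ℕ) :
    DD r (a • x + b • y) t = a * DD r x t + b * DD r y t := by
  unfold DD
  have : pad (a • x + b • y) = fun t => a * pad x t + b * pad y t := by
    funext t; unfold pad; split_ifs <;> simp
  rw [this, dseq_lin]

lemma Dl1_convex (r : ℕ) {n : ℕ} (a b : ℝ) (ha : 0 ≤ a) (hb : 0 ≤ b) (x y : Fin n → ℝ) :
    Dl1 r (a • x + b • y) ≤ a * Dl1 r x + b * Dl1 r y := by
  unfold Dl1
  rw [Finset.mul_sum, Finset.mul_sum, ← Finset.sum_add_distrib]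
  refine Finset.sum_le_sum fun t _ => ?_
  rw [DD_lin]
  refine (abs_add_le _ _).trans ?_
  rw [abs_mul, abs_mul, abs_of_nonneg ha, abs_of_nonneg hb]

lemma Dl1_hom (r : ℕ) {n : ℕ} (a : ℝ) (ha : 0 ≤ a) (x : Fin n → ℝ) :
    Dl1 r (a • x) ≤ a * Dl1 r x := by
  have := Dl1_convex r a 0 ha le_rfl x x
  simpa using this

/-- Euclidean inner product. -/
def ip {n : ℕ} (x y : Fin n → ℝ) : ℝ := ∑ i, x i * y i

lemma ip_add_left {n : ℕ} (x y z : Fin n → ℝ) : ip (x + y) z = ip x z + ip y z := by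
  simp [ip, add_mul, Finset.sum_add_distrib]
lemma ip_sub_left {n : ℕ} (x y z : Fin n → ℝ) : ip (x - y) z = ip x z - ip y z := by
  simp [ip, sub_mul, Finset.sum_sub_distrib]
lemma ip_smul_left {n : ℕ} (a : ℝ) (x z : Fin n → ℝ) : ip (a • x) z = a * ip x z := by
  simp [ip, Finset.mul_sum, mul_assoc]
lemma ip_comm {n : ℕ} (x y : Fin n → ℝ) : ip x y = ip y x := by
  simp [ip, mul_comm]
lemma ip_add_right {n : ℕ} (x y z : Fin n → ℝ) : ip z (x + y) = ip z x + ip z y := by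
  rw [ip_comm, ip_add_left, ip_comm x, ip_comm y]
lemma ip_sub_right {n : ℕ} (x y z : Fin n → ℝ) : ip z (x - y) = ip z x - ip z y := by
  rw [ip_comm, ip_sub_left, ip_comm x, ip_comm y]
lemma ip_smul_right {n : ℕ} (a : ℝ) (x z : Fin n → ℝ) : ip z (a • x) = a * ip z x := by
  rw [ip_comm, ip_smul_left, ip_comm x]
lemma ip_self {n : ℕ} (x : Fin n → ℝ) : ip x x = sqnorm x := by
  simp [ip, sqnorm, sq]
lemma ip_zero_left {n : ℕ} (x : Fin n → ℝ) : ip 0 x = 0 := by simp [ip]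

lemma ip_cs {n : ℕ} (x y : Fin n → ℝ) : ip x y ≤ eunorm x * eunorm y :=
  Real.sum_mul_le_sqrt_mul_sqrt Finset.univ x y

lemma eunorm_neg {n : ℕ} (x : Fin n → ℝ) : eunorm (-x) = eunorm x := by
  simp [eunorm, sqnorm]

lemma ip_abs {n : ℕ} (x y : Fin n → ℝ) : |ip x y| ≤ eunorm x * eunorm y := by
  rw [abs_le']
  refine ⟨ip_cs x y, ?_⟩
  have := ip_cs (-x) y
  rw [eunorm_neg] at this
  have h2 : ip (-x) y = - ip x y := by simp [ip]
  rw [← h2]; exact this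


lemma lim_helper (A B : ℝ) (hB : 0 ≤ B) (h : ∀ t : ℝ, 0 < t → t ≤ 1 → 0 ≤ A + t * B) : 0 ≤ A := by
  by_contra hA
  push Not at hA
  have h0 : 0 < -A / (2 * (B - A)) := div_pos (by linarith) (by linarith)
  have h1 : -A / (2 * (B - A)) ≤ 1 := by rw [div_le_one (by linarith)]; linarith
  have := h _ h0 h1
  have h2 : -A / (2 * (B - A)) * B ≤ -A / 2 := by
    rw [div_mul_eq_mul_div, div_le_div_iff₀ (by linarith) (by norm_num)]
    nlinarith
  linarith

/-- The deterministic oracle inequality. -/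
lemma pen_det (r : ℕ) {n : ℕ} (θ y e v : Fin n → ℝ) (c : ℝ) (hc : 0 ≤ c)
    (hv : v ∈ subdiff (fun α => Dl1 r α) θ)
    (he : ∀ x, 1 / 2 * sqnorm (y - e) + c * Dl1 r e ≤ 1 / 2 * sqnorm (y - x) + c * Dl1 r x) :
    eunorm (e - θ) ≤ eunorm (y - θ - c • v) := by
  set d := e - θ with hd
  have hfv : Dl1 r θ + ip v d ≤ Dl1 r e := hv e
  have key : 0 ≤ ip (y - e) d - c * ip v d := by
    refine lim_helper _ (sqnorm d / 2) (by have := sqnorm_nonneg d; positivity) fun t ht ht1 => ?_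
    have h1 := he ((1 - t) • e + t • θ)
    have h2 := Dl1_convex r (1 - t) t (by linarith) ht.le e θ
    have h3 : y - ((1 - t) • e + t • θ) = (y - e) + t • d := by
      rw [hd]; module
    have h4 : sqnorm ((y - e) + t • d) = sqnorm (y - e) + 2 * t * ip (y - e) d + t ^ 2 * sqnorm d := by
      rw [← ip_self, ← ip_self, ← ip_self, ip_add_left, ip_add_right, ip_add_right, ip_smul_left, ip_smul_right, ip_smul_right,
        ip_smul_left, ip_comm d (y - e)]
      ring
    rw [h3, h4] at h1
    have h5 := mul_le_mul_of_nonneg_left h2 hc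
    have h6 := mul_le_mul_of_nonneg_left hfv (mul_nonneg hc ht.le)
    have h7 : 0 ≤ t * (ip (y - e) d - c * ip v d + t * (sqnorm d / 2)) := by nlinarith
    exact nonneg_of_mul_nonneg_right h7 ht
  have h8 : sqnorm d ≤ ip (y - θ - c • v) d := by
    have : y - e = y - θ - d := by rw [hd]; module
    rw [this, ip_sub_left, ip_self] at key
    rw [ip_sub_left (y - θ), ip_smul_left]
    linarith
  have h9 := h8.trans (ip_cs _ _)
  have h10 := eunorm_sq d
  have h11 := eunorm_nonneg d
  have h12 := eunorm_nonneg (y - θ - c • v)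
  rw [← h10] at h9
  by_contra hcon
  push Not at hcon
  nlinarith

lemma sub_theta (r : ℕ) {n : ℕ} (θ v : Fin n → ℝ) (hv : v ∈ subdiff (fun α => Dl1 r α) θ) :
    ip v θ = Dl1 r θ := by
  have h1 : Dl1 r θ + ip v ((0:ℝ) • θ - θ) ≤ Dl1 r ((0:ℝ) • θ) := hv ((0:ℝ) • θ)
  have h2 : Dl1 r θ + ip v ((2:ℝ) • θ - θ) ≤ Dl1 r ((2:ℝ) • θ) := hv ((2:ℝ) • θ)
  have h3 := Dl1_hom r 0 le_rfl θ
  have h4 := Dl1_hom r 2 (by norm_num) θ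
  rw [ip_sub_right, ip_smul_right] at h1 h2
  linarith

lemma sub_convex {n : ℕ} (g : (Fin n → ℝ) → ℝ) (θ : Fin n → ℝ) (v w : Fin n → ℝ) (hv : v ∈ subdiff g θ)
    (hw : w ∈ subdiff g θ) (a b : ℝ) (ha : 0 ≤ a) (hb : 0 ≤ b) (hab : a + b = 1) :
    a • v + b • w ∈ subdiff g θ := by
  intro y
  have h1 : g θ + ip v (y - θ) ≤ g y := hv y
  have h2 : g θ + ip w (y - θ) ≤ g y := hw y
  have h3 : g θ + ip (a • v + b • w) (y - θ) ≤ g y := by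
    rw [ip_add_left, ip_smul_left, ip_smul_left]
    have e : b = 1 - a := by linarith
    subst e
    nlinarith
  exact h3

lemma sub_closed {n : ℕ} (g : (Fin n → ℝ) → ℝ) (θ : Fin n → ℝ) : IsClosed (subdiff g θ) := by
  have : subdiff g θ = ⋂ y, {v | g θ + ∑ i, v i * (y i - θ i) ≤ g y} := by
    ext v; simp [subdiff]
  rw [this]
  exact isClosed_iInter fun y => isClosed_le (by fun_prop) continuous_const

/-- Affine span facts. -/
lemma v0_facts {n : ℕ} (S : Set (Fin n → ℝ)) (θ v0 : Fin n → ℝ) (f0 : ℝ) (hf0 : 0 < f0)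
    (hS : ∀ v ∈ S, ip v θ = f0) (h0 : IsMinNormIn v0 (affineSpan ℝ S : Set (Fin n → ℝ))) :
    0 < eunorm v0 ∧ ∀ v ∈ S, ip v v0 = sqnorm v0 := by
  obtain ⟨hm, hmin⟩ := h0
  constructor
  · have h1 : ip v0 θ = f0 := by
      refine affineSpan_induction (p := fun v => ip v θ = f0) hm hS ?_
      intro c u v w hu hv hw
      simp only [vsub_eq_sub, vadd_eq_add, smul_eq_mul]
      rw [ip_add_left, ip_smul_left, ip_sub_left, hu, hv, hw]; ring
    have h2 := ip_cs v0 θ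
    by_contra hc
    have h3 : eunorm v0 = 0 := le_antisymm (not_lt.1 hc) (eunorm_nonneg _)
    rw [h1, h3] at h2
    linarith
  · intro v hv
    set d := v - v0 with hd
    have key : ∀ t : ℝ, 0 ≤ 2 * t * ip v0 d + t ^ 2 * sqnorm d := by
      intro t
      have h1 : v0 + t • d ∈ (affineSpan ℝ S : Set (Fin n → ℝ)) := by
        have := AffineMap.lineMap_mem t hm (subset_affineSpan ℝ S hv)
        rw [AffineMap.lineMap_apply] at this
        simp only [vsub_eq_sub, vadd_eq_add] at this
        rw [add_comm]; exact this
      have h2 := hmin _ h1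
      have h3 : sqnorm v0 ≤ sqnorm (v0 + t • d) := by
        rw [← eunorm_sq, ← eunorm_sq]
        exact pow_le_pow_left₀ (eunorm_nonneg _) h2 2
      have h4 : sqnorm (v0 + t • d) = sqnorm v0 + 2 * t * ip v0 d + t ^ 2 * sqnorm d := by
        rw [← ip_self, ← ip_self, ← ip_self, ip_add_left, ip_add_right, ip_add_right, ip_smul_left, ip_smul_right, ip_smul_right,
          ip_smul_left, ip_comm d v0]
        ring
      linarith
    have h5 : 0 ≤ ip v0 d := by
      refine lim_helper _ (sqnorm d / 2) (by have := sqnorm_nonneg d; positivity) fun t ht _ => ?_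
      have := key t
      have h7 : 0 ≤ t * (ip v0 d + t * (sqnorm d / 2)) := by nlinarith
      exact nonneg_of_mul_nonneg_right h7 ht
    have h6 : 0 ≤ - ip v0 d := by
      refine lim_helper _ (sqnorm d / 2) (by have := sqnorm_nonneg d; positivity) fun t ht _ => ?_
      have := key (-t)
      have h7 : 0 ≤ t * (-ip v0 d + t * (sqnorm d / 2)) := by nlinarith
      exact nonneg_of_mul_nonneg_right h7 ht
    have h8 : ip v0 d = 0 := by linarith
    rw [hd, ip_sub_right, ip_self] at h8
    rw [ip_comm]; linarith

lemma distSet_le {n : ℕ} (z w : Fin n → ℝ) (T : Set (Fin n → ℝ)) (hw : w ∈ T) : distSet z T ≤ eunorm (z - w) :=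
  csInf_le ⟨0, by rintro _ ⟨v, _, rfl⟩; exact eunorm_nonneg _⟩ ⟨w, hw, rfl⟩

lemma le_distSet {n : ℕ} (z : Fin n → ℝ) (T : Set (Fin n → ℝ)) (hT : T.Nonempty) (b : ℝ)
    (h : ∀ w ∈ T, b ≤ eunorm (z - w)) : b ≤ distSet z T :=
  le_csInf (hT.image _) (by rintro _ ⟨v, hv, rfl⟩; exact h v hv)

lemma distSet_nonneg {n : ℕ} (z : Fin n → ℝ) (T : Set (Fin n → ℝ)) : 0 ≤ distSet z T :=
  Real.sInf_nonneg (by rintro _ ⟨v, _, rfl⟩; exact eunorm_nonneg _)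

lemma distSet_lip {n : ℕ} (T : Set (Fin n → ℝ)) (hT : T.Nonempty) (x y : Fin n → ℝ) :
    |distSet x T - distSet y T| ≤ 1 * eunorm (x - y) := by
  have key : ∀ x y, distSet x T - eunorm (x - y) ≤ distSet y T := by
    intro x y
    refine le_distSet _ _ hT _ fun w hw => ?_
    have h1 := distSet_le x w T hw
    have h2 := eunorm_add (x - y) (y - w)
    rw [sub_add_sub_cancel] at h2
    linarith
  have h1 := key x y
  have h2 := key y x
  have h3 : eunorm (y - x) = eunorm (x - y) := by rw [← eunorm_neg, neg_sub]
  rw [h3] at h2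
  rw [abs_le]; constructor <;> linarith

lemma distSet_attain {n : ℕ} (T : Set (Fin n → ℝ)) (hT : T.Nonempty) (hc : IsClosed T) (z : Fin n → ℝ) :
    ∃ w ∈ T, ∀ u ∈ T, eunorm (z - w) ≤ eunorm (z - u) := by
  set T' : Set (EuclideanSpace ℝ (Fin n)) := (WithLp.ofLp) ⁻¹' T with hT'
  have hcl : IsClosed T' := hc.preimage (PiLp.continuous_ofLp 2 _)
  have hne : T'.Nonempty := by
    obtain ⟨w, hw⟩ := hT
    exact ⟨WithLp.toLp 2 w, hw⟩
  obtain ⟨w, hw, hd⟩ := hcl.exists_infDist_eq_dist hne (WithLp.toLp 2 z)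
  refine ⟨WithLp.ofLp w, hw, fun u hu => ?_⟩
  have h1 : Metric.infDist (WithLp.toLp 2 z) T' ≤ dist (WithLp.toLp 2 z) (WithLp.toLp 2 u) :=
    Metric.infDist_le_dist_of_mem hu
  rw [hd, dist_eq_norm, dist_eq_norm] at h1
  rw [eunorm_eq, eunorm_eq]
  exact h1

/-- The projection onto the cone. -/
lemma lam_proj {n : ℕ} (S : Set (Fin n → ℝ)) (hne : S.Nonempty) (hcl : IsClosed S) (lamfun : (Fin n → ℝ) → ℝ)
    (hl : IsLamFun S lamfun) (z : Fin n → ℝ) :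
    ∃ v ∈ S, ∀ c : ℝ, 0 ≤ c → ∀ u ∈ S, eunorm (z - lamfun z • v) ≤ eunorm (z - c • u) := by
  obtain ⟨h0, hmin⟩ := hl z
  have hcl2 : IsClosed (scaleSet (lamfun z) S) := by
    unfold scaleSet
    by_cases h : lamfun z = 0
    · have : (fun x : Fin n → ℝ => lamfun z • x) '' S = {0} := by
        rw [h]; ext x; simp [hne, eq_comm]
      rw [this]; exact isClosed_singleton
    · exact (Homeomorph.smulOfNeZero (lamfun z) h).isClosedMap S hcl
  obtain ⟨w, ⟨v, hv, rfl⟩, hw⟩ := distSet_attain (scaleSet (lamfun z) S) (hne.image _) hcl2 z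
  refine ⟨v, hv, fun c hc u hu => ?_⟩
  have h1 := le_distSet z _ (hne.image _) _ hw
  exact h1.trans ((hmin c hc).trans (distSet_le _ _ _ ⟨u, hu, rfl⟩))

end

section

/-- Variational inequality for the projection onto the cone. -/
lemma proj_var {n : ℕ} (S : Set (Fin n → ℝ))
    (hconv : ∀ v ∈ S, ∀ w ∈ S, ∀ a b : ℝ, 0 ≤ a → 0 ≤ b → a + b = 1 → a • v + b • w ∈ S)
    (z v : Fin n → ℝ) (hv : v ∈ S) (c : ℝ) (hc : 0 ≤ c)
    (hmin : ∀ b : ℝ, 0 ≤ b → ∀ u ∈ S, eunorm (z - c • v) ≤ eunorm (z - b • u))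
    (b : ℝ) (hb : 0 ≤ b) (u : Fin n → ℝ) (hu : u ∈ S) :
    ip (z - c • v) (b • u - c • v) ≤ 0 := by
  set d := b • u - c • v with hd
  suffices 0 ≤ - ip (z - c • v) d by linarith
  refine lim_helper _ (sqnorm d / 2) (by have := sqnorm_nonneg d; positivity) fun t ht ht1 => ?_
  have hmem : ∃ q : ℝ, 0 ≤ q ∧ ∃ x ∈ S, q • x = (1 - t) • (c • v) + t • (b • u) := by
    have h1 : 0 ≤ (1 - t) * c := mul_nonneg (by linarith) hc
    have h2 : 0 ≤ t * b := by positivity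
    by_cases h0 : (1 - t) * c + t * b = 0
    · refine ⟨0, le_rfl, v, hv, ?_⟩
      have e1 : (1 - t) * c = 0 := by linarith
      have e2 : t * b = 0 := by linarith
      rw [smul_smul, smul_smul, e1, e2]; simp
    · have hp : 0 < (1 - t) * c + t * b := lt_of_le_of_ne (by linarith) (Ne.symm h0)
      refine ⟨(1 - t) * c + t * b, hp.le, _, hconv v hv u hu ((1 - t) * c / ((1 - t) * c + t * b)) (t * b / ((1 - t) * c + t * b))
        (by positivity) (by positivity) (by field_simp), ?_⟩
      rw [smul_add, smul_smul, smul_smul, smul_smul, smul_smul, mul_div_cancel₀ _ h0, mul_div_cancel₀ _ h0]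
  obtain ⟨q, hq, x, hx, hqx⟩ := hmem
  have h3 := hmin q hq x hx
  have h4 : z - q • x = (z - c • v) + (-t) • d := by rw [hqx, hd]; module
  have h5 : sqnorm (z - c • v) ≤ sqnorm ((z - c • v) + (-t) • d) := by
    rw [← h4, ← eunorm_sq, ← eunorm_sq]
    exact pow_le_pow_left₀ (eunorm_nonneg _) h3 2
  have h6 : sqnorm ((z - c • v) + (-t) • d) = sqnorm (z - c • v) + 2 * (-t) * ip (z - c • v) d + t ^ 2 * sqnorm d := by
    rw [← ip_self, ← ip_self, ← ip_self, ip_add_left, ip_add_right, ip_add_right, ip_smul_left, ip_smul_right, ip_smul_right,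
      ip_smul_left, ip_comm d (z - c • v)]
    ring
  have h7 : 0 ≤ t * (-ip (z - c • v) d + t * (sqnorm d / 2)) := by nlinarith
  exact nonneg_of_mul_nonneg_right h7 ht

lemma lam_lip {n : ℕ} (S : Set (Fin n → ℝ)) (hne : S.Nonempty) (hcl : IsClosed S)
    (hconv : ∀ v ∈ S, ∀ w ∈ S, ∀ a b : ℝ, 0 ≤ a → 0 ≤ b → a + b = 1 → a • v + b • w ∈ S)
    (v0 : Fin n → ℝ) (hv0 : 0 < eunorm v0) (h0 : ∀ v ∈ S, ip v v0 = sqnorm v0)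
    (lamfun : (Fin n → ℝ) → ℝ) (hl : IsLamFun S lamfun) (x y : Fin n → ℝ) :
    |lamfun x - lamfun y| ≤ (1 / eunorm v0) * eunorm (x - y) := by
  obtain ⟨v, hv, hvm⟩ := lam_proj S hne hcl lamfun hl x
  obtain ⟨w, hw, hwm⟩ := lam_proj S hne hcl lamfun hl y
  have h1 := proj_var S hconv x v hv (lamfun x) (hl x).1 hvm (lamfun y) (hl y).1 w hw
  have h2 := proj_var S hconv y w hw (lamfun y) (hl y).1 hwm (lamfun x) (hl x).1 v hv
  set p := lamfun x • v with hp
  set q := lamfun y • w with hq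
  have h3 : sqnorm (p - q) ≤ ip (x - y) (p - q) := by
    rw [← ip_self]
    simp only [ip_sub_left, ip_sub_right] at h1 h2 ⊢
    linarith
  have h4 : eunorm (p - q) ≤ eunorm (x - y) := by
    have h9 := h3.trans (ip_cs _ _)
    rw [← eunorm_sq] at h9
    have h11 := eunorm_nonneg (p - q)
    have h12 := eunorm_nonneg (x - y)
    by_contra hcon
    push Not at hcon
    nlinarith
  have h5 : ip (p - q) v0 = (lamfun x - lamfun y) * eunorm v0 ^ 2 := by
    rw [ip_sub_left, hp, hq, ip_smul_left, ip_smul_left, h0 v hv, h0 w hw, eunorm_sq]; ring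
  have h6 := (ip_abs (p - q) v0).trans (mul_le_mul_of_nonneg_right h4 hv0.le)
  rw [h5, abs_mul, abs_of_nonneg (sq_nonneg (eunorm v0))] at h6
  rw [one_div, inv_mul_eq_div, le_div_iff₀ hv0]
  have : |lamfun x - lamfun y| * eunorm v0 * eunorm v0 ≤ eunorm (x - y) * eunorm v0 := by nlinarith
  exact le_of_mul_le_mul_right this hv0

lemma int_sq_sub {n : ℕ} (f : (Fin n → ℝ) → ℝ) (hf : MemLp f 2 (gaussVec n 1)) (c : ℝ) :
    Integrable (fun z => (f z - c) ^ 2) (gaussVec n 1) ∧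
    ∫ z, (f z - c) ^ 2 ∂gaussVec n 1 =
      (∫ z, f z ^ 2 ∂gaussVec n 1 - (∫ z, f z ∂gaussVec n 1) ^ 2) + (∫ z, f z ∂gaussVec n 1 - c) ^ 2 := by
  have h1 : Integrable (fun z => f z ^ 2) (gaussVec n 1) := hf.integrable_sq
  have h2 : Integrable f (gaussVec n 1) := hf.integrable (by norm_num)
  have h3 : Integrable (fun z => f z ^ 2 - 2 * c * f z) (gaussVec n 1) := h1.sub (h2.const_mul _)
  have e : (fun z => (f z - c) ^ 2) = fun z => (f z ^ 2 - 2 * c * f z) + c ^ 2 := by funext z; ring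
  rw [e]
  refine ⟨h3.add (integrable_const _), ?_⟩
  rw [integral_add h3 (integrable_const _), integral_sub h1 (h2.const_mul _), integral_const_mul]
  simp only [integral_const, probReal_univ, one_smul]
  ring

/-- The key moment bound. -/
lemma moment_bound {n : ℕ} (F lamf U : (Fin n → ℝ) → ℝ) (a V μ : ℝ) (ha : 0 < a) (hV : 0 ≤ V)
    (hF0 : ∀ z, 0 ≤ F z)
    (hF : ∀ x y, |F x - F y| ≤ 1 * eunorm (x - y)) (hlam : ∀ x y, |lamf x - lamf y| ≤ a * eunorm (x - y))
    (hU : Integrable U (gaussVec n 1)) (hU0 : ∀ z, 0 ≤ U z)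
    (hμ : ∫ z, lamf z ∂gaussVec n 1 + 2 * a ≤ μ)
    (hA : ∀ z, lamf z ≤ μ → F z ≤ Real.sqrt (U z) + (μ - lamf z) * V) :
    ∫ z, F z ^ 2 ∂gaussVec n 1 ≤ 8 * ∫ z, U z ∂gaussVec n 1 + 10 + 64 * (V ^ 2 * a ^ 2) +
      4 * (μ - (∫ z, lamf z ∂gaussVec n 1 + 2 * a)) ^ 2 * V ^ 2 := by
  have hFL := eulip_bound hF zero_le_one
  have hlL := eulip_bound hlam ha.le
  have vF := poincare_var zero_le_one hF
  have vl := poincare_var ha.le hlam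
  set m := ∫ z, F z ∂gaussVec n 1 with hm
  set lb := ∫ z, lamf z ∂gaussVec n 1 with hlb
  obtain ⟨i1, e1⟩ := int_sq_sub F hFL m
  obtain ⟨i2, e2⟩ := int_sq_sub lamf hlL lb
  obtain ⟨i3, e3⟩ := int_sq_sub lamf hlL μ
  rw [← hm] at e1
  rw [← hlb] at e2 e3
  set VF := ∫ z, F z ^ 2 ∂gaussVec n 1 - m ^ 2 with hVF
  set Vl := ∫ z, lamf z ^ 2 ∂gaussVec n 1 - lb ^ 2 with hVl
  have pw : ∀ z, m ^ 2 ≤ 16 / 3 * U z + 16 / 9 * V ^ 2 * (lamf z - μ) ^ 2 + 4 * (F z - m) ^ 2 +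
      m ^ 2 / (4 * a ^ 2) * (lamf z - lb) ^ 2 := by
    intro z
    have hm4 : 0 ≤ m ^ 2 / (4 * a ^ 2) := by positivity
    by_cases h : lamf z ≤ μ
    · have h1 := hA z h
      have h2 := Real.sq_sqrt (hU0 z)
      set g := Real.sqrt (U z) with hg
      set w := (μ - lamf z) * V with hw
      have h3 : F z ^ 2 ≤ (g + w) ^ 2 := pow_le_pow_left₀ (hF0 z) h1 2
      have h4 : m ^ 2 ≤ 4 / 3 * F z ^ 2 + 4 * (F z - m) ^ 2 := by nlinarith [sq_nonneg (4 * F z - 3 * m)]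
      have h5 : (g + w) ^ 2 ≤ 4 * g ^ 2 + 4 / 3 * w ^ 2 := by nlinarith [sq_nonneg (3 * g - w)]
      have h6 : w ^ 2 = V ^ 2 * (lamf z - μ) ^ 2 := by rw [hw]; ring
      have h7 : 0 ≤ m ^ 2 / (4 * a ^ 2) * (lamf z - lb) ^ 2 := by positivity
      nlinarith
    · push Not at h
      have h1 : 2 * a ≤ lamf z - lb := by linarith
      have h2 : 4 * a ^ 2 ≤ (lamf z - lb) ^ 2 := by nlinarith
      have h3 := mul_le_mul_of_nonneg_left h2 hm4
      rw [div_mul_cancel₀ _ (by positivity)] at h3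
      have h4 := hU0 z
      have h5 : 0 ≤ 16 / 9 * V ^ 2 * (lamf z - μ) ^ 2 + 4 * (F z - m) ^ 2 := by positivity
      linarith
  have j1 : Integrable (fun z => 16 / 3 * U z) (gaussVec n 1) := hU.const_mul _
  have j2 : Integrable (fun z => 16 / 9 * V ^ 2 * (lamf z - μ) ^ 2) (gaussVec n 1) := i3.const_mul _
  have j3 : Integrable (fun z => 4 * (F z - m) ^ 2) (gaussVec n 1) := i1.const_mul _
  have j4 : Integrable (fun z => m ^ 2 / (4 * a ^ 2) * (lamf z - lb) ^ 2) (gaussVec n 1) := i2.const_mul _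
  have j12 : Integrable (fun z => 16 / 3 * U z + 16 / 9 * V ^ 2 * (lamf z - μ) ^ 2) (gaussVec n 1) := j1.add j2
  have j123 : Integrable (fun z => 16 / 3 * U z + 16 / 9 * V ^ 2 * (lamf z - μ) ^ 2 + 4 * (F z - m) ^ 2) (gaussVec n 1) :=
    j12.add j3
  have h_int := integral_mono (μ := gaussVec n 1) (integrable_const (m ^ 2)) (j123.add j4) pw
  simp only [Pi.add_apply] at h_int
  rw [integral_add j123 j4, integral_add j12 j3, integral_add j1 j2, integral_const_mul, integral_const_mul,
    integral_const_mul, integral_const_mul, e1, e2, e3] at h_int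
  simp only [integral_const, probReal_univ, one_smul, sub_self] at h_int
  set EU := ∫ z, U z ∂gaussVec n 1 with hEU
  have hEF : ∫ z, F z ^ 2 ∂gaussVec n 1 = VF + m ^ 2 := by rw [hVF]; ring
  rw [hEF]
  have hEU0 : 0 ≤ EU := integral_nonneg hU0
  have k1 : m ^ 2 / (4 * a ^ 2) * (Vl + 0 ^ 2) ≤ 5 / 16 * m ^ 2 := by
    have : m ^ 2 / (4 * a ^ 2) * (Vl + 0 ^ 2) ≤ m ^ 2 / (4 * a ^ 2) * (5 / 4 * a ^ 2) := by
      gcongr; linarith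
    refine this.trans (le_of_eq ?_)
    field_simp; norm_num
  set d := μ - (lb + 2 * a) with hd
  have k2 : Vl + (lb - μ) ^ 2 ≤ 3 / 2 * d ^ 2 + 53 / 4 * a ^ 2 := by
    have : lb - μ = - (d + 2 * a) := by rw [hd]; ring
    rw [this]
    have h9 := sq_nonneg (d - 4 * a)
    have h10 : (-(d + 2 * a)) ^ 2 = 3 / 2 * d ^ 2 + 12 * a ^ 2 - 1 / 2 * (d - 4 * a) ^ 2 := by ring
    rw [h10]
    linarith
  have k3 : 16 / 9 * V ^ 2 * (Vl + (lb - μ) ^ 2) ≤ 16 / 9 * V ^ 2 * (3 / 2 * d ^ 2 + 53 / 4 * a ^ 2) := by gcongr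
  have k4 : 0 ≤ V ^ 2 * d ^ 2 := by positivity
  have k5 : 0 ≤ V ^ 2 * a ^ 2 := by positivity
  have k6 : 16 / 9 * V ^ 2 * (3 / 2 * d ^ 2 + 53 / 4 * a ^ 2) = 8 / 3 * (V ^ 2 * d ^ 2) + 212 / 9 * (V ^ 2 * a ^ 2) := by ring
  have k7 : 4 * d ^ 2 * V ^ 2 = 4 * (V ^ 2 * d ^ 2) := by ring
  rw [k7]
  rw [k6] at k3
  norm_num at vF h_int k1
  linarith

end

/-- Theorem: risk of the penalized trend filtering estimator for
`λ ≥ λ*` when `D^{(r)}θ* ≠ 0`. -/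
theorem stmt5 (r : ℕ) (hr : 1 ≤ r) :
    ∃ C : ℝ, 0 < C ∧
      ∀ (n : ℕ), 2 * r ≤ n → ∀ σ : ℝ, 0 < σ → ∀ θstar : Fin n → ℝ,
        (∃ t < n - r, DD r θstar t ≠ 0) →
        ∀ (k : ℕ) (j : Fin k → ℕ) (sg : Fin k → ℝ), IsKnotSeq r n θstar k j sg →
        ∀ vstar : Fin n → ℝ, IsMinNormIn vstar (subdiff (fun α => Dl1 r α) θstar) →
        ∀ v0 : Fin n → ℝ,
          IsMinNormIn v0
            ((affineSpan ℝ (subdiff (fun α => Dl1 r α) θstar) : Set (Fin n → ℝ))) →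
        ∀ lamfun : (Fin n → ℝ) → ℝ, IsLamFun (subdiff (fun α => Dl1 r α) θstar) lamfun →
        ∀ lamstar : ℝ,
          lamstar = (n : ℝ) ^ (1 - (r : ℤ)) *
            ((∫ z, lamfun z ∂gaussVec n 1) + 2 / eunorm v0) →
        ∀ lam : ℝ, lamstar ≤ lam →
        ∀ est : (Fin n → ℝ) → Fin n → ℝ, IsPenEst r σ lam est →
          risk σ est θstar ≤
            C * σ ^ 2 * DeltaR n r k j sg +
              64 * σ ^ 2 / (n : ℝ) * (sqnorm vstar / sqnorm v0) +
              4 * σ ^ 2 / (n : ℝ) ^ ((3 : ℤ) - 2 * (r : ℤ)) * (lam - lamstar) ^ 2 *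
                sqnorm vstar := by
  obtain ⟨C, hC, HG⟩ := gbound r hr
  refine ⟨8 * C + 10, by positivity, ?_⟩
  intro n hn σ hσ θ hne k j sg hks vstar hvs v0 hv0 lamfun hl lamstar hls lam hlam est hest
  obtain ⟨hone, U, hUi, hUE, hUz⟩ := HG n hn θ hne k j sg hks
  set S := subdiff (fun α => Dl1 r α) θ with hS
  have hnpos : (0:ℝ) < n := by exact_mod_cast (by omega : 0 < n)
  have hSne : S.Nonempty := ⟨vstar, hvs.1⟩
  have hScl : IsClosed S := sub_closed _ _
  have hconv : ∀ v ∈ S, ∀ w ∈ S, ∀ a b : ℝ, 0 ≤ a → 0 ≤ b → a + b = 1 → a • v + b • w ∈ S :=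
    fun v hv w hw a b ha hb hab => sub_convex _ _ v w hv hw a b ha hb hab
  have hf0 : 0 < Dl1 r θ := by
    obtain ⟨t, ht, htne⟩ := hne
    unfold Dl1
    exact Finset.sum_pos' (fun _ _ => abs_nonneg _) ⟨t, Finset.mem_range.2 ht, abs_pos.2 htne⟩
  obtain ⟨hv0p, hv0S⟩ := v0_facts S θ v0 (Dl1 r θ) hf0 (fun v hv => sub_theta r θ v hv) hv0
  have hlip := lam_lip S hSne hScl hconv v0 hv0p hv0S lamfun hl
  set a := 1 / eunorm v0 with ha
  have ha0 : 0 < a := by positivity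
  have hq0 : (0:ℝ) < (n:ℝ) ^ ((r:ℤ) - 1) := zpow_pos hnpos _
  set q := (n:ℝ) ^ ((r:ℤ) - 1) with hq
  have hqinv : (n:ℝ) ^ (1 - (r:ℤ)) = q⁻¹ := by rw [hq, ← zpow_neg]; congr 1; ring
  set lb := ∫ z, lamfun z ∂gaussVec n 1 with hlb
  have hlb0 : 0 ≤ lb := integral_nonneg fun z => (hl z).1
  have hmustar : q * lamstar = lb + 2 * a := by
    rw [hls, hqinv, mul_inv_cancel_left₀ hq0.ne', ha]; ring
  set μ := q * lam with hμ
  have hμle : lb + 2 * a ≤ μ := by rw [← hmustar, hμ]; gcongr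
  have hμ0 : 0 < μ := by linarith
  set F : (Fin n → ℝ) → ℝ := fun z => distSet z (scaleSet μ S) with hF
  have hFne : (scaleSet μ S).Nonempty := hSne.image _
  have hFlip : ∀ x y, |F x - F y| ≤ 1 * eunorm (x - y) := distSet_lip _ hFne
  have hF0 : ∀ z, 0 ≤ F z := fun z => distSet_nonneg _ _
  have hU0 : ∀ z, 0 ≤ U z := fun z => by
    obtain ⟨c, _, v, _, h⟩ := hUz z
    exact (sqnorm_nonneg _).trans h
  have hA : ∀ z, lamfun z ≤ μ → F z ≤ Real.sqrt (U z) + (μ - lamfun z) * eunorm vstar := by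
    intro z hz
    obtain ⟨v, hv, hvm⟩ := lam_proj S hSne hScl lamfun hl z
    obtain ⟨c, hc, u, hu, hUu⟩ := hUz z
    have h1 : eunorm (z - lamfun z • v) ≤ Real.sqrt (U z) :=
      (hvm c hc u hu).trans (Real.sqrt_le_sqrt hUu)
    have hl0 := (hl z).1
    have hmem : lamfun z • v + (μ - lamfun z) • vstar ∈ scaleSet μ S := by
      refine ⟨(lamfun z / μ) • v + ((μ - lamfun z) / μ) • vstar,
        hconv v hv vstar hvs.1 _ _ (by positivity) (div_nonneg (by linarith) hμ0.le) (by field_simp; ring), ?_⟩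
      simp only []
      rw [smul_add, smul_smul, smul_smul, mul_div_cancel₀ _ hμ0.ne', mul_div_cancel₀ _ hμ0.ne']
    have h2 := distSet_le z _ _ hmem
    have h3 : z - (lamfun z • v + (μ - lamfun z) • vstar) = (z - lamfun z • v) + (-(μ - lamfun z)) • vstar := by module
    rw [h3] at h2
    have h4 := eunorm_add (z - lamfun z • v) ((-(μ - lamfun z)) • vstar)
    rw [eunorm_smul, abs_neg, abs_of_nonneg (by linarith : 0 ≤ μ - lamfun z)] at h4
    linarith
  have hmom := moment_bound F lamfun U a (eunorm vstar) μ ha0 (eunorm_nonneg _) hF0 hFlip hlip hUi hU0 hμle hA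
  have hFc : Continuous F := (eulip_lipschitz zero_le_one hFlip).continuous
  have hFL : MemLp F 2 (gaussVec n 1) := eulip_bound hFlip zero_le_one
  have hpen : ∀ ξ, sqnorm (est (θ + ξ) - θ) ≤ σ ^ 2 * F (fun i => σ⁻¹ * ξ i) ^ 2 := by
    intro ξ
    rw [← mul_pow, ← eunorm_sq]
    refine pow_le_pow_left₀ (eunorm_nonneg _) ?_ 2
    have h1 : σ⁻¹ * eunorm (est (θ + ξ) - θ) ≤ F (fun i => σ⁻¹ * ξ i) := by
      refine le_distSet _ _ hFne _ ?_
      rintro _ ⟨v, hv, rfl⟩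
      have h2 := pen_det r θ (θ + ξ) (est (θ + ξ)) v (σ * μ) (by positivity) hv (by
        intro x
        have := hest (θ + ξ) x
        rw [hμ, ← mul_assoc]; exact this)
      have h3 : (fun i => σ⁻¹ * ξ i) - μ • v = σ⁻¹ • (θ + ξ - θ - (σ * μ) • v) := by
        rw [smul_sub, smul_smul, ← mul_assoc, inv_mul_cancel₀ hσ.ne', one_mul, add_sub_cancel_left]
        rfl
      simp only []
      rw [h3, eunorm_smul, abs_of_pos (by positivity)]
      gcongr
    calc eunorm (est (θ + ξ) - θ) = σ * (σ⁻¹ * eunorm (est (θ + ξ) - θ)) := by field_simp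
      _ ≤ _ := by gcongr
  set G : (Fin n → ℝ) → ℝ := fun ξ => σ ^ 2 * F (fun i => σ⁻¹ * ξ i) ^ 2 with hG
  have hGc : Continuous G := by
    have : Continuous fun ξ : Fin n → ℝ => F (fun i => σ⁻¹ * ξ i) := hFc.comp (by fun_prop)
    exact continuous_const.mul (this.pow 2)
  have hmp := gaussVec_smul n σ
  have hcomp : ∀ z : Fin n → ℝ, G (fun i => σ * z i) = σ ^ 2 * F z ^ 2 := by
    intro z
    simp only [hG, inv_mul_cancel_left₀ hσ.ne']
  have hGi : Integrable G (gaussVec n σ) := by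
    rw [← hmp.integrable_comp hGc.aestronglyMeasurable]
    have : (G ∘ fun z : Fin n → ℝ => fun i => σ * z i) = fun z => σ ^ 2 * F z ^ 2 := funext hcomp
    rw [this]
    exact hFL.integrable_sq.const_mul _
  have hGint : ∫ ξ, G ξ ∂gaussVec n σ = σ ^ 2 * ∫ z, F z ^ 2 ∂gaussVec n 1 := by
    rw [← hmp.map_eq, integral_map hmp.measurable.aemeasurable hGc.aestronglyMeasurable]
    simp only [hcomp]
    rw [integral_const_mul]
  have hI : ∫ ξ, sqnorm (est (θ + ξ) - θ) ∂gaussVec n σ ≤ σ ^ 2 * ∫ z, F z ^ 2 ∂gaussVec n 1 := by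
    rw [← hGint]
    exact integral_mono_of_nonneg (Filter.Eventually.of_forall fun _ => sqnorm_nonneg _) hGi
      (Filter.Eventually.of_forall hpen)
  have e1 : eunorm vstar ^ 2 * a ^ 2 = sqnorm vstar / sqnorm v0 := by
    rw [ha, div_pow, one_pow, eunorm_sq, eunorm_sq]; ring
  have e2 : μ - (lb + 2 * a) = q * (lam - lamstar) := by rw [← hmustar, hμ]; ring
  rw [e1, e2, eunorm_sq] at hmom
  have e3 : (n:ℝ) ^ ((3:ℤ) - 2 * (r:ℤ)) = n / q ^ 2 := by
    rw [hq, ← zpow_natCast, ← zpow_mul, div_eq_mul_inv, ← zpow_neg]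
    nth_rw 2 [← zpow_one (n:ℝ)]
    rw [← zpow_add₀ hnpos.ne']
    congr 1; push_cast; ring
  rw [e3]
  unfold risk
  have hfin : ∫ ξ, sqnorm (est (θ + ξ) - θ) ∂gaussVec n σ ≤ σ ^ 2 * ((8 * C + 10) * (n * DeltaR n r k j sg) +
      64 * (sqnorm vstar / sqnorm v0) + 4 * (q * (lam - lamstar)) ^ 2 * sqnorm vstar) := by
    refine hI.trans (mul_le_mul_of_nonneg_left ?_ (sq_nonneg σ))
    refine hmom.trans ?_
    linarith
  calc 1 / (n:ℝ) * ∫ ξ, sqnorm (est (θ + ξ) - θ) ∂gaussVec n σ ≤ 1 / (n:ℝ) * (σ ^ 2 * ((8 * C + 10) * (n * DeltaR n r k j sg) +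
      64 * (sqnorm vstar / sqnorm v0) + 4 * (q * (lam - lamstar)) ^ 2 * sqnorm vstar)) := by gcongr
    _ = _ := by
      have := hq0.ne'
      generalize sqnorm vstar / sqnorm v0 = ρ
      field_simp
end
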